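/- arXiv:math/0407206 — 2 statements merged into one kernel-verified Lean document; each statement's English description precedes it below -/
import Mathlib

section
/- Let T₁, T₂ be geometric actions of a finitely presented group G on ℝ-trees. Then the intersection number i(T₁, T₂) is finite. -/
/-!
Formalization of definitions from V. Guirardel,
"Core and intersection number for group actions on trees".
-/

open Set Metric Filter Function Topology
open scoped ENNReal Pointwise

noncomputable section

namespace Guirardel

/-- The metric segment `[x,y]`: the set of points lying metrically between `x` and `y`.
In an `ℝ`-tree this is the image of the geodesic from `x` to `y`. -/
def seg {T : Type*} [MetricSpace T] (x y : T) : Set T :=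
  {p : T | dist x p + dist p y = dist x y}

/-- The open segment `]x,y[`. -/
def openSeg {T : Type*} [MetricSpace T] (x y : T) : Set T :=
  seg x y \ {x, y}

/-- A subset of an `ℝ`-tree is convex (i.e. a subtree when nonempty) if it contains the
segment between any two of its points. -/
def TreeConvex {T : Type*} [MetricSpace T] (S : Set T) : Prop :=
  ∀ x ∈ S, ∀ y ∈ S, seg x y ⊆ S

/-- An `ℝ`-tree: any two points are joined by a geodesic, and any two injective paths
with the same endpoints have the same image (uniqueness of arcs). -/
structure IsRTree (T : Type*) [MetricSpace T] : Prop where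
  exists_geod : ∀ x y : T, ∃ f : ℝ → T, f 0 = x ∧ f (dist x y) = y ∧
    ∀ s ∈ Icc (0 : ℝ) (dist x y), ∀ t ∈ Icc (0 : ℝ) (dist x y),
      dist (f s) (f t) = |s - t|
  arc_unique : ∀ (x y : T) (γ₁ γ₂ : Path x y),
    Function.Injective γ₁ → Function.Injective γ₂ →
      Set.range γ₁ = Set.range γ₂

/-- A direction based at `x`: a connected component of the complement of `x`. -/
def IsDirectionAt {T : Type*} [MetricSpace T] (δ : Set T) (x : T) : Prop :=
  ∃ y : T, y ≠ x ∧ δ = connectedComponentIn {x}ᶜ y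

/-- A direction in a tree. -/
def IsDirection {T : Type*} [MetricSpace T] (δ : Set T) : Prop :=
  ∃ x : T, IsDirectionAt δ x

/-- A branch point: a point with at least three directions. -/
def IsBranchPoint {T : Type*} [MetricSpace T] (x : T) : Prop :=
  ∃ δ₁ δ₂ δ₃ : Set T, IsDirectionAt δ₁ x ∧ IsDirectionAt δ₂ x ∧ IsDirectionAt δ₃ x ∧
    δ₁ ≠ δ₂ ∧ δ₁ ≠ δ₃ ∧ δ₂ ≠ δ₃

/-- A quadrant in `T₁ × T₂`: a product of two directions. -/
def IsQuadrant {T₁ T₂ : Type*} [MetricSpace T₁] [MetricSpace T₂]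
    (Q : Set (T₁ × T₂)) : Prop :=
  ∃ (δ₁ : Set T₁) (δ₂ : Set T₂), IsDirection δ₁ ∧ IsDirection δ₂ ∧ Q = δ₁ ×ˢ δ₂

/-- A quadrant is heavy if (for every choice of base point, which does not matter) there
is a sequence of orbit points inside it whose two coordinates go to infinity. -/
def Heavy (G : Type*) {T₁ T₂ : Type*} [Group G] [MetricSpace T₁] [MetricSpace T₂]
    [MulAction G T₁] [MulAction G T₂] (Q : Set (T₁ × T₂)) : Prop :=
  ∀ p : T₁ × T₂, ∃ γ : ℕ → G,
    (∀ k, ((γ k • p.1 : T₁), (γ k • p.2 : T₂)) ∈ Q) ∧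
    Tendsto (fun k => dist (γ k • p.1) p.1) atTop atTop ∧
    Tendsto (fun k => dist (γ k • p.2) p.2) atTop atTop

/-- The core of `T₁ × T₂`: the complement of the union of all light (i.e. non-heavy)
quadrants; equivalently the set of points all of whose quadrants are heavy. -/
def Core (G T₁ T₂ : Type*) [Group G] [MetricSpace T₁] [MetricSpace T₂]
    [MulAction G T₁] [MulAction G T₂] : Set (T₁ × T₂) :=
  {z : T₁ × T₂ | ∀ Q : Set (T₁ × T₂), IsQuadrant Q → z ∈ Q → Heavy G Q}

/-- A subset of `T₁ × T₂` has convex fibers if its horizontal and vertical fibers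
are convex. -/
def ConvexFibers {T₁ T₂ : Type*} [MetricSpace T₁] [MetricSpace T₂]
    (E : Set (T₁ × T₂)) : Prop :=
  (∀ x₁ : T₁, TreeConvex {y₂ : T₂ | (x₁, y₂) ∈ E}) ∧
  (∀ x₂ : T₂, TreeConvex {y₁ : T₁ | (y₁, x₂) ∈ E})

/-- The action of `G` on `T` is by isometries. -/
def IsometricAction (G T : Type*) [MetricSpace T] [SMul G T] : Prop :=
  ∀ (g : G) (x y : T), dist (g • x) (g • y) = dist x y

/-- `g` is elliptic: it fixes a point of `T`. -/
def Elliptic {G : Type*} (T : Type*) [SMul G T] (g : G) : Prop :=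
  ∃ x : T, g • x = x

/-- `g` is hyperbolic: it fixes no point of `T`. -/
def Hyperbolic {G : Type*} (T : Type*) [SMul G T] (g : G) : Prop :=
  ∀ x : T, g • x ≠ x

/-- Translation length of `g` on `T`. -/
def translationLength {G : Type*} (T : Type*) [MetricSpace T] [SMul G T] (g : G) : ℝ :=
  ⨅ x : T, dist x (g • x)

/-- The axis (characteristic set) of `g`: points minimizing displacement. -/
def axisSet {G : Type*} (T : Type*) [MetricSpace T] [SMul G T] (g : G) : Set T :=
  {x : T | ∀ y : T, dist x (g • x) ≤ dist y (g • y)}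

/-- The action is non-trivial: some element is hyperbolic. -/
def NontrivialAction (G T : Type*) [SMul G T] : Prop :=
  ∃ g : G, ∀ x : T, g • x ≠ x

/-- The action is free: only the identity fixes a point. -/
def FreeAction (G T : Type*) [Group G] [MulAction G T] : Prop :=
  ∀ g : G, g ≠ 1 → ∀ x : T, g • x ≠ x

/-- The action is minimal: no proper nonempty invariant subtree. -/
def MinimalAction (G T : Type*) [MetricSpace T] [SMul G T] : Prop :=
  ∀ S : Set T, S.Nonempty → TreeConvex S → (∀ g : G, ∀ x ∈ S, g • x ∈ S) → S = univ

/-- The minimal subtree for the subset `H` of `G`: the intersection of all nonempty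
invariant subtrees. -/
def minSubtreeOf {G : Type*} (H : Set G) (T : Type*) [MetricSpace T] [SMul G T] : Set T :=
  ⋂₀ {S : Set T | S.Nonempty ∧ TreeConvex S ∧ ∀ g ∈ H, ∀ x ∈ S, g • x ∈ S}

/-- The minimal subtree of the `G`-action. -/
def minSubtree (G T : Type*) [MetricSpace T] [SMul G T] : Set T :=
  minSubtreeOf (univ : Set G) T

/-- A line in `T`: the image of an isometric embedding of `ℝ`. -/
def IsLine {T : Type*} [MetricSpace T] (L : Set T) : Prop :=
  ∃ f : ℝ → T, (∀ s t : ℝ, dist (f s) (f t) = |s - t|) ∧ L = range f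

/-- A ray in `T`: the image of an isometric embedding of `[0,∞)`. -/
def IsRay {T : Type*} [MetricSpace T] (R : Set T) : Prop :=
  ∃ f : ℝ → T, (∀ s ∈ Ici (0 : ℝ), ∀ t ∈ Ici (0 : ℝ), dist (f s) (f t) = |s - t|) ∧
    R = f '' Ici 0

/-- Two rays (or subsets) define the same end when they are at finite Hausdorff distance. -/
def SameEnd {T : Type*} [MetricSpace T] (R R' : Set T) : Prop :=
  EMetric.hausdorffEdist R R' ≠ ⊤

/-- The action of `G` fixes an end of `T`. -/
def GFixedEnd (G T : Type*) [MetricSpace T] [SMul G T] : Prop :=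
  ∃ R : Set T, IsRay R ∧ ∀ g : G, SameEnd ((fun x => g • x) '' R) R

/-- The action of `G` has an invariant line. -/
def GInvariantLine (G T : Type*) [MetricSpace T] [SMul G T] : Prop :=
  ∃ L : Set T, IsLine L ∧ ∀ g : G, (fun x => g • x) '' L = L

/-- The action is irreducible: no invariant line and no fixed end. -/
def IrreducibleAction (G T : Type*) [MetricSpace T] [SMul G T] : Prop :=
  ¬ GInvariantLine G T ∧ ¬ GFixedEnd G T

/-- The action is dihedral: there is an invariant line on which some element acts as a
reflection (i.e. with non-constant displacement along the line). -/
def DihedralAction (G T : Type*) [MetricSpace T] [SMul G T] : Prop :=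
  ∃ L : Set T, IsLine L ∧ (∀ g : G, (fun x => g • x) '' L = L) ∧
    ∃ g : G, ∃ x ∈ L, ∃ y ∈ L, dist x (g • x) ≠ dist y (g • y)

/-- `A` is a positive semi-axis of `g`: a ray contained in the axis of `g` and mapped
into itself by `g`. -/
def PosSemiAxis {G : Type*} (T : Type*) [MetricSpace T] [SMul G T] (g : G) (A : Set T) :
    Prop :=
  IsRay A ∧ A ⊆ axisSet T g ∧ (fun x => g • x) '' A ⊆ A

/-- `g` translates towards the end determined by the ray `R`:
`g` is hyperbolic and has a positive semi-axis defining the same end as `R`. -/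
def TranslatesToward {G : Type*} (T : Type*) [MetricSpace T] [SMul G T] (g : G)
    (R : Set T) : Prop :=
  Hyperbolic T g ∧ ∃ A : Set T, PosSemiAxis T g A ∧ SameEnd A R

/-- The end `ω_T(g)` of the hyperbolic element `g` lies in the set of ends of `δ`:
some positive semi-axis of `g` is contained in `δ`. -/
def EndInSubtree {G : Type*} (T : Type*) [MetricSpace T] [SMul G T] (g : G)
    (δ : Set T) : Prop :=
  ∃ A : Set T, PosSemiAxis T g A ∧ A ⊆ δ

/-- A map between `ℝ`-trees preserves alignment if the image of a point between `y`
and `z` lies between the images of `y` and `z`. -/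
def AlignPreserving {T T' : Type*} [MetricSpace T] [MetricSpace T'] (f : T → T') : Prop :=
  ∀ x y z : T, x ∈ seg y z → f x ∈ seg (f y) (f z)

/-- `f : T → T'` witnesses that `T` is a refinement of `T'`: it is an equivariant
continuous surjection preserving alignment. -/
def IsRefinementMap (G : Type*) {T T' : Type*} [Group G] [MetricSpace T] [MetricSpace T']
    [MulAction G T] [MulAction G T'] (f : T → T') : Prop :=
  Continuous f ∧ Surjective f ∧ AlignPreserving f ∧ ∀ (g : G) (x : T), f (g • x) = g • f x

/-- The length functions of the two actions are homothetic. -/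
def HomotheticLengths (G T₁ T₂ : Type*) [MetricSpace T₁] [MetricSpace T₂] [SMul G T₁]
    [SMul G T₂] : Prop :=
  ∃ c : ℝ, 0 < c ∧ ∀ g : G, translationLength T₁ g = c * translationLength T₂ g

/-- A bundled `ℝ`-tree with an isometric action of `G`. -/
structure GTree (G : Type*) [Group G] where
  carrier : Type
  [ms : MetricSpace carrier]
  [ma : MulAction G carrier]
  isom : ∀ (g : G) (x y : carrier), dist (g • x) (g • y) = dist x y
  tree : IsRTree carrier

attribute [instance] GTree.ms GTree.ma

/-- A simplicial structure on an `ℝ`-tree: a vertex set containing all branch points,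
meeting every segment in a finite set, and discrete. -/
def IsSimplicialStructure {T : Type*} [MetricSpace T] (V : Set T) : Prop :=
  (∀ x : T, IsBranchPoint x → x ∈ V) ∧
  (∀ x y : T, (seg x y ∩ V).Finite) ∧
  (∀ v ∈ V, ∃ ε > 0, ∀ w ∈ V, dist v w < ε → w = v)

/-- Two vertices of a simplicial tree are adjacent (span an edge). -/
def Adjacent {T : Type*} [MetricSpace T] (V : Set T) (v w : T) : Prop :=
  v ∈ V ∧ w ∈ V ∧ v ≠ w ∧ seg v w ∩ V = {v, w}

/-- A bundled simplicial `G`-tree. -/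
structure SimplicialGTree (G : Type*) [Group G] extends GTree G where
  V : Set carrier
  simp : IsSimplicialStructure V
  inv : ∀ g : G, (fun x => g • x) '' V = V

/-- `T₁` and `T₂` are refinements of a common non-trivial simplicial action of `G`. -/
def RefineCommonSimplicial (G T₁ T₂ : Type*) [Group G] [MetricSpace T₁] [MetricSpace T₂]
    [MulAction G T₁] [MulAction G T₂] : Prop :=
  ∃ T' : SimplicialGTree G, NontrivialAction G T'.carrier ∧
    (∃ f₁ : T₁ → T'.carrier, IsRefinementMap G f₁) ∧
    (∃ f₂ : T₂ → T'.carrier, IsRefinementMap G f₂)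

/-- Two directions face each other: their union is the whole tree. -/
def FacingDirections {T : Type*} [MetricSpace T] (δ δ' : Set T) : Prop :=
  δ ∪ δ' = univ

/-- There is a twice-light rectangle with (opposite) base corners `x` and `x'`:
two light quadrants based at `x` and `x'` facing each other. -/
def IsTwiceLightRect (G : Type*) {T₁ T₂ : Type*} [Group G] [MetricSpace T₁]
    [MetricSpace T₂] [MulAction G T₁] [MulAction G T₂] (x x' : T₁ × T₂) : Prop :=
  ∃ (δ₁ : Set T₁) (δ₂ : Set T₂) (δ₁' : Set T₁) (δ₂' : Set T₂),
    IsDirectionAt δ₁ x.1 ∧ IsDirectionAt δ₂ x.2 ∧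
    IsDirectionAt δ₁' x'.1 ∧ IsDirectionAt δ₂' x'.2 ∧
    x.1 ≠ x'.1 ∧ x.2 ≠ x'.2 ∧
    FacingDirections δ₁ δ₁' ∧ FacingDirections δ₂ δ₂' ∧
    ¬ Heavy G (δ₁ ×ˢ δ₂) ∧ ¬ Heavy G (δ₁' ×ˢ δ₂')

/-- The open rectangle with opposite corners `x, x'`. -/
def openRect {T₁ T₂ : Type*} [MetricSpace T₁] [MetricSpace T₂] (x x' : T₁ × T₂) :
    Set (T₁ × T₂) :=
  openSeg x.1 x'.1 ×ˢ openSeg x.2 x'.2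

/-- A maximal twice-light rectangle. -/
def IsMaxTwiceLightRect (G : Type*) {T₁ T₂ : Type*} [Group G] [MetricSpace T₁]
    [MetricSpace T₂] [MulAction G T₁] [MulAction G T₂] (x x' : T₁ × T₂) : Prop :=
  IsTwiceLightRect G x x' ∧ ∀ y y' : T₁ × T₂, IsTwiceLightRect G y y' →
    openRect x x' ⊆ openRect y y' → openRect x x' = openRect y y'

/-- The straight diagonal of a rectangle joining the two opposite corners `p` and `q`. -/
def mainDiag {T₁ T₂ : Type*} [MetricSpace T₁] [MetricSpace T₂] (p q : T₁ × T₂) :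
    Set (T₁ × T₂) :=
  {z : T₁ × T₂ | z.1 ∈ seg p.1 q.1 ∧ z.2 ∈ seg p.2 q.2 ∧
    dist p.1 z.1 * dist p.2 q.2 = dist p.2 z.2 * dist p.1 q.1}

/-- The augmented core: the union of the core and of the main diagonals of the maximal
twice-light rectangles (the diagonals joining the two opposite corners lying in the core). -/
def AugCore (G T₁ T₂ : Type*) [Group G] [MetricSpace T₁] [MetricSpace T₂]
    [MulAction G T₁] [MulAction G T₂] : Set (T₁ × T₂) :=
  Core G T₁ T₂ ∪
    {z : T₁ × T₂ | ∃ x x' p q : T₁ × T₂, IsMaxTwiceLightRect G x x' ∧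
      p ∈ Core G T₁ T₂ ∧ q ∈ Core G T₁ T₂ ∧
      ({p.1, q.1} : Set T₁) = {x.1, x'.1} ∧ ({p.2, q.2} : Set T₂) = {x.2, x'.2} ∧
      p.1 ≠ q.1 ∧ p.2 ≠ q.2 ∧ z ∈ mainDiag p q}

/-- There exists an equivariant (strong) deformation retraction of `T₁ × T₂` onto `C`. -/
def EquivDeformRetract (G : Type*) {T₁ T₂ : Type*} [Group G] [MetricSpace T₁]
    [MetricSpace T₂] [MulAction G T₁] [MulAction G T₂] (C : Set (T₁ × T₂)) : Prop :=
  ∃ H : ℝ → T₁ × T₂ → T₁ × T₂,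
    Continuous (fun p : ℝ × (T₁ × T₂) => H p.1 p.2) ∧
    (∀ z : T₁ × T₂, H 0 z = z) ∧
    (∀ z : T₁ × T₂, H 1 z ∈ C) ∧
    (∀ t : ℝ, ∀ z ∈ C, H t z = z) ∧
    (∀ (t : ℝ) (g : G) (z : T₁ × T₂), H t (g • z) = g • H t z)

/-- The `ℓ²` product distance on `T₁ × T₂`. -/
def dist2 {T₁ T₂ : Type*} [MetricSpace T₁] [MetricSpace T₂] (p q : T₁ × T₂) : ℝ :=
  Real.sqrt (dist p.1 q.1 ^ 2 + dist p.2 q.2 ^ 2)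

/-- The length of a path `c : [0,1] → T₁ × T₂`, measured with the `ℓ²` product metric. -/
def pathLen2 {T₁ T₂ : Type*} [MetricSpace T₁] [MetricSpace T₂] (c : ℝ → T₁ × T₂) :
    ℝ≥0∞ :=
  ⨆ (n : ℕ) (u : Fin (n + 1) → ℝ) (_ : Monotone u) (_ : ∀ i, u i ∈ Icc (0 : ℝ) 1),
    ∑ i : Fin n, ENNReal.ofReal (dist2 (c (u i.castSucc)) (c (u i.succ)))

/-- The path metric induced on a subset `C ⊆ T₁ × T₂` by the `ℓ²` product metric. -/
def pathDistOn {T₁ T₂ : Type*} [MetricSpace T₁] [MetricSpace T₂] (C : Set (T₁ × T₂))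
    (x y : C) : ℝ :=
  (⨅ (c : ℝ → T₁ × T₂) (_ : ContinuousOn c (Icc (0 : ℝ) 1))
      (_ : MapsTo c (Icc (0 : ℝ) 1) C) (_ : c 0 = (x : T₁ × T₂))
      (_ : c 1 = (y : T₁ × T₂)), pathLen2 c).toReal

/-- A distance function makes a set a CAT(0) space: it is a metric, geodesic, and the
CN-inequality of Bruhat–Tits holds (comparison triangles are at least as thick). -/
structure IsCAT0Dist {X : Type*} (d : X → X → ℝ) : Prop where
  refl : ∀ x, d x x = 0
  symm : ∀ x y, d x y = d y x
  triangle : ∀ x y z, d x z ≤ d x y + d y z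
  eq_of_dist_eq_zero : ∀ x y, d x y = 0 → x = y
  geodesic : ∀ x y, ∃ f : ℝ → X, f 0 = x ∧ f (d x y) = y ∧
    ∀ s ∈ Icc (0 : ℝ) (d x y), ∀ t ∈ Icc (0 : ℝ) (d x y), d (f s) (f t) = |s - t|
  cn : ∀ x y z m, d y m = d y z / 2 → d m z = d y z / 2 →
    d x m ^ 2 ≤ (d x y ^ 2 + d x z ^ 2) / 2 - d y z ^ 2 / 4

/-- A 2-cell of the core of a product of two simplicial trees: a rectangle which is a
product of two edges and is contained in the core. -/
def IsCoreCell (G : Type*) {T₁ T₂ : Type*} [Group G] [MetricSpace T₁] [MetricSpace T₂]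
    [MulAction G T₁] [MulAction G T₂] (V₁ : Set T₁) (V₂ : Set T₂)
    (R : Set (T₁ × T₂)) : Prop :=
  ∃ v₁ w₁ v₂ w₂, Adjacent V₁ v₁ w₁ ∧ Adjacent V₂ v₂ w₂ ∧
    R = seg v₁ w₁ ×ˢ seg v₂ w₂ ∧ R ⊆ Core G T₁ T₂


/-! ### Geometric actions: measured foliations on 2-complexes -/

attribute [local instance] Classical.decEq

/-- A big ambient vector space in which all the simplicial 2-complexes with cocompact
`G`-action that we need can be realized. -/
abbrev Amb (G : Type*) : Type _ := (G × ℕ) → ℝ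

/-- The transverse pseudo-distance of a measured foliation on a simplicial complex,
where the foliation is given by an affine map `fol s` on each face `s`: the infimum over
chains of points, consecutive ones lying in a common face, of the total transverse
measure. -/
def foliationDist {E : Type*} [AddCommGroup E] [Module ℝ E]
    (K : Geometry.SimplicialComplex ℝ E) (fol : Finset E → E →ᵃ[ℝ] ℝ) (x y : E) :
    ℝ≥0∞ :=
  ⨅ (n : ℕ) (c : Fin (n + 1) → E) (S : Fin n → Finset E)
    (_ : c 0 = x) (_ : c (Fin.last n) = y)
    (_ : ∀ i : Fin n, S i ∈ K.faces ∧
      c i.castSucc ∈ convexHull ℝ (S i : Set E) ∧ c i.succ ∈ convexHull ℝ (S i : Set E)),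
    ∑ i : Fin n, ENNReal.ofReal |fol (S i) (c i.castSucc) - fol (S i) (c i.succ)|

/-- A measured foliation on a simplicial 2-complex with a free, properly discontinuous,
cocompact, simplicial `G`-action, together with an identification of `T` with the leaf
space made Hausdorff (so that `T` is dual to the foliated complex). -/
structure GeometricStructure (G : Type*) [Group G] (T : Type*) [MetricSpace T]
    [MulAction G T] where
  /-- the underlying simplicial complex -/
  K : Geometry.SimplicialComplex ℝ (Amb G)
  nonempty : K.faces.Nonempty
  /-- the complex is 2-dimensional -/
  dim2 : ∀ s ∈ K.faces, s.card ≤ 3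
  /-- the `G`-action on the complex, by continuous affine automorphisms -/
  ρ : G →* Amb G ≃ᵃ[ℝ] Amb G
  contρ : ∀ g : G, Continuous (ρ g)
  mapsFaces : ∀ g : G, ∀ s ∈ K.faces, Finset.image (ρ g) s ∈ K.faces
  /-- the action is free -/
  freeAct : ∀ g : G, g ≠ 1 → ∀ x ∈ K.space, ρ g x ≠ x
  /-- the action is properly discontinuous -/
  pdisc : ∀ C C' : Set (Amb G), IsCompact C → IsCompact C' →
    {g : G | ((ρ g) '' (C ∩ K.space) ∩ C').Nonempty}.Finite
  /-- the action is cocompact: finitely many orbits of faces -/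
  cocompact : ∃ F : Set (Finset (Amb G)), F.Finite ∧ F ⊆ K.faces ∧
    ∀ s ∈ K.faces, ∃ t ∈ F, ∃ g : G, s = Finset.image (ρ g) t
  /-- the measured foliation: an affine map to `ℝ` on each face... -/
  fol : Finset (Amb G) → Amb G →ᵃ[ℝ] ℝ
  /-- ...compatible on faces of faces up to isometries of `ℝ`... -/
  fol_compat : ∀ s ∈ K.faces, ∀ t ∈ K.faces, t ⊆ s →
    ∃ ε c : ℝ, (ε = 1 ∨ ε = -1) ∧
      ∀ x ∈ convexHull ℝ (t : Set (Amb G)), fol t x = ε * fol s x + c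
  /-- ...and `G`-invariant up to isometries of `ℝ` -/
  fol_equivariant : ∀ g : G, ∀ s ∈ K.faces, ∃ ε c : ℝ, (ε = 1 ∨ ε = -1) ∧
    ∀ x ∈ convexHull ℝ (s : Set (Amb G)), fol (Finset.image (ρ g) s) (ρ g x) = ε * fol s x + c
  /-- the equivariant projection identifying `T` with the leaf space made Hausdorff -/
  proj : Amb G → T
  proj_equivariant : ∀ g : G, ∀ x ∈ K.space, proj (ρ g x) = g • proj x
  proj_surjective : ∀ t : T, ∃ x ∈ K.space, proj x = t
  proj_dist : ∀ x ∈ K.space, ∀ y ∈ K.space,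
    ENNReal.ofReal (dist (proj x) (proj y)) = foliationDist K fol x y
  /-- transverse edges embed isometrically in `T` -/
  edges_embed : ∀ s ∈ K.faces, s.card ≤ 2 →
    ∀ x ∈ convexHull ℝ (s : Set (Amb G)), ∀ y ∈ convexHull ℝ (s : Set (Amb G)),
      dist (proj x) (proj y) = |fol s x - fol s y|

/-- An action of a finitely generated group on an `ℝ`-tree is geometric if the tree is
equivariantly dual to a measured foliation on a simplicial 2-complex endowed with a
free, properly discontinuous, cocompact action of `G`. -/
def GeometricAction (G : Type*) [Group G] (T : Type*) [MetricSpace T] [MulAction G T] :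
    Prop :=
  Nonempty (GeometricStructure G T)

/-- A group is finitely presented. -/
def FinitelyPresentedGroup (G : Type*) [Group G] : Prop :=
  ∃ (n : ℕ) (rels : Finset (FreeGroup (Fin n))) (φ : FreeGroup (Fin n) →* G),
    Function.Surjective φ ∧
    φ.ker = Subgroup.normalClosure (rels : Set (FreeGroup (Fin n)))

/-- The intersection number `i(T₁,T₂)` of two actions: the covolume of the core for the
product of the (1-dimensional Hausdorff, i.e. length) measures on `T₁` and `T₂`: the
infimum of the measures of measurable sets whose `G`-orbit covers the core. -/
def intersectionNumber (G T₁ T₂ : Type*) [Group G] [MetricSpace T₁] [MetricSpace T₂]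
    [MeasurableSpace T₁] [BorelSpace T₁] [MeasurableSpace T₂] [BorelSpace T₂]
    [MulAction G T₁] [MulAction G T₂] : ℝ≥0∞ :=
  ⨅ (E : Set (T₁ × T₂)) (_ : MeasurableSet E)
    (_ : Core G T₁ T₂ ⊆ ⋃ g : G, (fun z => g • z) '' E),
    ((MeasureTheory.Measure.hausdorffMeasure 1 : MeasureTheory.Measure T₁).prod
      (MeasureTheory.Measure.hausdorffMeasure 1 : MeasureTheory.Measure T₂)) E

/-! ### Segments in `ℝ`-trees -/

section Segments

variable {T : Type*} [MetricSpace T]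

theorem seg_comm (x y : T) : seg x y = seg y x := by
  ext p
  change dist x p + dist p y = dist x y ↔ dist y p + dist p x = dist y x
  rw [dist_comm x p, dist_comm p y, dist_comm x y, add_comm]

theorem left_mem_seg (x y : T) : x ∈ seg x y := by simp [seg]

theorem right_mem_seg (x y : T) : y ∈ seg x y := by simp [seg]

theorem eq_of_mem_seg_self {x p : T} (h : p ∈ seg x x) : p = x := by
  have h : dist x p + dist p x = dist x x := h
  rw [dist_self, dist_comm p x] at h
  exact (dist_eq_zero.1 (by linarith)).symm

/-- A unit speed geodesic parametrized by `[0, dist x y]`. -/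
def IsGeod (f : ℝ → T) (x y : T) : Prop :=
  f 0 = x ∧ f (dist x y) = y ∧
    ∀ s ∈ Icc (0 : ℝ) (dist x y), ∀ t ∈ Icc (0 : ℝ) (dist x y), dist (f s) (f t) = |s - t|

theorem IsGeod.dist_left {f : ℝ → T} {x y : T} (h : IsGeod f x y) {s : ℝ}
    (hs : s ∈ Icc (0 : ℝ) (dist x y)) : dist x (f s) = s := by
  have := h.2.2 0 ⟨le_rfl, dist_nonneg⟩ s hs
  rw [h.1] at this
  rw [this, zero_sub, abs_neg, abs_of_nonneg hs.1]

theorem IsGeod.dist_right {f : ℝ → T} {x y : T} (h : IsGeod f x y) {s : ℝ}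
    (hs : s ∈ Icc (0 : ℝ) (dist x y)) : dist (f s) y = dist x y - s := by
  have := h.2.2 s hs (dist x y) ⟨dist_nonneg, le_rfl⟩
  rw [h.2.1] at this
  rw [this, abs_sub_comm, abs_of_nonneg (by linarith [hs.2])]

theorem IsGeod.mem_seg {f : ℝ → T} {x y : T} (h : IsGeod f x y) {s : ℝ}
    (hs : s ∈ Icc (0 : ℝ) (dist x y)) : f s ∈ seg x y := by
  change _ + _ = _
  rw [h.dist_left hs, h.dist_right hs]; ring

theorem IsGeod.continuousOn {f : ℝ → T} {x y : T} (h : IsGeod f x y) :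
    ContinuousOn f (Icc 0 (dist x y)) := by
  refine (LipschitzOnWith.of_dist_le_mul (K := 1) fun s hs t ht => ?_).continuousOn
  rw [h.2.2 s hs t ht, NNReal.coe_one, one_mul, Real.dist_eq]

theorem IsGeod.injOn {f : ℝ → T} {x y : T} (h : IsGeod f x y) :
    InjOn f (Icc 0 (dist x y)) := by
  intro s hs t ht hst
  have := h.2.2 s hs t ht
  rw [hst, dist_self] at this
  linarith [abs_eq_zero.1 this.symm]

theorem IsRTree.exists_isGeod (hT : IsRTree T) (x y : T) : ∃ f : ℝ → T, IsGeod f x y :=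
  hT.exists_geod x y

/-- Two injective continuous curves with the same endpoints have the same image. -/
theorem IsRTree.image_eq (hT : IsRTree T) {x y : T} {a b : ℝ} (ha : 0 < a) (hb : 0 < b)
    {f g : ℝ → T} (hf : ContinuousOn f (Icc 0 a)) (hg : ContinuousOn g (Icc 0 b))
    (hfi : InjOn f (Icc 0 a)) (hgi : InjOn g (Icc 0 b))
    (hf0 : f 0 = x) (hf1 : f a = y) (hg0 : g 0 = x) (hg1 : g b = y) :
    f '' Icc 0 a = g '' Icc 0 b := by
  have key : ∀ {c : ℝ} (_ : 0 < c) {h : ℝ → T}, ContinuousOn h (Icc 0 c) →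
      InjOn h (Icc 0 c) → h 0 = x → h c = y →
      ∃ γ : Path x y, Function.Injective γ ∧ Set.range γ = h '' Icc 0 c := by
    intro c hc h hh hi h0 h1
    have hm : ∀ t : unitInterval, (t : ℝ) * c ∈ Icc 0 c := fun t =>
      ⟨mul_nonneg t.2.1 hc.le, by nlinarith [t.2.2]⟩
    refine ⟨⟨⟨fun t => h (t * c), ?_⟩, by simpa using h0, by simpa using h1⟩, ?_, ?_⟩
    · exact hh.comp_continuous (by fun_prop) hm
    · intro s t hst
      have := hi (hm s) (hm t) hst
      exact Subtype.ext (mul_right_cancel₀ hc.ne' this)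
    · ext z
      constructor
      · rintro ⟨t, rfl⟩
        exact ⟨_, hm t, rfl⟩
      · rintro ⟨t, ht, rfl⟩
        refine ⟨⟨t / c, div_nonneg ht.1 hc.le, (div_le_one hc).2 ht.2⟩, ?_⟩
        change h (t / c * c) = h t
        rw [div_mul_cancel₀ _ hc.ne']
  obtain ⟨γ₁, h₁, e₁⟩ := key ha hf hfi hf0 hf1
  obtain ⟨γ₂, h₂, e₂⟩ := key hb hg hgi hg0 hg1
  rw [← e₁, ← e₂]
  exact hT.arc_unique x y γ₁ γ₂ h₁ h₂

/-- If two segments `[x,p]` and `[p,y]` meet only at `p`, every geodesic from `x` to `y`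
passes through `p`. -/
theorem IsRTree.exists_eq_of_inter (hT : IsRTree T) {x p y : T}
    (hp : ∀ w ∈ seg x p, w ∈ seg p y → w = p) {h : ℝ → T} (hh : IsGeod h x y) :
    ∃ t ∈ Icc 0 (dist x y), h t = p := by
  rcases eq_or_ne x p with rfl | hxp
  · exact ⟨0, ⟨le_rfl, dist_nonneg⟩, hh.1⟩
  rcases eq_or_ne p y with rfl | hpy
  · exact ⟨_, ⟨dist_nonneg, le_rfl⟩, hh.2.1⟩
  have hxy : x ≠ y := by
    rintro rfl
    exact hxp (hp x (left_mem_seg _ _) (right_mem_seg _ _))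
  obtain ⟨f, hf⟩ := hT.exists_isGeod x p
  obtain ⟨g, hg⟩ := hT.exists_isGeod p y
  set r := dist x p with hr
  set s := dist p y with hs
  have hr0 : 0 < r := dist_pos.2 hxp
  have hs0 : 0 < s := dist_pos.2 hpy
  let k : ℝ → T := fun t => if t ≤ r then f t else g (t - r)
  have k1 : ∀ t, t ≤ r → k t = f t := fun t ht => if_pos ht
  have k2 : ∀ t, r < t → k t = g (t - r) := fun t ht => if_neg (not_le.2 ht)
  have hf1 : f r = p := hf.2.1
  have hmix : ∀ a b, a ∈ Icc 0 (r + s) → b ∈ Icc 0 (r + s) → a ≤ r → r < b →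
      dist (k a) (k b) ≤ |a - b| := by
    intro a b ha hb har hbr
    rw [k1 a har, k2 b hbr, abs_sub_comm, abs_of_pos (by linarith)]
    have e1 : dist (f a) p = r - a := hf.dist_right ⟨ha.1, har⟩
    have e2 : dist p (g (b - r)) = b - r :=
      hg.dist_left ⟨by linarith, by linarith [hb.2]⟩
    linarith [dist_triangle (f a) p (g (b - r))]
  have hk : ContinuousOn k (Icc 0 (r + s)) := by
    refine (LipschitzOnWith.of_dist_le_mul (K := 1) fun a ha b hb => ?_).continuousOn
    rw [NNReal.coe_one, one_mul, Real.dist_eq]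
    rcases le_or_gt a r with har | har <;> rcases le_or_gt b r with hbr | hbr
    · rw [k1 a har, k1 b hbr]
      exact (hf.2.2 a ⟨ha.1, har⟩ b ⟨hb.1, hbr⟩).le
    · exact hmix a b ha hb har hbr
    · rw [dist_comm, abs_sub_comm]
      exact hmix b a hb ha hbr har
    · rw [k2 a har, k2 b hbr,
        hg.2.2 (a - r) ⟨by linarith, by linarith [ha.2]⟩ (b - r) ⟨by linarith, by linarith [hb.2]⟩]
      simp
  have hne : ∀ a b, a ∈ Icc 0 (r + s) → b ∈ Icc 0 (r + s) → a ≤ r → r < b → k a ≠ k b := by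
    intro a b ha hb har hbr hab
    rw [k1 a har, k2 b hbr] at hab
    have hb' : b - r ∈ Icc 0 s := ⟨by linarith, by linarith [hb.2]⟩
    have e := hp (f a) (hf.mem_seg ⟨ha.1, har⟩) (hab ▸ hg.mem_seg hb')
    have e2 : dist p (g (b - r)) = b - r := hg.dist_left hb'
    rw [← hab, e, dist_self] at e2
    linarith
  have hki : InjOn k (Icc 0 (r + s)) := by
    intro a ha b hb hab
    rcases le_or_gt a r with har | har <;> rcases le_or_gt b r with hbr | hbr
    · rw [k1 a har, k1 b hbr] at hab
      exact hf.injOn ⟨ha.1, har⟩ ⟨hb.1, hbr⟩ hab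
    · exact absurd hab (hne a b ha hb har hbr)
    · exact absurd hab.symm (hne b a hb ha hbr har)
    · rw [k2 a har, k2 b hbr] at hab
      have := hg.injOn ⟨by linarith, by linarith [ha.2]⟩ ⟨by linarith, by linarith [hb.2]⟩ hab
      linarith
  have hk0 : k 0 = x := by rw [k1 0 hr0.le, hf.1]
  have hk1 : k (r + s) = y := by
    rw [k2 _ (by linarith), add_sub_cancel_left]; exact hg.2.1
  have him := hT.image_eq (by linarith) (dist_pos.2 hxy) hk hh.continuousOn hki hh.injOn
    hk0 hk1 hh.1 hh.2.1
  have : p ∈ k '' Icc 0 (r + s) := ⟨r, ⟨hr0.le, by linarith⟩, by rw [k1 r le_rfl, hf1]⟩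
  rw [him] at this
  exact this

theorem IsRTree.mem_seg_of_inter (hT : IsRTree T) {x p y : T}
    (hp : ∀ w ∈ seg x p, w ∈ seg p y → w = p) : p ∈ seg x y := by
  obtain ⟨h, hh⟩ := hT.exists_isGeod x y
  obtain ⟨t, ht, rfl⟩ := hT.exists_eq_of_inter hp hh
  exact hh.mem_seg ht

theorem IsRTree.seg_eq_image (hT : IsRTree T) {x y : T} {h : ℝ → T} (hh : IsGeod h x y) :
    seg x y = h '' Icc 0 (dist x y) := by
  refine Subset.antisymm (fun p hp => ?_) ?_
  · refine hT.exists_eq_of_inter (fun w hw hw' => ?_) hh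
    have hp : dist x p + dist p y = dist x y := hp
    have hw : dist x w + dist w p = dist x p := hw
    have hw' : dist p w + dist w y = dist p y := hw'
    have := dist_triangle x w y
    rw [dist_comm p w] at hw'
    exact dist_eq_zero.1 (le_antisymm (by linarith) dist_nonneg)
  · rintro _ ⟨t, ht, rfl⟩
    exact hh.mem_seg ht

theorem IsRTree.isCompact_seg (hT : IsRTree T) (x y : T) : IsCompact (seg x y) := by
  obtain ⟨h, hh⟩ := hT.exists_isGeod x y
  rw [hT.seg_eq_image hh]
  exact isCompact_Icc.image_of_continuousOn hh.continuousOn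

theorem IsRTree.isPreconnected_seg (hT : IsRTree T) (x y : T) : IsPreconnected (seg x y) := by
  obtain ⟨h, hh⟩ := hT.exists_isGeod x y
  rw [hT.seg_eq_image hh]
  exact isPreconnected_Icc.image _ hh.continuousOn

theorem IsRTree.exists_mem_seg_dist (hT : IsRTree T) {x y : T} {r : ℝ} (h0 : 0 ≤ r)
    (h1 : r ≤ dist x y) : ∃ p ∈ seg x y, dist x p = r := by
  obtain ⟨h, hh⟩ := hT.exists_isGeod x y
  exact ⟨h r, hh.mem_seg ⟨h0, h1⟩, hh.dist_left ⟨h0, h1⟩⟩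

theorem IsRTree.seg_dist (hT : IsRTree T) {x y u v : T} (hu : u ∈ seg x y) (hv : v ∈ seg x y) :
    dist u v = |dist x u - dist x v| := by
  obtain ⟨h, hh⟩ := hT.exists_isGeod x y
  rw [hT.seg_eq_image hh] at hu hv
  obtain ⟨s, hs, rfl⟩ := hu
  obtain ⟨t, ht, rfl⟩ := hv
  rw [hh.dist_left hs, hh.dist_left ht, hh.2.2 s hs t ht]

theorem IsRTree.eq_of_dist_eq (hT : IsRTree T) {x y u v : T} (hu : u ∈ seg x y)
    (hv : v ∈ seg x y) (h : dist x u = dist x v) : u = v :=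
  dist_eq_zero.1 (by rw [hT.seg_dist hu hv, h, sub_self, abs_zero])

theorem IsRTree.mem_seg_of_le (hT : IsRTree T) {x y u v : T} (hu : u ∈ seg x y)
    (hv : v ∈ seg x y) (h : dist x u ≤ dist x v) : u ∈ seg x v ∧ v ∈ seg u y := by
  have e := hT.seg_dist hu hv
  rw [abs_sub_comm, abs_of_nonneg (by linarith)] at e
  have hu : dist x u + dist u y = dist x y := hu
  have hv : dist x v + dist v y = dist x y := hv
  constructor
  · change dist x u + dist u v = dist x v
    linarith
  · change dist u v + dist v y = dist u y
    linarith

theorem seg_subset_left {x y p : T} (hp : p ∈ seg x y) : seg x p ⊆ seg x y := by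
  intro q hq
  have hp : dist x p + dist p y = dist x y := hp
  have hq : dist x q + dist q p = dist x p := hq
  change dist x q + dist q y = dist x y
  linarith [dist_triangle x q y, dist_triangle q p y]

theorem seg_subset_right {x y p : T} (hp : p ∈ seg x y) : seg p y ⊆ seg x y := by
  rw [seg_comm x y] at hp ⊢
  rw [seg_comm p y]
  exact seg_subset_left hp

theorem IsRTree.treeConvex_seg (hT : IsRTree T) (x y : T) : TreeConvex (seg x y) := by
  intro u hu v hv
  rcases le_total (dist x u) (dist x v) with h | h
  · exact (seg_subset_right (hT.mem_seg_of_le hu hv h).1).trans (seg_subset_left hv)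
  · rw [seg_comm]
    exact (seg_subset_right (hT.mem_seg_of_le hv hu h).1).trans (seg_subset_left hu)

/-- Every triangle is a tripod. -/
theorem IsRTree.exists_center (hT : IsRTree T) (x y z : T) :
    ∃ c, c ∈ seg x y ∧ c ∈ seg y z ∧ c ∈ seg x z := by
  obtain ⟨c, hc, hmin⟩ := (hT.isCompact_seg x y).exists_isMinOn ⟨x, left_mem_seg x y⟩
    (f := fun p => dist p z) (by fun_prop)
  have key : ∀ w ∈ seg x y, w ∈ seg c z → w = c := by
    intro w hw hw'
    have h1 : dist c z ≤ dist w z := hmin hw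
    have h2 : dist c w + dist w z = dist c z := hw'
    exact (dist_eq_zero.1 (le_antisymm (by linarith) dist_nonneg)).symm
  refine ⟨c, hc, hT.mem_seg_of_inter fun w hw hw' => ?_, hT.mem_seg_of_inter fun w hw hw' => ?_⟩
  · exact key w (seg_subset_right hc (seg_comm y c ▸ hw)) hw'
  · exact key w (seg_subset_left hc hw) hw'

/-- A point of `[x,y]` lies in `[x,z]` or in `[z,y]`. -/
theorem IsRTree.mem_seg_or (hT : IsRTree T) {x y m : T} (hm : m ∈ seg x y) (z : T) :
    m ∈ seg x z ∨ m ∈ seg z y := by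
  obtain ⟨c, hc, hc', hc''⟩ := hT.exists_center x y z
  rcases le_total (dist x m) (dist x c) with h | h
  · exact Or.inl (seg_subset_left hc'' (hT.mem_seg_of_le hm hc h).1)
  · right
    rw [seg_comm y z] at hc'
    exact seg_subset_right hc' (hT.mem_seg_of_le hc hm h).2

theorem not_mem_seg_of_dist_lt {x y m : T} (h : dist x y < dist x m) : m ∉ seg x y := by
  intro hm
  have hm : dist x m + dist m y = dist x y := hm
  linarith [dist_nonneg (x := m) (y := y)]

theorem TreeConvex.union {A B : Set T} (hT : IsRTree T) (hA : TreeConvex A) (hB : TreeConvex B)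
    (h : (A ∩ B).Nonempty) : TreeConvex (A ∪ B) := by
  obtain ⟨z, hzA, hzB⟩ := h
  intro x hx y hy m hm
  have key : ∀ w ∈ A ∪ B, seg w z ⊆ A ∪ B := by
    rintro w (hw | hw)
    · exact (hA w hw z hzA).trans subset_union_left
    · exact (hB w hw z hzB).trans subset_union_right
  rcases hT.mem_seg_or hm z with h | h
  · exact key x hx h
  · exact key y hy (seg_comm y z ▸ h)

theorem TreeConvex.iUnion_of_mem {ι : Sort*} {A : ι → Set T} (hT : IsRTree T)
    (hA : ∀ i, TreeConvex (A i)) (z : T) (hz : ∀ i, z ∈ A i) : TreeConvex (⋃ i, A i) := by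
  intro x hx y hy m hm
  rw [mem_iUnion] at hx hy ⊢
  obtain ⟨i, hi⟩ := hx
  obtain ⟨j, hj⟩ := hy
  rcases hT.mem_seg_or hm z with h | h
  · exact ⟨i, hA i x hi z (hz i) h⟩
  · exact ⟨j, hA j z (hz j) y hj h⟩

/-- A compact convex nonempty subset of a segment is a segment. -/
theorem IsRTree.exists_eq_seg (hT : IsRTree T) {x y : T} {A : Set T} (hA : A ⊆ seg x y)
    (hc : TreeConvex A) (hcl : IsClosed A) (hne : A.Nonempty) : ∃ a b, A = seg a b := by
  have hcomp : IsCompact A := (hT.isCompact_seg x y).of_isClosed_subset hcl hA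
  obtain ⟨a, ha, hamin⟩ := hcomp.exists_isMinOn hne (f := fun p => dist x p) (by fun_prop)
  obtain ⟨b, hb, hbmax⟩ := hcomp.exists_isMaxOn hne (f := fun p => dist x p) (by fun_prop)
  refine ⟨a, b, Subset.antisymm (fun p hp => ?_) (hc a ha b hb)⟩
  have h1 : dist x a ≤ dist x p := hamin hp
  have h2 : dist x p ≤ dist x b := hbmax hp
  have e1 := hT.seg_dist (hA ha) (hA hp)
  have e2 := hT.seg_dist (hA hp) (hA hb)
  have e3 := hT.seg_dist (hA ha) (hA hb)
  rw [abs_sub_comm, abs_of_nonneg (by linarith)] at e1 e2 e3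
  change _ + _ = _
  linarith

/-- The direction at `m` containing `x` consists of the points not separated from `x` by `m`. -/
theorem IsRTree.connectedComponentIn_eq (hT : IsRTree T) {m x : T} (hx : x ≠ m) :
    connectedComponentIn {m}ᶜ x = {z | m ∉ seg x z} := by
  have hxm : x ∈ ({m}ᶜ : Set T) := hx
  refine Subset.antisymm ?_ ?_
  · have hU : IsOpen {z | m ∉ seg x z} := by
      rw [Metric.isOpen_iff]
      intro z hz
      have hzm : z ≠ m := by rintro rfl; exact hz (right_mem_seg _ _)
      refine ⟨dist z m, dist_pos.2 hzm, fun w hw hw' => ?_⟩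
      rcases hT.mem_seg_or hw' z with h | h
      · exact hz h
      · exact not_mem_seg_of_dist_lt (by rw [dist_comm]; exact hw) h
    have hV : IsOpen {z | z ≠ m ∧ m ∈ seg x z} := by
      rw [Metric.isOpen_iff]
      rintro z ⟨hzm, hz⟩
      refine ⟨dist z m, dist_pos.2 hzm, fun w hw => ?_⟩
      rw [mem_ball, dist_comm] at hw
      refine ⟨by rintro rfl; exact lt_irrefl _ hw, ?_⟩
      rcases hT.mem_seg_or hz w with h | h
      · exact h
      · exact absurd (seg_comm w z ▸ h) (not_mem_seg_of_dist_lt hw)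
    refine IsPreconnected.subset_left_of_subset_union hU hV ?_ ?_ ?_
      isPreconnected_connectedComponentIn
    · rw [Set.disjoint_left]
      rintro z hz ⟨-, hz'⟩
      exact hz hz'
    · intro z hz
      have : z ≠ m := connectedComponentIn_subset _ _ hz
      by_cases h : m ∈ seg x z
      · exact Or.inr ⟨this, h⟩
      · exact Or.inl h
    · exact ⟨x, mem_connectedComponentIn hxm, fun h => hx (eq_of_mem_seg_self h).symm⟩
  · intro z hz
    have : seg x z ⊆ {m}ᶜ := by
      rintro w hw rfl
      exact hz hw
    exact (hT.isPreconnected_seg x z).subset_connectedComponentIn (left_mem_seg x z) this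
      (right_mem_seg x z)

theorem IsRTree.isOpen_direction (hT : IsRTree T) {δ : Set T} (hδ : IsDirection δ) :
    IsOpen δ := by
  obtain ⟨m, x, hx, rfl⟩ := hδ
  rw [hT.connectedComponentIn_eq hx, Metric.isOpen_iff]
  intro z hz
  have hzm : z ≠ m := by rintro rfl; exact hz (right_mem_seg _ _)
  refine ⟨dist z m, dist_pos.2 hzm, fun w hw hw' => ?_⟩
  rcases hT.mem_seg_or hw' z with h | h
  · exact hz h
  · exact not_mem_seg_of_dist_lt (by rw [dist_comm]; exact hw) h

/-- A point of `[x,m]` closer to `x` than the convex set `M ∋ m` separates `x` from `M`. -/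
theorem IsRTree.mem_seg_of_dist_lt (hT : IsRTree T) {M : Set T} (hM : TreeConvex M) {x m b : T}
    (hm : m ∈ M) (hb : b ∈ seg x m) (hd : ∀ w ∈ M, dist x b < dist x w) {w : T} (hw : w ∈ M) :
    b ∈ seg x w := by
  obtain ⟨c, hc, hc', hc''⟩ := hT.exists_center x m w
  exact seg_subset_left hc'' (hT.mem_seg_of_le hb hc (hd c (hM m hm w hw hc')).le).1

end Segments

/-! ### Length measure on `ℝ`-trees -/

section Length

open MeasureTheory Measure

variable {T : Type*} [MetricSpace T]

/-- The centre of a tripod is unique. -/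
theorem IsRTree.center_unique (hT : IsRTree T) {a b c y z : T} (h₁ : y ∈ seg a b)
    (h₂ : y ∈ seg b c) (h₃ : y ∈ seg a c) (k₁ : z ∈ seg a b) (k₂ : z ∈ seg b c)
    (k₃ : z ∈ seg a c) : y = z := by
  refine hT.eq_of_dist_eq h₁ k₁ ?_
  have h₁ : dist a y + dist y b = dist a b := h₁
  have h₂ : dist b y + dist y c = dist b c := h₂
  have h₃ : dist a y + dist y c = dist a c := h₃
  have k₁ : dist a z + dist z b = dist a b := k₁
  have k₂ : dist b z + dist z c = dist b c := k₂
  have k₃ : dist a z + dist z c = dist a c := k₃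
  rw [dist_comm b] at h₂ k₂
  linarith

theorem IsRTree.mem_seg_of_near (hT : IsRTree T) {a b y a' : T} (h : y ∈ seg a b)
    (ha : dist a a' < dist a y) : y ∈ seg a' b :=
  (hT.mem_seg_or h a').resolve_left (not_mem_seg_of_dist_lt ha)

/-- A point at which three directions meet. -/
def IsTripodCenter (y : T) : Prop :=
  ∃ a b c, a ≠ y ∧ b ≠ y ∧ c ≠ y ∧ y ∈ seg a b ∧ y ∈ seg b c ∧ y ∈ seg a c

theorem IsRTree.countable_tripodCenter [SecondCountableTopology T] (hT : IsRTree T) :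
    {y : T | IsTripodCenter y}.Countable := by
  obtain ⟨Q, hQc, hQ⟩ := TopologicalSpace.exists_countable_dense T
  have : {y : T | IsTripodCenter y} ⊆ ⋃ t ∈ Q ×ˢ (Q ×ˢ Q),
      {y | y ∈ seg t.1 t.2.1 ∧ y ∈ seg t.2.1 t.2.2 ∧ y ∈ seg t.1 t.2.2} := by
    rintro y ⟨a, b, c, ha, hb, hc, h₁, h₂, h₃⟩
    obtain ⟨a', ha', haQ⟩ := Metric.dense_iff.1 hQ a (dist a y) (dist_pos.2 ha)
    obtain ⟨b', hb', hbQ⟩ := Metric.dense_iff.1 hQ b (dist b y) (dist_pos.2 hb)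
    obtain ⟨c', hc', hcQ⟩ := Metric.dense_iff.1 hQ c (dist c y) (dist_pos.2 hc)
    rw [mem_ball, dist_comm] at ha' hb' hc'
    simp only [mem_iUnion]
    refine ⟨(a', b', c'), ⟨haQ, hbQ, hcQ⟩, ?_, ?_, ?_⟩
    · exact seg_comm b' a' ▸ hT.mem_seg_of_near (seg_comm a' b ▸ hT.mem_seg_of_near h₁ ha') hb'
    · exact seg_comm c' b' ▸ hT.mem_seg_of_near (seg_comm b' c ▸ hT.mem_seg_of_near h₂ hb') hc'
    · exact seg_comm c' a' ▸ hT.mem_seg_of_near (seg_comm a' c ▸ hT.mem_seg_of_near h₃ ha') hc'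
  refine Countable.mono this (Countable.biUnion (hQc.prod (hQc.prod hQc)) fun t _ => ?_)
  refine Set.Subsingleton.countable fun y hy z hz => ?_
  exact hT.center_unique hy.1 hy.2.1 hy.2.2 hz.1 hz.2.1 hz.2.2

/-- If a tree is covered by countably many segments, the frontier points added by taking the
closure of a convex subset are countably many. -/
theorem IsRTree.countable_closure_diff (hT : IsRTree T) {ι : Type*} [Countable ι] {p q : ι → T}
    (hpq : ⋃ j, seg (p j) (q j) = univ) {L : Set T} (hL : TreeConvex L) :
    (closure L \ L).Countable := by
  have : closure L \ L ⊆ ⋃ j, (closure L \ L) ∩ seg (p j) (q j) := by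
    rw [← inter_iUnion, hpq, inter_univ]
  refine Countable.mono this (countable_iUnion fun j => Set.Finite.countable ?_)
  by_contra hinf
  have hinj : InjOn (dist (p j)) ((closure L \ L) ∩ seg (p j) (q j)) :=
    fun u hu v hv huv => hT.eq_of_dist_eq hu.2 hv.2 huv
  obtain ⟨s, hs, hcard⟩ := (Set.Infinite.image hinj hinf).exists_subset_card_eq 3
  let f := s.orderEmbOfFin hcard
  have hf : ∀ i, ∃ u ∈ (closure L \ L) ∩ seg (p j) (q j), dist (p j) u = f i :=
    fun i => hs (s.orderEmbOfFin_mem hcard i)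
  obtain ⟨a, ha, ea⟩ := hf 0
  obtain ⟨b, hb, eb⟩ := hf 1
  obtain ⟨c, hc, ec⟩ := hf 2
  have hab : dist (p j) a < dist (p j) b := by rw [ea, eb]; exact f.strictMono (by decide)
  have hbc : dist (p j) b < dist (p j) c := by rw [eb, ec]; exact f.strictMono (by decide)
  have hne : a ≠ b := by rintro rfl; exact lt_irrefl _ hab
  have hne' : c ≠ b := by rintro rfl; exact lt_irrefl _ hbc
  have hseg : b ∈ seg a c := by
    have h1 := (hT.mem_seg_of_le ha.2 hb.2 hab.le).2
    have h2 := (hT.mem_seg_of_le hb.2 hc.2 hbc.le).2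
    have e1 := hT.seg_dist ha.2 hb.2
    have e2 := hT.seg_dist hb.2 hc.2
    have e3 := hT.seg_dist ha.2 hc.2
    rw [abs_sub_comm, abs_of_nonneg (by linarith)] at e1 e2 e3
    change _ + _ = _
    linarith
  obtain ⟨a', ha', haa⟩ := Metric.mem_closure_iff.1 ha.1.1 _ (dist_pos.2 hne)
  obtain ⟨c', hc', hcc⟩ := Metric.mem_closure_iff.1 hc.1.1 _ (dist_pos.2 hne')
  refine hb.1.2 (hL c' hc' a' ha' ?_)
  exact hT.mem_seg_of_near (seg_comm a' c ▸ hT.mem_seg_of_near hseg haa) hcc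

theorem IsRTree.secondCountable (hT : IsRTree T) {ι : Type*} [Countable ι] {p q : ι → T}
    (hpq : ⋃ j, seg (p j) (q j) = univ) : SecondCountableTopology T := by
  have : TopologicalSpace.SeparableSpace T := by
    rw [← TopologicalSpace.isSeparable_univ_iff, ← hpq]
    exact TopologicalSpace.IsSeparable.iUnion fun j => (hT.isCompact_seg _ _).isSeparable
  exact UniformSpace.secondCountable_of_separable T

variable [MeasurableSpace T] [BorelSpace T]

theorem IsRTree.hausdorffMeasure_seg_le (hT : IsRTree T) (x y : T) :
    μH[1] (seg x y) ≤ ENNReal.ofReal (dist x y) := by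
  obtain ⟨f, hf⟩ := hT.exists_isGeod x y
  rw [hT.seg_eq_image hf]
  have hlip : LipschitzOnWith 1 f (Icc 0 (dist x y)) :=
    LipschitzOnWith.of_dist_le_mul fun s hs t ht => by
      rw [hf.2.2 s hs t ht, NNReal.coe_one, one_mul, Real.dist_eq]
  refine (hlip.hausdorffMeasure_image_le zero_le_one).trans ?_
  rw [hausdorffMeasure_real, Real.volume_Icc]
  simp

theorem IsRTree.le_hausdorffMeasure_seg (hT : IsRTree T) (x y : T) :
    ENNReal.ofReal (dist x y) ≤ μH[1] (seg x y) := by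
  have hlip : LipschitzWith 1 (fun z => dist x z) := LipschitzWith.dist_right x
  have h := hlip.hausdorffMeasure_image_le zero_le_one (seg x y)
  rw [hausdorffMeasure_real] at h
  have hsub : Icc 0 (dist x y) ⊆ (fun z => dist x z) '' seg x y := fun r hr =>
    hT.exists_mem_seg_dist hr.1 hr.2
  have h2 := measure_mono (μ := volume) hsub
  rw [Real.volume_Icc, sub_zero] at h2
  simpa using h2.trans h

theorem Countable.hausdorffMeasure_one_zero {s : Set T} (hs : s.Countable) :
    (μH[1] : Measure T) s = 0 := by
  have : NullSingletonClass (μH[1] : Measure T) := nullSingletonClass_hausdorff T one_pos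
  exact hs.measure_zero _

theorem IsRTree.exists_mem_seg_notMem (hT : IsRTree T) {B : Set T} (hB : μH[1] B = 0) {x y : T}
    (hxy : x ≠ y) : ∃ v ∈ seg x y, v ∉ B ∧ v ≠ x ∧ v ≠ y := by
  by_contra! h
  have hsub : seg x y ⊆ B ∪ {x, y} := by
    intro v hv
    by_cases hvB : v ∈ B
    · exact Or.inl hvB
    · refine Or.inr ?_
      by_cases hvx : v = x
      · exact Or.inl hvx
      · exact Or.inr (h v hv hvB hvx)
  have h0 : (μH[1] : Measure T) (B ∪ {x, y}) = 0 :=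
    measure_union_null hB (Countable.hausdorffMeasure_one_zero (by simp))
  have h1 := (hT.le_hausdorffMeasure_seg x y).trans ((measure_mono hsub).trans h0.le)
  rw [nonpos_iff_eq_zero, ENNReal.ofReal_eq_zero] at h1
  exact absurd (dist_pos.2 hxy) (not_lt.2 h1)

/-- In a tree covered by countably many segments, there is a countable set avoiding a given null
set and meeting all open segments. -/
theorem IsRTree.exists_countable_segDense (hT : IsRTree T) {ι : Type*} [Countable ι]
    {p q : ι → T} (hpq : ⋃ j, seg (p j) (q j) = univ) {B : Set T} (hB : μH[1] B = 0) :
    ∃ Q : Set T, Q.Countable ∧ Disjoint Q B ∧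
      ∀ x y, x ≠ y → ∃ v ∈ Q, v ∈ seg x y ∧ v ≠ x ∧ v ≠ y := by
  classical
  let P : ι × ℚ × ℚ → T → Prop := fun t v =>
    v ∈ seg (p t.1) (q t.1) ∧ v ∉ B ∧ (t.2.1 : ℝ) < dist (p t.1) v ∧ dist (p t.1) v < t.2.2
  let Q : Set T := ⋃ t, {v | ∃ h : ∃ v, P t v, v = h.choose}
  refine ⟨Q, countable_iUnion fun t => Set.Subsingleton.countable ?_, ?_, ?_⟩
  · rintro u ⟨h, rfl⟩ v ⟨h', rfl⟩
    rfl
  · rw [Set.disjoint_left]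
    intro v hv
    obtain ⟨t, h, rfl⟩ := mem_iUnion.1 hv
    exact h.choose_spec.2.1
  · intro x y hxy
    have hcov : seg x y ⊆ ⋃ j, seg x y ∩ seg (p j) (q j) := by
      rw [← inter_iUnion, hpq, inter_univ]
    have hex : ∃ j, ¬ (seg x y ∩ seg (p j) (q j)).Countable := by
      by_contra! h
      have h0 : (μH[1] : Measure T) (seg x y) = 0 :=
        Countable.hausdorffMeasure_one_zero ((countable_iUnion h).mono hcov)
      have h1 := (hT.le_hausdorffMeasure_seg x y).trans h0.le
      rw [nonpos_iff_eq_zero, ENNReal.ofReal_eq_zero] at h1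
      exact absurd (dist_pos.2 hxy) (not_lt.2 h1)
    obtain ⟨j, hj⟩ := hex
    have hj : ∃ u ∈ seg x y ∩ seg (p j) (q j), ∃ v ∈ seg x y ∩ seg (p j) (q j),
        dist (p j) u < dist (p j) v := by
      by_contra! h
      refine hj (Set.Subsingleton.countable fun u hu v hv => ?_)
      exact hT.eq_of_dist_eq hu.2 hv.2 (le_antisymm (h v hv u hu) (h u hu v hv))
    obtain ⟨u, hu, v, hv, huv⟩ := hj
    obtain ⟨a, hua, hav⟩ := exists_rat_btwn huv
    obtain ⟨b, hab, hbv⟩ := exists_rat_btwn hav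
    have hP : ∃ w, P (j, a, b) w := by
      obtain ⟨w₁, hw₁, e₁⟩ := hT.exists_mem_seg_dist (x := p j) (y := q j) (r := a)
        (dist_nonneg.trans hua.le) (by
          have : dist (p j) v + dist v (q j) = _ := hv.2
          linarith [dist_nonneg (x := v) (y := q j)])
      obtain ⟨w₂, hw₂, e₂⟩ := hT.exists_mem_seg_dist (x := p j) (y := q j) (r := b)
        (dist_nonneg.trans (hua.trans hab).le) (by
          have : dist (p j) v + dist v (q j) = _ := hv.2
          linarith [dist_nonneg (x := v) (y := q j)])
      have hne : w₁ ≠ w₂ := by rintro rfl; rw [e₁] at e₂; exact hab.ne e₂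
      obtain ⟨w, hw, hwB, hwn₁, hwn₂⟩ := hT.exists_mem_seg_notMem hB hne
      have hwm := hT.treeConvex_seg _ _ w₁ hw₁ w₂ hw₂ hw
      have hw : dist w₁ w + dist w w₂ = dist w₁ w₂ := hw
      have k := hT.seg_dist hw₁ hw₂
      rw [abs_sub_comm, abs_of_nonneg (by rw [e₁, e₂]; linarith)] at k
      have t1 := dist_triangle (p j) w₁ w
      have t2 := dist_triangle (p j) w w₂
      have p1 := dist_pos.2 hwn₁
      have p2 := dist_pos.2 hwn₂
      rw [dist_comm w w₁] at p1
      refine ⟨w, hwm, hwB, ?_, ?_⟩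
      · change (a : ℝ) < dist (p j) w
        linarith
      · change dist (p j) w < (b : ℝ)
        linarith
    have hspec := hP.choose_spec
    set w := hP.choose with hw
    obtain ⟨hwm, -, haw, hwb⟩ := hspec
    change (a : ℝ) < dist (p j) w at haw
    change dist (p j) w < (b : ℝ) at hwb
    have hwuv : w ∈ seg u v := by
      have e1 := hT.seg_dist hu.2 hwm
      have e2 := hT.seg_dist hwm hv.2
      have e3 := hT.seg_dist hu.2 hv.2
      rw [abs_sub_comm, abs_of_nonneg (by linarith)] at e1 e2 e3
      change _ + _ = _
      linarith
    have hwu : w ≠ u := by intro h; rw [h] at haw; linarith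
    have hwv : w ≠ v := by intro h; rw [h] at hwb; linarith
    refine ⟨w, mem_iUnion.2 ⟨_, hP, rfl⟩, hT.treeConvex_seg _ _ _ hu.1 _ hv.1 hwuv, ?_, ?_⟩
    · intro h
      rw [h] at hwuv hwu hwv
      have e1 : dist u x + dist x v = dist u v := hwuv
      have e2 := hT.seg_dist hu.1 hv.1
      have := dist_pos.2 hwu
      have := dist_pos.2 hwv
      rw [dist_comm u x] at e1
      rw [e2] at e1
      rcases abs_cases (dist x u - dist x v) with h | h <;> linarith
    · intro h
      rw [h] at hwuv hwu hwv
      have e1 : dist u y + dist y v = dist u v := hwuv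
      have hu1 := hu.1
      have hv1 := hv.1
      rw [seg_comm] at hu1 hv1
      have e2 := hT.seg_dist hu1 hv1
      have := dist_pos.2 hwu
      have := dist_pos.2 hwv
      rw [dist_comm u y] at e1
      rw [e2] at e1
      rcases abs_cases (dist y u - dist y v) with h | h <;> linarith

theorem IsRTree.sigmaFinite_hausdorff (hT : IsRTree T) {ι : Type*} [Countable ι]
    {p q : ι → T} (hpq : ⋃ j, seg (p j) (q j) = univ) :
    SigmaFinite (μH[1] : Measure T) := by
  refine sigmaFinite_of_countable (S := range fun j => seg (p j) (q j)) (countable_range _) ?_ hpq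
  rintro _ ⟨j, rfl⟩
  exact (hT.hausdorffMeasure_seg_le _ _).trans_lt ENNReal.ofReal_lt_top

end Length

/-! ### Cocycles on Cayley complexes of finitely presented groups -/

section Presentation

variable {G : Type*} [Group G]

theorem pow_subset_pow_of_one_mem {S : Set G} (h1 : (1 : G) ∈ S) {m n : ℕ} (h : m ≤ n) :
    S ^ m ⊆ S ^ n :=
  Set.pow_subset_pow_right h1 h

theorem inv_mem_pow {S : Set G} (hinv : ∀ s ∈ S, s⁻¹ ∈ S) {n : ℕ} {g : G} (hg : g ∈ S ^ n) :
    g⁻¹ ∈ S ^ n := by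
  have hS : S⁻¹ = S := Subset.antisymm (fun s hs => inv_inv s ▸ hinv _ hs) fun s hs => hinv s hs
  rw [← hS, inv_pow, Set.mem_inv, inv_inv]
  exact hg

/-- The symmetric generating set of a free group, with `1` added. -/
def freeGens (n : ℕ) : Set (FreeGroup (Fin n)) :=
  {1} ∪ (range FreeGroup.of ∪ range fun i => (FreeGroup.of i)⁻¹)

theorem finite_freeGens (n : ℕ) : (freeGens n).Finite :=
  (finite_singleton _).union ((finite_range _).union (finite_range _))

theorem one_mem_freeGens (n : ℕ) : 1 ∈ freeGens n := Or.inl rfl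

theorem inv_mem_freeGens {n : ℕ} : ∀ s ∈ freeGens n, s⁻¹ ∈ freeGens n := by
  rintro _ (rfl | ⟨i, rfl⟩ | ⟨i, rfl⟩)
  · exact Or.inl (by simp)
  · exact Or.inr (Or.inr ⟨i, rfl⟩)
  · exact Or.inr (Or.inl ⟨i, by simp⟩)

theorem exists_mem_freeGens_pow {n : ℕ} (w : FreeGroup (Fin n)) : ∃ m, w ∈ freeGens n ^ m := by
  induction w using FreeGroup.induction_on with
  | C1 => exact ⟨0, by simp⟩
  | of i => exact ⟨1, by rw [pow_one]; exact Or.inr (Or.inl ⟨i, rfl⟩)⟩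
  | inv_of i _ => exact ⟨1, by rw [pow_one]; exact Or.inr (Or.inr ⟨i, rfl⟩)⟩
  | mul u v hu hv =>
    obtain ⟨a, ha⟩ := hu
    obtain ⟨b, hb⟩ := hv
    exact ⟨a + b, by rw [pow_add]; exact Set.mul_mem_mul ha hb⟩

/-- The permutation of the mod 2 cover of `G` defined by `d` lifting left translation by `a`. -/
def liftPerm (d : G → G → ZMod 2) (a : G) : Equiv.Perm (G × ZMod 2) where
  toFun z := (a * z.1, z.2 + d z.1 (a * z.1))
  invFun z := (a⁻¹ * z.1, z.2 + d (a⁻¹ * z.1) z.1)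
  left_inv z := by
    ext
    · simp
    · simp [add_assoc, CharTwo.add_self_eq_zero]
  right_inv z := by
    ext
    · simp
    · simp [add_assoc, CharTwo.add_self_eq_zero]

theorem lift_liftPerm_fst {n : ℕ} (φ : FreeGroup (Fin n) →* G) (d : G → G → ZMod 2)
    (w : FreeGroup (Fin n)) (z : G × ZMod 2) :
    (FreeGroup.lift (fun i => liftPerm d (φ (FreeGroup.of i))) w z).1 = φ w * z.1 := by
  induction w using FreeGroup.induction_on generalizing z with
  | C1 => simp
  | of i => simp [liftPerm]
  | inv_of i _ =>
    rw [map_inv, FreeGroup.lift_apply_of, map_inv]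
    rfl
  | mul u v hu hv => rw [map_mul, Equiv.Perm.mul_apply, hu, hv, map_mul, mul_assoc]

/-- In a short word, the lifted permutation is given by the cocycle. -/
theorem lift_liftPerm_apply {n N : ℕ} (φ : FreeGroup (Fin n) →* G) (d : G → G → ZMod 2)
    (hN : 1 ≤ N)
    (hd : ∀ g h k, h * g⁻¹ ∈ (φ '' freeGens n) ^ N → k * h⁻¹ ∈ (φ '' freeGens n) ^ N →
      k * g⁻¹ ∈ (φ '' freeGens n) ^ N → d g h + d h k = d g k)
    {m : ℕ} (hm : m ≤ N) {w : FreeGroup (Fin n)} (hw : w ∈ freeGens n ^ m) (g : G) (t : ZMod 2) :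
    FreeGroup.lift (fun i => liftPerm d (φ (FreeGroup.of i))) w (g, t) =
      (φ w * g, t + d g (φ w * g)) := by
  have h1 : (1 : G) ∈ φ '' freeGens n := ⟨1, one_mem_freeGens n, map_one φ⟩
  have hmem : ∀ {k : ℕ} {u : FreeGroup (Fin n)}, k ≤ N → u ∈ freeGens n ^ k →
      φ u ∈ (φ '' freeGens n) ^ N := by
    intro k u hk hu
    refine pow_subset_pow_of_one_mem h1 hk ?_
    rw [← Set.image_pow]
    exact mem_image_of_mem φ hu
  have h1N : (1 : G) ∈ (φ '' freeGens n) ^ N := by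
    simpa using hmem (Nat.zero_le N) (show (1 : FreeGroup (Fin n)) ∈ freeGens n ^ 0 by simp)
  have hdiag : ∀ g, d g g = 0 := by
    intro g
    simpa using hd g g g (by simpa using h1N) (by simpa using h1N) (by simpa using h1N)
  have hsymm : ∀ {u : FreeGroup (Fin n)} (g : G), u ∈ freeGens n →
      d g (φ u * g) + d (φ u * g) g = 0 := by
    intro u g hu
    rw [hd g (φ u * g) g, hdiag]
    · simpa using hmem hN (by rwa [pow_one])
    · have := hmem hN (by rw [pow_one]; exact inv_mem_freeGens u hu)
      simpa using this
    · simpa using h1N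
  have hgen : ∀ u ∈ freeGens n, ∀ g t,
      FreeGroup.lift (fun i => liftPerm d (φ (FreeGroup.of i))) u (g, t) =
        (φ u * g, t + d g (φ u * g)) := by
    rintro u hu g t
    rcases hu with rfl | ⟨i, rfl⟩ | ⟨i, rfl⟩
    · simp [hdiag]
    · rw [FreeGroup.lift_apply_of]
      rfl
    · rw [map_inv, FreeGroup.lift_apply_of, map_inv]
      change ((φ (FreeGroup.of i))⁻¹ * g, t + d ((φ (FreeGroup.of i))⁻¹ * g) g) = _
      have := hsymm g (inv_mem_freeGens _ (Or.inr (Or.inl ⟨i, rfl⟩)))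
      rw [map_inv] at this
      rw [CharTwo.add_eq_zero.1 this]
  induction m generalizing w g t with
  | zero =>
    rw [pow_zero, Set.mem_one] at hw
    subst hw
    simp [hdiag]
  | succ m ih =>
    have hw' := hw
    rw [pow_succ'] at hw
    obtain ⟨u, hu, v, hv, rfl⟩ := Set.mem_mul.1 hw
    rw [map_mul, Equiv.Perm.mul_apply, ih (by omega) hv, hgen u hu, map_mul, mul_assoc, add_assoc,
      hd]
    · simpa using hmem (by omega) hv
    · simpa [mul_assoc] using hmem hN (by rwa [pow_one])
    · simpa [mul_assoc] using hmem hm hw'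

/-- A finitely presented group has a finite symmetric generating set `S` such that, for all large
`N`, mod 2 cocycles on the Rips complex with respect to `S ^ N` are coboundaries. -/
theorem FinitelyPresentedGroup.exists_cocycle_trivial (hG : FinitelyPresentedGroup G) :
    ∃ S : Set G, S.Finite ∧ 1 ∈ S ∧ (∀ s ∈ S, s⁻¹ ∈ S) ∧ (∀ g, ∃ n, g ∈ S ^ n) ∧
      ∃ N₀, ∀ N, N₀ ≤ N → ∀ c : G → G → ZMod 2,
        (∀ g h k, g⁻¹ * h ∈ S ^ N → h⁻¹ * k ∈ S ^ N → g⁻¹ * k ∈ S ^ N → c g h + c h k = c g k) →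
        ∃ ψ : G → ZMod 2, ∀ g h, g⁻¹ * h ∈ S ^ N → c g h = ψ g + ψ h := by
  obtain ⟨n, rels, φ, hφ, hker⟩ := hG
  choose len hlen using exists_mem_freeGens_pow (n := n)
  have hinv : ∀ s ∈ φ '' freeGens n, s⁻¹ ∈ φ '' freeGens n := by
    rintro _ ⟨w, hw, rfl⟩
    exact ⟨w⁻¹, inv_mem_freeGens w hw, map_inv φ w⟩
  refine ⟨φ '' freeGens n, (finite_freeGens n).image _, ⟨1, one_mem_freeGens n, map_one φ⟩,
    hinv, ?_, rels.sup len + 1, ?_⟩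
  · intro g
    obtain ⟨w, rfl⟩ := hφ g
    exact ⟨len w, by rw [← Set.image_pow]; exact mem_image_of_mem φ (hlen w)⟩
  intro N hN c hc
  let d : G → G → ZMod 2 := fun g h => c g⁻¹ h⁻¹
  have hN1 : 1 ≤ N := by omega
  have hd : ∀ g h k, h * g⁻¹ ∈ (φ '' freeGens n) ^ N → k * h⁻¹ ∈ (φ '' freeGens n) ^ N →
      k * g⁻¹ ∈ (φ '' freeGens n) ^ N → d g h + d h k = d g k := by
    intro g h k h1 h2 h3
    refine hc _ _ _ ?_ ?_ ?_
    · simpa using inv_mem_pow hinv h1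
    · simpa using inv_mem_pow hinv h2
    · simpa using inv_mem_pow hinv h3
  set Φ := FreeGroup.lift (fun i => liftPerm d (φ (FreeGroup.of i))) with hΦ
  have happ : ∀ {m : ℕ}, m ≤ N → ∀ {w : FreeGroup (Fin n)}, w ∈ freeGens n ^ m → ∀ g t,
      Φ w (g, t) = (φ w * g, t + d g (φ w * g)) :=
    fun hm _ hw g t => lift_liftPerm_apply φ d hN1 hd hm hw g t
  have hdiag : ∀ g, d g g = 0 := by
    intro g
    have := happ (Nat.zero_le N) (w := 1) (by simp) g 0
    simpa using this.symm
  have hkerle : φ.ker ≤ Φ.ker := by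
    rw [hker]
    refine Subgroup.normalClosure_le_normal fun r hr => ?_
    have hφr : φ r = 1 := by
      rw [← MonoidHom.mem_ker, hker]
      exact Subgroup.subset_normalClosure hr
    have hle : len r ≤ N := (Finset.le_sup (f := len) hr).trans (by omega)
    refine MonoidHom.mem_ker.2 (Equiv.ext fun z => ?_)
    obtain ⟨g, t⟩ := z
    rw [happ hle (hlen r), hφr]
    simp [hdiag]
  have hwd : ∀ w w', φ w = φ w' → Φ w = Φ w' := by
    intro w w' h
    have : w⁻¹ * w' ∈ φ.ker := by rw [MonoidHom.mem_ker, map_mul, map_inv, h, inv_mul_cancel]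
    have := MonoidHom.mem_ker.1 (hkerle this)
    rwa [map_mul, map_inv, inv_mul_eq_one] at this
  choose lift hlift using hφ
  have hψ : ∀ g h, h * g⁻¹ ∈ (φ '' freeGens n) ^ N →
      d g h = (Φ (lift g) (1, 0)).2 + (Φ (lift h) (1, 0)).2 := by
    intro g h hgh
    rw [← Set.image_pow] at hgh
    obtain ⟨w, hw, hwe⟩ := hgh
    have e : h = φ w * g := by rw [hwe]; group
    have e1 : Φ (lift h) = Φ w * Φ (lift g) := by
      rw [← map_mul]
      exact hwd _ _ (by rw [hlift, map_mul, hlift, e])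
    have e2 : Φ (lift g) (1, 0) = (g, (Φ (lift g) (1, 0)).2) :=
      Prod.ext (by rw [hΦ, lift_liftPerm_fst, hlift]; simp) rfl
    rw [e1, Equiv.Perm.mul_apply, e2, happ le_rfl hw, ← e, ← add_assoc,
      CharTwo.add_self_eq_zero, zero_add]
  refine ⟨fun g => (Φ (lift g⁻¹) (1, 0)).2, fun g h hgh => ?_⟩
  have := hψ g⁻¹ h⁻¹ (by simpa using inv_mem_pow hinv hgh)
  simpa [d] using this

end Presentation

/-! ### Fundamental domains of geometric actions -/

section Geometric

open MeasureTheory Measure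

variable {G T : Type*} [Group G] [MetricSpace T] [MulAction G T]

/-- Points `z ∈ g • D` and `z' ∈ h • D` of nearby translates of `D`, with `[z,z']` avoiding `y`. -/
def AvoidStep (D : Set T) (A : Set G) (y : T) (u v : G × T) : Prop :=
  u.2 ∈ u.1 • D ∧ v.2 ∈ v.1 • D ∧ u.1⁻¹ * v.1 ∈ A ∧ y ∉ seg u.2 v.2

/-- A convex finite union of segments whose translates cover the tree, such that almost every
leaf is connected through nearby translates. -/
structure IsLeafDomain [MeasurableSpace T] [BorelSpace T] (S A : Set G) (D : Set T) : Prop where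
  segs : ∃ I : Set (T × T), I.Finite ∧ D = ⋃ t ∈ I, seg t.1 t.2
  convex : TreeConvex D
  overlap : ∀ s ∈ S, (D ∩ s • D).Nonempty
  cover : ∀ x : T, ∃ g : G, x ∈ g • D
  finite : A.Finite
  chain : ∀ (k k' : G) (x : T), x ∈ k • D → x ∈ k' • D →
    ∀ᵐ y ∂(μH[1] : Measure T), Relation.ReflTransGen (AvoidStep D A y) (k, x) (k', x)

namespace GeometricStructure

variable (X : GeometricStructure G T)

theorem hull_image (g : G) (t : Finset (Amb G)) :
    convexHull ℝ ((Finset.image (X.ρ g) t : Finset (Amb G)) : Set (Amb G)) =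
      X.ρ g '' convexHull ℝ (t : Set (Amb G)) := by
  rw [Finset.coe_image]
  exact (AffineMap.image_convexHull (X.ρ g : Amb G →ᵃ[ℝ] Amb G) _).symm

theorem hull_subset_space {t : Finset (Amb G)} (ht : t ∈ X.K.faces) :
    convexHull ℝ (t : Set (Amb G)) ⊆ X.K.space :=
  X.K.convexHull_subset_space ht

theorem dist_proj_le {t : Finset (Amb G)} (ht : t ∈ X.K.faces) {x y : Amb G}
    (hx : x ∈ convexHull ℝ (t : Set (Amb G))) (hy : y ∈ convexHull ℝ (t : Set (Amb G))) :
    ENNReal.ofReal (dist (X.proj x) (X.proj y)) ≤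
      ENNReal.ofReal |X.fol t x - X.fol t y| := by
  rw [X.proj_dist x (X.hull_subset_space ht hx) y (X.hull_subset_space ht hy)]
  refine (iInf_le _ 1).trans ((iInf_le _ ![x, y]).trans ((iInf_le _ fun _ => t).trans
    ((iInf_le _ rfl).trans ((iInf_le _ rfl).trans ((iInf_le _ ?_).trans ?_)))))
  · intro i
    fin_cases i
    exact ⟨ht, hx, hy⟩
  · simp

theorem exists_chain {x y : Amb G} (hx : x ∈ X.K.space) (hy : y ∈ X.K.space) {ε : ℝ≥0∞}
    (h : ENNReal.ofReal (dist (X.proj x) (X.proj y)) < ε) :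
    ∃ (n : ℕ) (c : Fin (n + 1) → Amb G) (S : Fin n → Finset (Amb G)), c 0 = x ∧
      c (Fin.last n) = y ∧
      (∀ i : Fin n, S i ∈ X.K.faces ∧ c i.castSucc ∈ convexHull ℝ (S i : Set (Amb G)) ∧
        c i.succ ∈ convexHull ℝ (S i : Set (Amb G))) ∧
      ∑ i : Fin n, ENNReal.ofReal |X.fol (S i) (c i.castSucc) - X.fol (S i) (c i.succ)| < ε := by
  rw [X.proj_dist x hx y hy, foliationDist] at h
  simp only [iInf_lt_iff] at h
  obtain ⟨n, c, S, h0, h1, h2, h3⟩ := h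
  exact ⟨n, c, S, h0, h1, h2, h3⟩

theorem exists_proj_hull_eq_seg (hT : IsRTree T) {t : Finset (Amb G)} (ht : t ∈ X.K.faces) :
    ∃ a c : T, X.proj '' convexHull ℝ (t : Set (Amb G)) = seg a c := by
  have hne : t.Nonempty := X.K.nonempty_of_mem_faces ht
  obtain ⟨a, ha, hmin⟩ := t.exists_min_image (X.fol t) hne
  obtain ⟨c, hc, hmax⟩ := t.exists_max_image (X.fol t) hne
  have hI : convexHull ℝ (t : Set (Amb G)) ⊆ X.fol t ⁻¹' Icc (X.fol t a) (X.fol t c) :=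
    convexHull_min (fun x hx => ⟨hmin x hx, hmax x hx⟩)
      ((convex_Icc _ _).affine_preimage (X.fol t))
  have hsub : ({a, c} : Finset (Amb G)) ⊆ t := by
    intro z hz
    rcases Finset.mem_insert.1 hz with rfl | hz
    · exact ha
    · rwa [Finset.mem_singleton.1 hz]
  have he : ({a, c} : Finset (Amb G)) ∈ X.K.faces :=
    X.K.down_closed ht hsub (Finset.insert_nonempty _ _)
  have hae : a ∈ convexHull ℝ (({a, c} : Finset (Amb G)) : Set (Amb G)) :=
    subset_convexHull ℝ _ (by simp)
  have hce : c ∈ convexHull ℝ (({a, c} : Finset (Amb G)) : Set (Amb G)) :=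
    subset_convexHull ℝ _ (by simp)
  have hat : a ∈ convexHull ℝ (t : Set (Amb G)) := subset_convexHull ℝ _ ha
  have hct : c ∈ convexHull ℝ (t : Set (Amb G)) := subset_convexHull ℝ _ hc
  have hd' := X.edges_embed _ he Finset.card_le_two a hae c hce
  have hd : dist (X.proj a) (X.proj c) = X.fol t c - X.fol t a := by
    obtain ⟨ε, b, hε, h⟩ := X.fol_compat t ht _ he hsub
    rw [hd', h a hae, h c hce, abs_sub_comm]
    have h0 := hmin c hc
    rcases hε with rfl | rfl
    · rw [abs_of_nonneg] <;> linarith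
    · rw [abs_of_nonpos] <;> linarith
  have hle : ∀ {x y}, x ∈ convexHull ℝ (t : Set (Amb G)) → y ∈ convexHull ℝ (t : Set (Amb G)) →
      X.fol t x ≤ X.fol t y → dist (X.proj x) (X.proj y) ≤ X.fol t y - X.fol t x := by
    intro x y hx hy hxy
    have := (ENNReal.ofReal_le_ofReal_iff (abs_nonneg _)).1 (X.dist_proj_le ht hx hy)
    rwa [abs_sub_comm, abs_of_nonneg (by linarith)] at this
  have hmem : ∀ x ∈ convexHull ℝ (t : Set (Amb G)), X.proj x ∈ seg (X.proj a) (X.proj c) := by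
    intro x hx
    have h1 := hle hat hx (hI hx).1
    have h2 := hle hx hct (hI hx).2
    have h3 := dist_triangle (X.proj a) (X.proj x) (X.proj c)
    change _ + _ = _
    linarith
  refine ⟨X.proj a, X.proj c, Subset.antisymm (image_subset_iff.2 hmem) fun z hz => ?_⟩
  set d := dist (X.proj a) (X.proj c) with hdd
  have hz' : dist (X.proj a) z + dist z (X.proj c) = d := hz
  have hr : dist (X.proj a) z ≤ d := by linarith [dist_nonneg (x := z) (y := X.proj c)]
  set r := dist (X.proj a) z with hrr
  have hs : r / d ∈ Icc (0 : ℝ) 1 :=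
    ⟨div_nonneg dist_nonneg dist_nonneg, div_le_one_of_le₀ hr dist_nonneg⟩
  have hline : ∀ {s : Set (Amb G)}, a ∈ convexHull ℝ s → c ∈ convexHull ℝ s →
      AffineMap.lineMap a c (r / d) ∈ convexHull ℝ s := fun h1 h2 =>
    (convex_convexHull ℝ _).segment_subset h1 h2 (lineMap_mem_segment ℝ a c hs)
  refine ⟨AffineMap.lineMap a c (r / d), hline hat hct, ?_⟩
  refine hT.eq_of_dist_eq (hmem _ (hline hat hct)) hz ?_
  rw [X.edges_embed _ he Finset.card_le_two a hae _ (hline hae hce), AffineMap.apply_lineMap,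
    AffineMap.lineMap_apply, vsub_eq_sub, smul_eq_mul, vadd_eq_add, sub_add_cancel_right, abs_neg,
    abs_mul, abs_sub_comm, ← hd', abs_of_nonneg hs.1]
  rcases eq_or_ne d 0 with h0 | h0
  · rw [h0, mul_zero]
    rw [h0] at hr
    exact le_antisymm dist_nonneg hr
  · exact div_mul_cancel₀ _ h0

theorem treeConvex_proj_hull (hT : IsRTree T) {t : Finset (Amb G)} (ht : t ∈ X.K.faces) :
    TreeConvex (X.proj '' convexHull ℝ (t : Set (Amb G))) := by
  obtain ⟨a, c, h⟩ := X.exists_proj_hull_eq_seg hT ht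
  rw [h]
  exact hT.treeConvex_seg a c

/-- The union of the faces in `W`. -/
def carrier (_ : GeometricStructure G T) (W : Set (Finset (Amb G))) : Set (Amb G) :=
  ⋃ w ∈ W, convexHull ℝ (w : Set (Amb G))

theorem mem_carrier {W : Set (Finset (Amb G))} {x : Amb G} :
    x ∈ X.carrier W ↔ ∃ w ∈ W, x ∈ convexHull ℝ (w : Set (Amb G)) := by
  simp [carrier]

theorem carrier_insert (W : Set (Finset (Amb G))) (t : Finset (Amb G)) :
    X.carrier (insert t W) = convexHull ℝ (t : Set (Amb G)) ∪ X.carrier W := by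
  simp [carrier]

/-- Any face is contained in a finite family of faces containing `t₀` with convex projection. -/
theorem exists_convex_carrier (hT : IsRTree T) {t₀ t : Finset (Amb G)} (ht₀ : t₀ ∈ X.K.faces)
    (ht : t ∈ X.K.faces) :
    ∃ W : Set (Finset (Amb G)), W.Finite ∧ W ⊆ X.K.faces ∧ t₀ ∈ W ∧ t ∈ W ∧
      TreeConvex (X.proj '' X.carrier W) := by
  obtain ⟨x₀, hx₀⟩ := X.K.nonempty_of_mem_faces ht₀
  obtain ⟨x, hx⟩ := X.K.nonempty_of_mem_faces ht
  replace hx₀ : x₀ ∈ convexHull ℝ (t₀ : Set (Amb G)) := subset_convexHull ℝ _ hx₀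
  replace hx : x ∈ convexHull ℝ (t : Set (Amb G)) := subset_convexHull ℝ _ hx
  obtain ⟨n, c, S, rfl, rfl, hS, -⟩ := X.exists_chain (X.hull_subset_space ht₀ hx₀)
    (X.hull_subset_space ht hx) ENNReal.ofReal_lt_top
  have key : ∀ i : Fin (n + 1), ∀ σ ∈ X.K.faces, c i ∈ convexHull ℝ (σ : Set (Amb G)) →
      ∃ W : Set (Finset (Amb G)), W.Finite ∧ W ⊆ X.K.faces ∧ t₀ ∈ W ∧ σ ∈ W ∧
        TreeConvex (X.proj '' X.carrier W) := by
    have hstep : ∀ (W : Set (Finset (Amb G))) (τ σ : Finset (Amb G)) (z : Amb G), W.Finite →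
        W ⊆ X.K.faces → t₀ ∈ W → τ ∈ W → TreeConvex (X.proj '' X.carrier W) → σ ∈ X.K.faces →
        z ∈ convexHull ℝ (τ : Set (Amb G)) → z ∈ convexHull ℝ (σ : Set (Amb G)) →
        ∃ W : Set (Finset (Amb G)), W.Finite ∧ W ⊆ X.K.faces ∧ t₀ ∈ W ∧ σ ∈ W ∧
          TreeConvex (X.proj '' X.carrier W) := by
      intro W τ σ z hfin hW h0 hτ hconv hσ hzτ hzσ
      refine ⟨insert σ W, hfin.insert σ, insert_subset hσ hW, Or.inr h0, Or.inl rfl, ?_⟩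
      rw [carrier_insert, image_union]
      refine TreeConvex.union hT (X.treeConvex_proj_hull hT hσ) hconv ⟨X.proj z, ?_, ?_⟩
      · exact mem_image_of_mem _ hzσ
      · exact mem_image_of_mem _ (X.mem_carrier.2 ⟨τ, hτ, hzτ⟩)
    intro i
    induction i using Fin.induction with
    | zero =>
      intro σ hσ hzσ
      refine hstep {t₀} t₀ σ _ (finite_singleton _) (singleton_subset_iff.2 ht₀) rfl rfl ?_ hσ
        hx₀ hzσ
      simpa [carrier] using X.treeConvex_proj_hull hT ht₀
    | succ i ih =>
      intro σ hσ hzσ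
      obtain ⟨W, h1, h2, h3, h4, h5⟩ := ih (S i) (hS i).1 (hS i).2.1
      exact hstep W (S i) σ _ h1 h2 h3 h4 h5 hσ (hS i).2.2 hzσ
  exact key (Fin.last n) t ht hx

/-- A finite family of faces meeting every orbit, large enough with respect to `S`. -/
theorem exists_finite_faces (hT : IsRTree T) {S : Set G} (hS : S.Finite) :
    ∃ (W : Set (Finset (Amb G))) (x₀ : Amb G), W.Finite ∧ W ⊆ X.K.faces ∧
      TreeConvex (X.proj '' X.carrier W) ∧ x₀ ∈ X.carrier W ∧
      (∀ s ∈ S, X.ρ s x₀ ∈ X.carrier W) ∧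
      ∀ t ∈ X.K.faces, ∃ w ∈ W, ∃ g : G, t = Finset.image (X.ρ g) w := by
  obtain ⟨t₀, ht₀⟩ := X.nonempty
  obtain ⟨x₀, hx₀⟩ := X.K.nonempty_of_mem_faces ht₀
  replace hx₀ : x₀ ∈ convexHull ℝ (t₀ : Set (Amb G)) := subset_convexHull ℝ _ hx₀
  obtain ⟨F, hFfin, hFsub, hF⟩ := X.cocompact
  let τ : Set (Finset (Amb G)) := insert t₀ (F ∪ (fun s => Finset.image (X.ρ s) t₀) '' S)
  have hτfin : τ.Finite := (hFfin.union (hS.image _)).insert _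
  have hτ : ∀ t : τ, (t : Finset (Amb G)) ∈ X.K.faces := by
    rintro ⟨t, rfl | ht | ⟨s, -, rfl⟩⟩
    · exact ht₀
    · exact hFsub ht
    · exact X.mapsFaces s t₀ ht₀
  choose W hWfin hWsub hW0 hWt hWconv using fun t : τ => X.exists_convex_carrier hT ht₀ (hτ t)
  have hfin : Finite τ := hτfin
  have hcar : X.carrier (⋃ t, W t) = ⋃ t, X.carrier (W t) := by
    ext x
    simp only [mem_carrier, mem_iUnion]
    constructor
    · rintro ⟨w, ⟨t, ht⟩, hx⟩
      exact ⟨t, w, ht, hx⟩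
    · rintro ⟨t, w, ht, hx⟩
      exact ⟨w, ⟨t, ht⟩, hx⟩
  have hin : ∀ t (ht : t ∈ τ), t ∈ ⋃ t, W t := fun t ht => mem_iUnion.2 ⟨⟨t, ht⟩, hWt _⟩
  refine ⟨⋃ t, W t, x₀, finite_iUnion hWfin, iUnion_subset hWsub, ?_, ?_, ?_, ?_⟩
  · rw [hcar, image_iUnion]
    refine TreeConvex.iUnion_of_mem hT hWconv (X.proj x₀) fun t => mem_image_of_mem _ ?_
    exact X.mem_carrier.2 ⟨t₀, hW0 t, hx₀⟩
  · exact X.mem_carrier.2 ⟨t₀, hin _ (Or.inl rfl), hx₀⟩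
  · intro s hs
    refine X.mem_carrier.2 ⟨_, hin _ (Or.inr (Or.inr ⟨s, hs, rfl⟩)), ?_⟩
    rw [hull_image]
    exact mem_image_of_mem _ hx₀
  · intro t ht
    obtain ⟨w, hw, g, hg⟩ := hF t ht
    exact ⟨w, hin _ (Or.inr (Or.inl hw)), g, hg⟩

theorem isCompact_carrier {W : Set (Finset (Amb G))} (hW : W.Finite) :
    IsCompact (X.carrier W) :=
  hW.isCompact_biUnion fun w _ => w.finite_toSet.isCompact_convexHull ℝ

theorem ρ_inv_mul (g h : G) (x : Amb G) : X.ρ (g⁻¹ * h) x = X.ρ g⁻¹ (X.ρ h x) := by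
  rw [map_mul]; rfl

theorem ρ_inv_apply_self (g : G) (x : Amb G) : X.ρ g⁻¹ (X.ρ g x) = x := by
  rw [← ρ_inv_mul, inv_mul_cancel, map_one]; rfl

theorem exists_isLeafDomain (X : GeometricStructure G T) [MeasurableSpace T] [BorelSpace T] (hT : IsRTree T) {S : Set G}
    (hS : S.Finite) : ∃ (A : Set G) (D : Set T), IsLeafDomain S A D := by
  obtain ⟨W, x₀, hWfin, hWsub, hWconv, hx₀, hx₀S, hWcov⟩ := X.exists_finite_faces hT hS
  set C := X.carrier W with hC
  have hCsub : C ⊆ X.K.space := iUnion₂_subset fun w hw => X.hull_subset_space (hWsub hw)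
  have hCcomp : IsCompact C := X.isCompact_carrier hWfin
  have hsp : ∀ g, ∀ x ∈ C, X.ρ g x ∈ X.K.space := by
    intro g x hx
    obtain ⟨w, hw, hxw⟩ := X.mem_carrier.1 hx
    refine X.hull_subset_space (X.mapsFaces g w (hWsub hw)) ?_
    rw [hull_image]
    exact mem_image_of_mem _ hxw
  let A : Set G := {g | ((X.ρ g) '' (C ∩ X.K.space) ∩ C).Nonempty}
  have hA : ∀ {g h z}, z ∈ X.ρ g '' C → z ∈ X.ρ h '' C → g⁻¹ * h ∈ A := by
    rintro g h z ⟨c, hc, rfl⟩ ⟨c', hc', h'⟩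
    refine ⟨c, ⟨c', ⟨hc', hCsub hc'⟩, ?_⟩, hc⟩
    rw [ρ_inv_mul, h', ρ_inv_apply_self]
  have hproj : ∀ {g z}, z ∈ X.ρ g '' C → X.proj z ∈ g • (X.proj '' C) := by
    rintro g _ ⟨c, hc, rfl⟩
    rw [X.proj_equivariant g c (hCsub hc)]
    exact smul_mem_smul_set (mem_image_of_mem _ hc)
  have hface : ∀ t ∈ X.K.faces, ∃ g, convexHull ℝ (t : Set (Amb G)) ⊆ X.ρ g '' C := by
    intro t ht
    obtain ⟨w, hw, g, rfl⟩ := hWcov t ht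
    refine ⟨g, ?_⟩
    rw [hull_image]
    exact image_mono fun x hx => X.mem_carrier.2 ⟨w, hw, hx⟩
  refine ⟨A, X.proj '' C, ?_, hWconv, ?_, ?_, X.pdisc C C hCcomp hCcomp, ?_⟩
  · choose a c hac using fun w : W => X.exists_proj_hull_eq_seg hT (hWsub w.2)
    have : Finite W := hWfin
    refine ⟨range fun w => (a w, c w), finite_range _, ?_⟩
    rw [biUnion_range, hC, carrier, image_iUnion₂, biUnion_eq_iUnion]
    exact iUnion_congr hac
  · intro s hs
    refine ⟨X.proj (X.ρ s x₀), mem_image_of_mem _ (hx₀S s hs), hproj ?_⟩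
    exact mem_image_of_mem _ hx₀
  · intro x
    obtain ⟨z, hz, rfl⟩ := X.proj_surjective x
    obtain ⟨t, ht, hzt⟩ := X.K.mem_space_iff.1 hz
    obtain ⟨g, hg⟩ := hface t ht
    exact ⟨g, hproj (hg hzt)⟩
  · rintro k k' x ⟨_, ⟨c, hc, rfl⟩, hcx⟩ ⟨_, ⟨c', hc', rfl⟩, hcx'⟩
    have hu : X.proj (X.ρ k c) = x := (X.proj_equivariant k c (hCsub hc)).trans hcx
    have hv : X.proj (X.ρ k' c') = x := (X.proj_equivariant k' c' (hCsub hc')).trans hcx'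
    rw [ae_iff]
    refine le_antisymm (le_of_forall_pos_le_add fun ε hε => ?_) zero_le
    rw [zero_add]
    obtain ⟨n, p, F, hp0, hpn, hF, hsum⟩ := X.exists_chain (hsp k c hc) (hsp k' c' hc') (ε := ε)
      (by rwa [hu, hv, dist_self, ENNReal.ofReal_zero])
    choose g hg using fun i => hface (F i) (hF i).1
    let U : Set T := {x} ∪ ⋃ i : Fin n, seg (X.proj (p i.castSucc)) (X.proj (p i.succ))
    have hU : μH[1] U ≤ ε := by
      refine (measure_union_le _ _).trans ?_
      rw [Countable.hausdorffMeasure_one_zero (countable_singleton x), zero_add]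
      refine (measure_iUnion_fintype_le _ _).trans (le_trans ?_ hsum.le)
      exact Finset.sum_le_sum fun i _ => (hT.hausdorffMeasure_seg_le _ _).trans
        (X.dist_proj_le (hF i).1 (hF i).2.1 (hF i).2.2)
    refine (measure_mono fun y hy => ?_).trans hU
    by_contra hyU
    refine hy ?_
    have hyx : y ≠ x := fun h => hyU (Or.inl h)
    have hyi : ∀ i : Fin n, y ∉ seg (X.proj (p i.castSucc)) (X.proj (p i.succ)) :=
      fun i h => hyU (Or.inr (mem_iUnion.2 ⟨i, h⟩))
    have key : ∀ i : Fin (n + 1), ∀ h, p i ∈ X.ρ h '' C →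
        Relation.ReflTransGen (AvoidStep (X.proj '' C) A y) (k, x) (h, X.proj (p i)) := by
      intro i
      induction i using Fin.induction with
      | zero =>
        intro h hh
        have h1 : p 0 ∈ X.ρ k '' C := hp0 ▸ mem_image_of_mem _ hc
        have h2 : X.proj (p 0) = x := by rw [hp0, hu]
        refine Relation.ReflTransGen.single ⟨h2 ▸ hproj h1, hproj hh, hA h1 hh, ?_⟩
        rw [h2]
        exact fun h => hyx (eq_of_mem_seg_self h)
      | succ i ih =>
        intro h hh
        refine (ih (g i) (hg i (hF i).2.1)).tail
          ⟨hproj (hg i (hF i).2.1), hproj hh, hA (hg i (hF i).2.2) hh, hyi i⟩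
    have := key (Fin.last n) k' (hpn ▸ mem_image_of_mem _ hc')
    rwa [hpn, hv] at this

end GeometricStructure

end Geometric

/-! ### Connectedness of leaves -/

section Leaves

open MeasureTheory Measure

variable {G T : Type*} [Group G] [MetricSpace T] [MulAction G T]

/-- `g` and `h` are neighbours, and both translates `g • P`, `h • P` contain `y`. -/
def LeafAdj (F : Set G) (P : Set T) (y : T) (g h : G) : Prop :=
  g⁻¹ * h ∈ F ∧ y ∈ g • P ∧ y ∈ h • P

section Isometric

variable [IsIsometricSMul G T]

theorem smul_mem_seg_iff (g : G) {x y z : T} : g • z ∈ seg (g • x) (g • y) ↔ z ∈ seg x y := by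
  change _ + _ = _ ↔ _ + _ = _
  rw [dist_smul, dist_smul, dist_smul]

theorem smul_seg (g : G) (x y : T) : g • seg x y = seg (g • x) (g • y) := by
  ext z
  rw [mem_smul_set_iff_inv_smul_mem, ← smul_mem_seg_iff g, smul_inv_smul]

theorem TreeConvex.smul {A : Set T} (hA : TreeConvex A) (g : G) : TreeConvex (g • A) := by
  intro x hx y hy z hz
  rw [mem_smul_set_iff_inv_smul_mem] at hx hy ⊢
  exact hA _ hx _ hy ((smul_mem_seg_iff g⁻¹).2 hz)

theorem treeConvex_pow_smul (hT : IsRTree T) {S : Set G} (h1 : (1 : G) ∈ S) {D : Set T}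
    (hD : TreeConvex D) (hS : ∀ s ∈ S, (D ∩ s • D).Nonempty) (n : ℕ) :
    TreeConvex (S ^ n • D) := by
  induction n with
  | zero => simpa using hD
  | succ n ih =>
    have hsub : D ⊆ S ^ n • D := fun d hd =>
      ⟨1, Set.one_mem_pow h1, d, hd, one_smul G d⟩
    have e : S ^ (n + 1) • D = ⋃ s : S, ((s : G) • (S ^ n • D) ∪ S ^ n • D) := by
      rw [pow_succ', mul_smul]
      refine Subset.antisymm ?_ (iUnion_subset fun s => union_subset ?_ ?_)
      · rintro _ ⟨s, hs, x, hx, rfl⟩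
        exact mem_iUnion.2 ⟨⟨s, hs⟩, Or.inl (smul_mem_smul_set hx)⟩
      · rintro _ ⟨x, hx, rfl⟩
        exact smul_mem_smul s.2 hx
      · intro x hx
        exact ⟨1, h1, x, hx, one_smul G x⟩
    obtain ⟨d, hd, -⟩ := hS 1 h1
    rw [e]
    refine TreeConvex.iUnion_of_mem hT (fun s => (ih.smul (s : G)).union hT ih ?_) d
      fun s => Or.inr (hsub hd)
    exact (hS s s.2).mono fun x hx => ⟨smul_set_mono hsub hx.2, hsub hx.1⟩

end Isometric

theorem IsRTree.mem_seg_iff_of_not_tripod (hT : IsRTree T) {y a z z' : T}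
    (hy : ¬ IsTripodCenter y) (ha : a ≠ y) (hz : z ≠ y) (hz' : z' ≠ y) :
    y ∈ seg z z' ↔ ¬ (y ∈ seg a z ↔ y ∈ seg a z') := by
  constructor
  · intro h hiff
    by_cases h1 : y ∈ seg a z
    · exact hy ⟨a, z, z', ha, hz, hz', h1, h, hiff.1 h1⟩
    · rcases hT.mem_seg_or h a with h2 | h2
      · exact h1 (seg_comm z a ▸ h2)
      · exact h1 (hiff.2 h2)
  · intro h
    by_cases h1 : y ∈ seg a z
    · have h2 : y ∉ seg a z' := fun h2 => h ⟨fun _ => h2, fun _ => h1⟩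
      exact seg_comm z' z ▸ (hT.mem_seg_or h1 z').resolve_left h2
    · have h2 : y ∈ seg a z' := by
        by_contra h2
        exact h ⟨fun h => absurd h h1, fun h => absurd h h2⟩
      exact (hT.mem_seg_or h2 z).resolve_left h1

/-- If `y` separates two points `α`, `β` of `k • D ∩ k' • D` from which one can go from `k` to
`k'` avoiding `y`, then `k` and `k'` are connected in the leaf of `y`. -/
theorem IsRTree.leafAdj_of_separates (hT : IsRTree T) [IsIsometricSMul G T] {F : Set G}
    {A : Set G} {D : Set T} (h1 : (1 : G) ∈ F) (hinv : ∀ g ∈ F, g⁻¹ ∈ F) (hAF : A ⊆ F)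
    (hconv : TreeConvex (F • D))
    (hcoc : ∀ c : G → G → ZMod 2,
      (∀ g h k, g⁻¹ * h ∈ F → h⁻¹ * k ∈ F → g⁻¹ * k ∈ F → c g h + c h k = c g k) →
        ∃ ψ : G → ZMod 2, ∀ g h, g⁻¹ * h ∈ F → c g h = ψ g + ψ h)
    {y d : T} (hy : ¬ IsTripodCenter y) (hd : d ∈ D) (hyd : ∀ g : G, g • d ≠ y) {k k' : G}
    {α β : T} (hyα : α ≠ y) (hyβ : β ≠ y) (hαβ : y ∈ seg α β)
    (hα : Relation.ReflTransGen (AvoidStep D A y) (k, α) (k', α))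
    (hβ : Relation.ReflTransGen (AvoidStep D A y) (k, β) (k', β)) :
    Relation.ReflTransGen (LeafAdj F (F • D) y) k k' := by
  classical
  by_contra hn
  let i : G → ZMod 2 := fun g =>
    if Relation.ReflTransGen (LeafAdj F (F • D) y) k g then 1 else 0
  let χ : T → ZMod 2 := fun z => if y ∈ seg α z then 1 else 0
  have hDP : ∀ {g h : G} {z : T}, g⁻¹ * h ∈ F → z ∈ h • D → z ∈ g • (F • D) := by
    rintro g h _ hgh ⟨z, hz, rfl⟩
    rw [mem_smul_set_iff_inv_smul_mem]
    change g⁻¹ • h • z ∈ _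
    rw [smul_smul]
    exact smul_mem_smul hgh hz
  have hDP' : ∀ {g : G} {z : T}, z ∈ g • D → z ∈ g • (F • D) := fun hz =>
    hDP (by simpa using h1) hz
  have hswap : ∀ {g h : G}, g⁻¹ * h ∈ F → h⁻¹ * g ∈ F := by
    intro g h hgh
    simpa using hinv _ hgh
  have hfact : ∀ {g h : G} {z z' : T}, g⁻¹ * h ∈ F → z ∈ g • D → z' ∈ h • D → z ≠ y → z' ≠ y →
      (i g + i h) * (χ z + χ z') = 0 := by
    intro g h z z' hgh hz hz' hzy hzy'
    by_cases hs : y ∈ seg z z'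
    · have hg : y ∈ g • (F • D) := (hconv.smul g) z (hDP' hz) z' (hDP hgh hz') hs
      have hh : y ∈ h • (F • D) := (hconv.smul h) z (hDP (hswap hgh) hz) z' (hDP' hz') hs
      have : Relation.ReflTransGen (LeafAdj F (F • D) y) k g ↔
          Relation.ReflTransGen (LeafAdj F (F • D) y) k h :=
        ⟨fun r => r.tail ⟨hgh, hg, hh⟩, fun r => r.tail ⟨hswap hgh, hh, hg⟩⟩
      have e : i g = i h := by simp only [i, this]
      rw [e, CharTwo.add_self_eq_zero, zero_mul]
    · rw [hT.mem_seg_iff_of_not_tripod hy hyα hzy hzy', not_not] at hs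
      have e : χ z = χ z' := by simp only [χ, hs]
      rw [e, CharTwo.add_self_eq_zero, mul_zero]
  have hbase : ∀ g : G, g • d ∈ g • D := fun g => smul_mem_smul_set hd
  obtain ⟨ψ, hψ⟩ := hcoc (fun g h => i g * (χ (g • d) + χ (h • d))) (by
    intro g h k e1 e2 e3
    have f1 := hfact e1 (hbase g) (hbase h) (hyd g) (hyd h)
    have f2 := hfact e2 (hbase h) (hbase k) (hyd h) (hyd k)
    have f3 := hfact e3 (hbase g) (hbase k) (hyd g) (hyd k)
    generalize i g = a, i h = b, i k = c, χ (g • d) = u, χ (h • d) = v, χ (k • d) = w at *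
    revert f1 f2 f3
    revert a b c u v w
    decide)
  let f : G × T → ZMod 2 := fun u => ψ u.1 + i u.1 * (χ (u.1 • d) + χ u.2)
  have hstep : ∀ u v, AvoidStep D A y u v → f u = f v := by
    rintro ⟨g, z⟩ ⟨h, z'⟩ ⟨hz, hz', hA, hs⟩
    have hzy : z ≠ y := by rintro rfl; exact hs (left_mem_seg _ _)
    have hzy' : z' ≠ y := by rintro rfl; exact hs (right_mem_seg _ _)
    have f1 := hfact (hAF hA) hz (hbase h) hzy (hyd h)
    have f2 := hψ g h (hAF hA)
    rw [hT.mem_seg_iff_of_not_tripod hy hyα hzy hzy', not_not] at hs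
    have e : χ z = χ z' := by
      change y ∈ seg α z ↔ y ∈ seg α z' at hs
      simp only [χ, hs]
    change ψ g + i g * (χ (g • d) + χ z) = ψ h + i h * (χ (h • d) + χ z')
    rw [← e]
    clear e hs
    generalize i g = a, i h = b, χ (g • d) = u, χ (h • d) = v, χ z = w, ψ g = p, ψ h = q at *
    revert f1 f2
    revert a b u v w p q
    decide
  have hconst : ∀ u v, Relation.ReflTransGen (AvoidStep D A y) u v → f u = f v := by
    intro u v huv
    induction huv with
    | refl => rfl
    | tail _ h ih => exact ih.trans (hstep _ _ h)
  have c1 := hconst _ _ hα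
  have c2 := hconst _ _ hβ
  have ik : i k = 1 := if_pos Relation.ReflTransGen.refl
  have ik' : i k' = 0 := if_neg hn
  have χα : χ α = 0 := if_neg fun h => hyα (eq_of_mem_seg_self h).symm
  have χβ : χ β = 1 := if_pos hαβ
  simp only [f, ik, ik', χα, χβ] at c1 c2
  generalize ψ k = p, ψ k' = q, χ (k • d) = u, χ (k' • d) = v at *
  revert c1 c2
  revert p q u v
  decide

theorem finite_set_pow {S : Set G} (hS : S.Finite) (n : ℕ) : (S ^ n).Finite := by
  induction n with
  | zero => simp
  | succ n ih => exact pow_succ S n ▸ ih.mul hS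

/-- A closed convex set with finite length whose translates cover the tree, almost all of whose
leaves are connected with respect to the set of generators `F`. -/
structure IsLeafCover [MeasurableSpace T] [BorelSpace T] (F : Set G) (P : Set T) : Prop where
  segs : ∃ I : Set (T × T), I.Finite ∧ P = ⋃ t ∈ I, seg t.1 t.2
  convex : TreeConvex P
  base : ∃ d ∈ P, ∀ a ∈ F, a • d ∈ P
  cover : ∀ x : T, ∃ g : G, x ∈ g • P
  conn : ∀ᵐ y ∂(μH[1] : Measure T), ∀ k k' : G, y ∈ k • P → y ∈ k' • P →
    Relation.ReflTransGen (LeafAdj F P y) k k'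

theorem IsLeafDomain.isLeafCover [MeasurableSpace T] [BorelSpace T] [IsIsometricSMul G T]
    [SecondCountableTopology T] [Countable G]
    (hT : IsRTree T) {S A : Set G} {D : Set T} (hD : IsLeafDomain S A D) (hSfin : S.Finite)
    (h1S : (1 : G) ∈ S) (hSinv : ∀ s ∈ S, s⁻¹ ∈ S) {N : ℕ} (hAN : A ⊆ S ^ N)
    (hcoc : ∀ c : G → G → ZMod 2,
      (∀ g h k, g⁻¹ * h ∈ S ^ N → h⁻¹ * k ∈ S ^ N → g⁻¹ * k ∈ S ^ N → c g h + c h k = c g k) →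
        ∃ ψ : G → ZMod 2, ∀ g h, g⁻¹ * h ∈ S ^ N → c g h = ψ g + ψ h) :
    IsLeafCover (S ^ N) (S ^ N • D) := by
  have h1 : (1 : G) ∈ S ^ N := Set.one_mem_pow h1S
  have hinv : ∀ g ∈ S ^ N, g⁻¹ ∈ S ^ N := fun g hg => inv_mem_pow hSinv hg
  have hconv := treeConvex_pow_smul hT h1S hD.convex hD.overlap N
  have hDP : ∀ {g : G} {z : T}, z ∈ g • D → z ∈ g • (S ^ N • D) := by
    rintro g _ ⟨z, hz, rfl⟩
    exact smul_mem_smul_set ⟨1, h1, z, hz, one_smul G z⟩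
  obtain ⟨d, hd, -⟩ := hD.overlap 1 h1S
  obtain ⟨I, hI, hDI⟩ := hD.segs
  refine ⟨?_, hconv, ⟨d, ⟨1, h1, d, hd, one_smul G d⟩, fun a ha => smul_mem_smul ha hd⟩, ?_, ?_⟩
  · refine ⟨image2 (fun g t => (g • t.1, g • t.2)) (S ^ N) I, (finite_set_pow hSfin N).image2 _ hI, ?_⟩
    rw [biUnion_image2, ← iUnion_smul_set]
    refine iUnion₂_congr fun g _ => ?_
    rw [hDI, smul_set_iUnion₂]
    exact iUnion₂_congr fun t _ => smul_seg g _ _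
  · intro x
    obtain ⟨g, hg⟩ := hD.cover x
    exact ⟨g, hDP hg⟩
  · have hae : ∀ᵐ y ∂(μH[1] : Measure T), ∀ k k' : G, y ∈ k • D → y ∈ k' • D →
        ∃ α β, α ≠ y ∧ β ≠ y ∧ y ∈ seg α β ∧
          Relation.ReflTransGen (AvoidStep D A y) (k, α) (k', α) ∧
          Relation.ReflTransGen (AvoidStep D A y) (k, β) (k', β) := by
      rw [ae_all_iff]
      intro k
      rw [ae_all_iff]
      intro k'
      have : ∀ᵐ y ∂(μH[1] : Measure T), ∀ t ∈ I, ∀ t' ∈ I,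
          y ∈ k • seg t.1 t.2 → y ∈ k' • seg t'.1 t'.2 → ∃ α β, α ≠ y ∧ β ≠ y ∧ y ∈ seg α β ∧
          Relation.ReflTransGen (AvoidStep D A y) (k, α) (k', α) ∧
          Relation.ReflTransGen (AvoidStep D A y) (k, β) (k', β) := by
        rw [ae_ball_iff hI.countable]
        intro t ht
        rw [ae_ball_iff hI.countable]
        intro t' ht'
        have hsub : ∀ g : G, ∀ t ∈ I, g • seg t.1 t.2 ⊆ g • D := fun g t ht =>
          smul_set_mono (hDI ▸ subset_biUnion_of_mem (u := fun t : T × T => seg t.1 t.2) ht)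
        set B := k • seg t.1 t.2 ∩ k' • seg t'.1 t'.2 with hB
        rcases B.eq_empty_or_nonempty with hemp | hne
        · exact Eventually.of_forall fun y h h' =>
            absurd (show y ∈ B from ⟨h, h'⟩) (hemp ▸ notMem_empty y)
        have hBk : B ⊆ k • D ∩ k' • D := inter_subset_inter (hsub k t ht) (hsub k' t' ht')
        have hBseg : ∃ α β, B = seg α β := by
          rw [smul_seg, smul_seg] at hB
          refine hT.exists_eq_seg (hB ▸ inter_subset_left) ?_ ?_ hne
          · rw [hB]
            intro x hx z hz w hw
            exact ⟨hT.treeConvex_seg _ _ x hx.1 z hz.1 hw, hT.treeConvex_seg _ _ x hx.2 z hz.2 hw⟩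
          · rw [hB]
            exact (hT.isCompact_seg _ _).isClosed.inter (hT.isCompact_seg _ _).isClosed
        obtain ⟨α, β, hαβ⟩ := hBseg
        have hα := hBk (hαβ ▸ left_mem_seg α β : α ∈ B)
        have hβ := hBk (hαβ ▸ right_mem_seg α β : β ∈ B)
        have hfin : ∀ᵐ y ∂(μH[1] : Measure T), y ∉ ({α, β} : Set T) :=
          measure_eq_zero_iff_ae_notMem.1 (Countable.hausdorffMeasure_one_zero (by simp))
        filter_upwards [hD.chain k k' α hα.1 hα.2, hD.chain k k' β hβ.1 hβ.2, hfin]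
          with y hy1 hy2 hy3 hyt hyt'
        refine ⟨α, β, ?_, ?_, ?_, hy1, hy2⟩
        · rintro rfl; exact hy3 (Or.inl rfl)
        · rintro rfl; exact hy3 (Or.inr rfl)
        · rw [← hαβ]; exact ⟨hyt, hyt'⟩
      filter_upwards [this] with y hy hk hk'
      rw [hDI, smul_set_iUnion₂] at hk hk'
      simp only [mem_iUnion] at hk hk'
      obtain ⟨t, ht, hyt⟩ := hk
      obtain ⟨t', ht', hyt'⟩ := hk'
      exact hy t ht t' ht' hyt hyt'
    have htri : ∀ᵐ y ∂(μH[1] : Measure T), y ∉ {y : T | IsTripodCenter y} :=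
      measure_eq_zero_iff_ae_notMem.1
        (Countable.hausdorffMeasure_one_zero hT.countable_tripodCenter)
    have horb : ∀ᵐ y ∂(μH[1] : Measure T), y ∉ range fun g : G => g • d :=
      measure_eq_zero_iff_ae_notMem.1
        (Countable.hausdorffMeasure_one_zero (countable_range _))
    filter_upwards [hae, htri, horb] with y hy hytri hyorb k k' hk hk'
    have hk0 := hk
    have hk0' := hk'
    obtain ⟨_, ⟨a, ha, x, hx, rfl⟩, hxy⟩ := hk
    obtain ⟨_, ⟨a', ha', x', hx', rfl⟩, hxy'⟩ := hk'
    have hka : y ∈ (k * a) • D := ⟨x, hx, by rw [← hxy]; exact mul_smul k a x⟩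
    have hka' : y ∈ (k' * a') • D := ⟨x', hx', by rw [← hxy']; exact mul_smul k' a' x'⟩
    obtain ⟨α, β, hα, hβ, hαβ, rα, rβ⟩ := hy _ _ hka hka'
    have hmid := hT.leafAdj_of_separates h1 hinv hAN hconv hcoc hytri hd
      (fun g hg => hyorb ⟨g, hg⟩) hα hβ hαβ rα rβ
    refine Relation.ReflTransGen.head ⟨?_, hk0, hDP hka⟩ (hmid.tail ⟨?_, hDP hka', hk0'⟩)
    · simpa using ha
    · simpa using hinv _ ha'

/-- A union of convex sets indexed by a connected set is convex. -/
theorem treeConvex_of_connected (hT : IsRTree T) {ι : Type*} {r : ι → ι → Prop} {B : ι → Set T}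
    (hB : ∀ i, TreeConvex (B i)) (hne : ∀ i, (B i).Nonempty)
    (hr : ∀ i j, r i j → (B i ∩ B j).Nonempty) {ℓ : Set ι}
    (hℓ : ∀ i ∈ ℓ, ∀ j ∈ ℓ, Relation.ReflTransGen (fun i j => r i j ∧ i ∈ ℓ ∧ j ∈ ℓ) i j) :
    TreeConvex (⋃ i ∈ ℓ, B i) := by
  rcases ℓ.eq_empty_or_nonempty with rfl | ⟨i₀, hi₀⟩
  · intro x hx
    simp at hx
  have key : ∀ j, Relation.ReflTransGen (fun i j => r i j ∧ i ∈ ℓ ∧ j ∈ ℓ) i₀ j →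
      ∃ V, TreeConvex V ∧ B i₀ ⊆ V ∧ B j ⊆ V ∧ V ⊆ ⋃ i ∈ ℓ, B i := by
    intro j hj
    induction hj with
    | refl => exact ⟨B i₀, hB i₀, Subset.rfl, Subset.rfl, subset_biUnion_of_mem hi₀⟩
    | tail _ h ih =>
      obtain ⟨V, h1, h2, h3, h4⟩ := ih
      refine ⟨V ∪ B _, h1.union hT (hB _) ((hr _ _ h.1).mono (inter_subset_inter_left _ h3)),
        h2.trans subset_union_left, subset_union_right,
        union_subset h4 (subset_biUnion_of_mem h.2.2)⟩
  choose V h1 h2 h3 h4 using fun j : ℓ => key j (hℓ i₀ hi₀ j j.2)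
  have e : ⋃ i ∈ ℓ, B i = ⋃ j, V j := by
    refine Subset.antisymm (iUnion₂_subset fun i hi => ?_) (iUnion_subset h4)
    exact (h3 ⟨i, hi⟩).trans (subset_iUnion V _)
  obtain ⟨z, hz⟩ := hne i₀
  rw [e]
  exact TreeConvex.iUnion_of_mem hT h1 z fun j => h2 j hz

end Leaves

/-! ### The core of two geometric actions -/

section CoreVolume

open MeasureTheory Measure

variable {G T T₁ T₂ : Type*} [Group G]
  [MulAction G T] [MulAction G T₁] [MulAction G T₂]

/-- The union of the translates of `Q` by those `g` for which `x ∈ g • P`. -/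
def leafOver (G : Type*) {T₁ T₂ : Type*} [Group G] [MulAction G T₁] [MulAction G T₂]
    (P : Set T₁) (Q : Set T₂) (x : T₁) : Set T₂ :=
  ⋃ g ∈ {g : G | x ∈ g • P}, g • Q

theorem mem_leafOver {P : Set T₁} {Q : Set T₂} {x : T₁} {z : T₂} :
    z ∈ leafOver G P Q x ↔ ∃ g : G, x ∈ g • P ∧ z ∈ g • Q := by
  simp [leafOver]

theorem mem_leafOver_comm {P : Set T₁} {Q : Set T₂} {x : T₁} {z : T₂} :
    z ∈ leafOver G P Q x ↔ x ∈ leafOver G Q P z := by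
  simp only [mem_leafOver, and_comm]

theorem smul_inter_smul_nonempty {F : Set G} {P : Set T} (hP : ∃ d ∈ P, ∀ a ∈ F, a • d ∈ P)
    {g h : G} (hgh : g⁻¹ * h ∈ F) : (g • P ∩ h • P).Nonempty := by
  obtain ⟨d, hd, hF⟩ := hP
  refine ⟨h • d, ⟨_, hF _ hgh, ?_⟩, smul_mem_smul_set hd⟩
  change g • (g⁻¹ * h) • d = h • d
  rw [smul_smul, mul_inv_cancel_left]

variable [MetricSpace T₂]

theorem treeConvex_leafOver [IsIsometricSMul G T₂] (hT₂ : IsRTree T₂) {F : Set G} {P : Set T₁}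
    {Q : Set T₂} (hQ : TreeConvex Q) (hQF : ∃ d ∈ Q, ∀ a ∈ F, a • d ∈ Q) {x : T₁}
    (hx : ∀ k k' : G, x ∈ k • P → x ∈ k' • P → Relation.ReflTransGen (LeafAdj F P x) k k') :
    TreeConvex (leafOver G P Q x) := by
  refine treeConvex_of_connected hT₂ (r := fun g h : G => g⁻¹ * h ∈ F) (fun g => hQ.smul g) ?_
    (fun g h hgh => smul_inter_smul_nonempty hQF hgh) fun g hg h hh => hx g h hg hh
  obtain ⟨d, hd, -⟩ := hQF
  exact fun g => ⟨g • d, smul_mem_smul_set hd⟩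

variable [MetricSpace T] [MetricSpace T₁]

theorem notMem_core_of_separates (hT₁ : IsRTree T₁) (hT₂ : IsRTree T₂)
    [IsIsometricSMul G T₁] [IsIsometricSMul G T₂] {F : Set G}
    (hgen : ∀ g h : G, Relation.ReflTransGen (fun g h => g⁻¹ * h ∈ F) g h)
    {P₁ : Set T₁} {P₂ : Set T₂} (hP₁ : TreeConvex P₁) (hP₂ : TreeConvex P₂)
    (hF₁ : ∃ d ∈ P₁, ∀ a ∈ F, a • d ∈ P₁) (hF₂ : ∃ d ∈ P₂, ∀ a ∈ F, a • d ∈ P₂)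
    (hcov : ∀ v : T₂, ∃ g : G, v ∈ g • P₂) {x₁ b : T₁} {x₂ v : T₂}
    (hv : ∀ l ∈ leafOver G P₁ P₂ x₁, v ∈ seg x₂ l) (hvx : x₂ ≠ v)
    (hb : ∀ m ∈ leafOver G P₂ P₁ v, b ∈ seg x₁ m) (hbx : x₁ ≠ b)
    (hbv : b ∉ leafOver G P₂ P₁ v) (hconv : TreeConvex (leafOver G P₁ P₂ b))
    (hmeet : (leafOver G P₁ P₂ b ∩ leafOver G P₁ P₂ x₁).Nonempty) :
    (x₁, x₂) ∉ Core G T₁ T₂ := by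
  intro hcore
  have hsep : ∀ z ∈ leafOver G P₁ P₂ b, v ∈ seg x₂ z := by
    obtain ⟨l, hlb, hl⟩ := hmeet
    intro z hz
    rcases hT₂.mem_seg_or (hv l hl) z with h | h
    · exact h
    · exact absurd (mem_leafOver_comm.1 (hconv z hz l hlb h)) hbv
  have hheavy : Heavy G (connectedComponentIn {b}ᶜ x₁ ×ˢ connectedComponentIn {v}ᶜ x₂) := by
    refine hcore _ ⟨_, _, ⟨b, x₁, hbx, rfl⟩, ⟨v, x₂, hvx, rfl⟩, rfl⟩ ?_
    exact ⟨mem_connectedComponentIn hbx, mem_connectedComponentIn hvx⟩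
  rw [hT₁.connectedComponentIn_eq hbx, hT₂.connectedComponentIn_eq hvx] at hheavy
  obtain ⟨d₁, hd₁, -⟩ := id hF₁
  obtain ⟨d₂, hd₂, -⟩ := id hF₂
  obtain ⟨γ, hγ, -, -⟩ := hheavy (d₁, d₂)
  obtain ⟨hg₁, hg₂⟩ := hγ 0
  change b ∉ seg x₁ (γ 0 • d₁) at hg₁
  change v ∉ seg x₂ (γ 0 • d₂) at hg₂
  have hstep : ∀ h : G, (∃ z ∈ h • P₁, b ∉ seg x₁ z) → (∃ z ∈ h • P₂, v ∉ seg x₂ z) →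
      v ∉ h • P₂ ∧ (∀ z ∈ h • P₁, b ∉ seg x₁ z) ∧ ∀ z ∈ h • P₂, v ∉ seg x₂ z := by
    rintro h ⟨z₁, hz₁, hbz⟩ ⟨z₂, hz₂, hvz⟩
    have k1 : v ∉ h • P₂ := fun hvh =>
      hbz (hb z₁ (mem_leafOver.2 ⟨h, hvh, hz₁⟩))
    have k2 : ∀ z ∈ h • P₂, v ∉ seg x₂ z := by
      intro z hz hvs
      rcases hT₂.mem_seg_or hvs z₂ with h' | h'
      · exact hvz h'
      · exact k1 (hP₂.smul h z₂ hz₂ z hz h')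
    have k3 : b ∉ h • P₁ := fun hbh => hvz (hsep z₂ (mem_leafOver.2 ⟨h, hbh, hz₂⟩))
    refine ⟨k1, fun z hz hbs => ?_, k2⟩
    rcases hT₁.mem_seg_or hbs z₁ with h' | h'
    · exact hbz h'
    · exact k3 (hP₁.smul h z₁ hz₁ z hz h')
  have hall : ∀ h : G, v ∉ h • P₂ ∧ (∀ z ∈ h • P₁, b ∉ seg x₁ z) ∧
      ∀ z ∈ h • P₂, v ∉ seg x₂ z := by
    intro h
    induction hgen (γ 0) h with
    | refl =>
      exact hstep _ ⟨_, smul_mem_smul_set hd₁, hg₁⟩ ⟨_, smul_mem_smul_set hd₂, hg₂⟩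
    | tail _ hgh ih =>
      obtain ⟨z₁, hz₁, hz₁'⟩ := smul_inter_smul_nonempty hF₁ hgh
      obtain ⟨z₂, hz₂, hz₂'⟩ := smul_inter_smul_nonempty hF₂ hgh
      exact hstep _ ⟨z₁, hz₁', ih.2.1 z₁ hz₁⟩ ⟨z₂, hz₂', ih.2.2 z₂ hz₂⟩
  obtain ⟨k, hk⟩ := hcov v
  exact (hall k).1 hk

theorem isClosed_core (hT₁ : IsRTree T₁) (hT₂ : IsRTree T₂) : IsClosed (Core G T₁ T₂) := by
  have : Core G T₁ T₂ = ⋂ Q, ⋂ (_ : IsQuadrant Q), ⋂ (_ : ¬ Heavy G Q), Qᶜ := by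
    ext z
    simp only [Core, mem_iInter]
    exact forall₂_congr fun Q _ => ⟨fun h hh hz => hh (h hz), fun h hz => by
      by_contra hh; exact h hh hz⟩
  rw [this]
  refine isClosed_iInter fun Q => isClosed_iInter fun hQ => isClosed_iInter fun _ => ?_
  obtain ⟨δ₁, δ₂, h₁, h₂, rfl⟩ := hQ
  exact ((hT₁.isOpen_direction h₁).prod (hT₂.isOpen_direction h₂)).isClosed_compl

section Cover

variable [MeasurableSpace T] [BorelSpace T] {F : Set G} {P : Set T}

theorem IsLeafCover.isCompact (hT : IsRTree T) (h : IsLeafCover F P) : IsCompact P := by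
  obtain ⟨I, hI, rfl⟩ := h.segs
  exact hI.isCompact_biUnion fun t _ => hT.isCompact_seg _ _

theorem IsLeafCover.measure_lt_top (hT : IsRTree T) (h : IsLeafCover F P) : μH[1] P < ⊤ := by
  obtain ⟨I, hI, rfl⟩ := h.segs
  exact measure_biUnion_lt_top hI fun t _ =>
    (hT.hausdorffMeasure_seg_le _ _).trans_lt ENNReal.ofReal_lt_top

end Cover

/-- The translates of finitely many segments covering a fundamental domain form a countable family
of segments covering the tree. -/
theorem exists_countable_segs {G T : Type*} [Group G] [MetricSpace T] [MulAction G T] [Countable G]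
    [IsIsometricSMul G T] {D : Set T} (hcov : ∀ x, ∃ g : G, x ∈ g • D)
    (hD : ∃ I : Set (T × T), I.Finite ∧ D = ⋃ t ∈ I, seg t.1 t.2) :
    ∃ (I : Set (T × T)) (_ : Countable I) (p q : G × I → T),
      (⋃ j, seg (p j) (q j) = univ) ∧ ∀ j, ∃ g : G, seg (p j) (q j) ⊆ g • D := by
  obtain ⟨I, hI, hDI⟩ := hD
  refine ⟨I, hI.countable, fun j => j.1 • j.2.1.1, fun j => j.1 • j.2.1.2, ?_, fun j => ?_⟩
  · refine eq_univ_of_forall fun x => ?_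
    obtain ⟨g, hg⟩ := hcov x
    rw [hDI, smul_set_iUnion₂] at hg
    simp only [mem_iUnion] at hg
    obtain ⟨t, ht, hx⟩ := hg
    rw [smul_seg] at hx
    exact mem_iUnion.2 ⟨(g, ⟨t, ht⟩), hx⟩
  · refine ⟨j.1, ?_⟩
    rw [← smul_seg]
    refine smul_set_mono ?_
    rw [hDI]
    exact subset_biUnion_of_mem (u := fun t : T × T => seg t.1 t.2) j.2.2

theorem IsRTree.exists_mem_seg_near {T : Type*} [MetricSpace T] (hT : IsRTree T) {Q : Set T}
    (hQ : ∀ x y : T, x ≠ y → ∃ v ∈ Q, v ∈ seg x y ∧ v ≠ x ∧ v ≠ y) {x y : T} {r : ℝ}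
    (hxy : x ≠ y) (hr : 0 < r) : ∃ v ∈ Q, v ∈ seg x y ∧ v ≠ x ∧ dist x v < r := by
  obtain ⟨u, hu, hur⟩ := hT.exists_mem_seg_dist (x := x) (y := y) (r := min r (dist x y))
    (le_min hr.le dist_nonneg) (min_le_right _ _)
  have hxu : x ≠ u := dist_pos.1 (hur ▸ lt_min hr (dist_pos.2 hxy))
  obtain ⟨v, hvQ, hv, hvx, hvu⟩ := hQ x u hxu
  refine ⟨v, hvQ, seg_subset_left hu hv, hvx, ?_⟩
  have hv : dist x v + dist v u = dist x u := hv
  linarith [dist_pos.2 hvu, min_le_left r (dist x y)]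

theorem core_inter_fiber_null [MeasurableSpace T₁] [BorelSpace T₁] [MeasurableSpace T₂]
    [BorelSpace T₂] [Countable G] (hT₁ : IsRTree T₁) (hT₂ : IsRTree T₂)
    [IsIsometricSMul G T₁] [IsIsometricSMul G T₂] {F : Set G}
    (hgen : ∀ g h : G, Relation.ReflTransGen (fun g h => g⁻¹ * h ∈ F) g h)
    {P₁ : Set T₁} {P₂ : Set T₂} (hP₁ : IsLeafCover F P₁) (hP₂ : IsLeafCover F P₂) :
    ∀ᵐ x₁ ∂(μH[1] : Measure T₁),
      (μH[1] : Measure T₂) {x₂ | (x₁, x₂) ∈ Core G T₁ T₂ ∧ x₂ ∉ leafOver G P₁ P₂ x₁} = 0 := by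
  obtain ⟨ι₁, _, p₁, q₁, hpq₁, hsub₁⟩ := exists_countable_segs hP₁.cover hP₁.segs
  obtain ⟨ι₂, _, p₂, q₂, hpq₂, -⟩ := exists_countable_segs hP₂.cover hP₂.segs
  obtain ⟨Q₁, -, hQB₁, hQ₁⟩ := hT₁.exists_countable_segDense hpq₁ (ae_iff.1 hP₁.conn)
  obtain ⟨Q₂, hQc₂, hQB₂, hQ₂⟩ := hT₂.exists_countable_segDense hpq₂ (ae_iff.1 hP₂.conn)
  have hQ₁conv : ∀ b ∈ Q₁, TreeConvex (leafOver G P₁ P₂ b) := fun b hb =>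
    treeConvex_leafOver hT₂ hP₂.convex hP₂.base
      (not_not.1 fun h => Set.disjoint_left.1 hQB₁ hb h)
  have hQ₂conv : ∀ v ∈ Q₂, TreeConvex (leafOver G P₂ P₁ v) := fun v hv =>
    treeConvex_leafOver hT₁ hP₁.convex hP₁.base
      (not_not.1 fun h => Set.disjoint_left.1 hQB₂ hv h)
  have hMne : ∀ v : T₂, ∃ m, m ∈ leafOver G P₂ P₁ v := by
    intro v
    obtain ⟨g, hg⟩ := hP₂.cover v
    obtain ⟨d, hd, -⟩ := hP₁.base
    exact ⟨g • d, mem_leafOver.2 ⟨g, hg, smul_mem_smul_set hd⟩⟩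
  choose m hm using hMne
  have hclos : ∀ᵐ x₁ ∂(μH[1] : Measure T₁), ∀ v ∈ Q₂,
      x₁ ∉ closure (leafOver G P₂ P₁ v) \ leafOver G P₂ P₁ v := by
    rw [ae_ball_iff hQc₂]
    exact fun v hv => measure_eq_zero_iff_ae_notMem.1 (Countable.hausdorffMeasure_one_zero
      (hT₁.countable_closure_diff hpq₁ (hQ₂conv v hv)))
  have hcent : ∀ᵐ x₁ ∂(μH[1] : Measure T₁), ∀ v ∈ Q₂, ∀ j,
      x₁ ∉ {c | c ∈ seg (p₁ j) (q₁ j) ∧ c ∈ seg (q₁ j) (m v) ∧ c ∈ seg (p₁ j) (m v)} := by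
    rw [ae_ball_iff hQc₂]
    intro v _
    rw [ae_all_iff]
    refine fun j => measure_eq_zero_iff_ae_notMem.1 (Countable.hausdorffMeasure_one_zero
      (Set.Subsingleton.countable fun y hy z hz => ?_))
    exact hT₁.center_unique hy.1 hy.2.1 hy.2.2 hz.1 hz.2.1 hz.2.2
  filter_upwards [hP₁.conn, hclos, hcent] with x₁ hx₁ hx₁clos hx₁cent
  have hL := treeConvex_leafOver (P := P₁) hT₂ hP₂.convex hP₂.base hx₁
  refine measure_mono_null (fun x₂ hx₂ => ?_) (Countable.hausdorffMeasure_one_zero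
    (hT₂.countable_closure_diff hpq₂ hL))
  refine ⟨?_, hx₂.2⟩
  by_contra hx₂clos
  refine absurd hx₂.1 ?_
  obtain ⟨j, hj⟩ := mem_iUnion.1 (hpq₁ ▸ mem_univ x₁ : x₁ ∈ ⋃ j, seg (p₁ j) (q₁ j))
  obtain ⟨g, hg⟩ := hsub₁ j
  have hgL : g • P₂ ⊆ leafOver G P₁ P₂ x₁ := fun z hz => mem_leafOver.2 ⟨g, hg hj, hz⟩
  obtain ⟨d, hd, -⟩ := hP₂.base
  have hl₀ : g • d ∈ leafOver G P₁ P₂ x₁ := hgL (smul_mem_smul_set hd)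
  have hr : 0 < infDist x₂ (leafOver G P₁ P₂ x₁) :=
    (infDist_pos_iff_notMem_closure ⟨_, hl₀⟩).1 hx₂clos
  obtain ⟨v, hvQ, hvs, hvx, hvr⟩ := hT₂.exists_mem_seg_near hQ₂
    (x := x₂) (y := g • d) (by rintro rfl; exact hx₂.2 hl₀) hr
  have hvd : ∀ w ∈ leafOver G P₁ P₂ x₁, dist x₂ v < dist x₂ w := fun w hw =>
    hvr.trans_le (infDist_le_dist_of_mem hw)
  have hvL : v ∉ leafOver G P₁ P₂ x₁ := fun h => lt_irrefl _ (hvd v h)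
  have hx₁M : x₁ ∉ closure (leafOver G P₂ P₁ v) := fun h =>
    hx₁clos v hvQ ⟨h, fun h' => hvL (mem_leafOver_comm.1 h')⟩
  have hr₁ : 0 < infDist x₁ (leafOver G P₂ P₁ v) :=
    (infDist_pos_iff_notMem_closure ⟨_, hm v⟩).1 hx₁M
  obtain ⟨c, hc, hc', hc''⟩ := hT₁.exists_center (p₁ j) (q₁ j) (m v)
  have hxc : x₁ ≠ c := by
    rintro rfl
    exact hx₁cent v hvQ j ⟨hc, hc', hc''⟩
  have hcm : c ∈ seg x₁ (m v) := by
    rcases le_total (dist (p₁ j) x₁) (dist (p₁ j) c) with h | h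
    · have h1 := (hT₁.mem_seg_of_le hj hc h).1
      exact (hT₁.mem_seg_of_le (seg_subset_left hc'' h1) hc'' h).2
    · have h1 : x₁ ∈ seg (q₁ j) c := seg_comm c (q₁ j) ▸ (hT₁.mem_seg_of_le hc hj h).2
      have h2 := seg_subset_left hc' h1
      have h3 : dist (q₁ j) x₁ + dist x₁ c = dist (q₁ j) c := h1
      exact (hT₁.mem_seg_of_le h2 hc' (by linarith [dist_nonneg (x := x₁) (y := c)])).2
  obtain ⟨b, hbQ, hbs, hbx, hbr⟩ := hT₁.exists_mem_seg_near hQ₁ hxc hr₁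
  have hbd : ∀ w ∈ leafOver G P₂ P₁ v, dist x₁ b < dist x₁ w := fun w hw =>
    hbr.trans_le (infDist_le_dist_of_mem hw)
  have hbg : b ∈ g • P₁ := hg (hT₁.treeConvex_seg _ _ x₁ hj c hc hbs)
  refine notMem_core_of_separates hT₁ hT₂ hgen hP₁.convex hP₂.convex hP₁.base hP₂.base hP₂.cover
    (fun l hl => hT₂.mem_seg_of_dist_lt hL hl₀ hvs hvd hl) hvx.symm
    (fun w hw => hT₁.mem_seg_of_dist_lt (hQ₂conv v hvQ) (hm v) (seg_subset_left hcm hbs) hbd hw)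
    hbx.symm (fun h => lt_irrefl _ (hbd b h)) (hQ₁conv b hbQ) ⟨g • d, ?_, hl₀⟩
  exact mem_leafOver.2 ⟨g, hbg, smul_mem_smul_set hd⟩

theorem intersectionNumber_ne_top_of_isLeafCover [MeasurableSpace T₁] [BorelSpace T₁]
    [MeasurableSpace T₂] [BorelSpace T₂] [Countable G] (hT₁ : IsRTree T₁) (hT₂ : IsRTree T₂)
    [IsIsometricSMul G T₁] [IsIsometricSMul G T₂] {F : Set G}
    (hgen : ∀ g h : G, Relation.ReflTransGen (fun g h => g⁻¹ * h ∈ F) g h)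
    {P₁ : Set T₁} {P₂ : Set T₂} (hP₁ : IsLeafCover F P₁) (hP₂ : IsLeafCover F P₂) :
    intersectionNumber G T₁ T₂ ≠ ⊤ := by
  obtain ⟨ι₁, _, p₁, q₁, hpq₁, -⟩ := exists_countable_segs hP₁.cover hP₁.segs
  obtain ⟨ι₂, _, p₂, q₂, hpq₂, -⟩ := exists_countable_segs hP₂.cover hP₂.segs
  have := hT₁.secondCountable hpq₁
  have := hT₂.secondCountable hpq₂
  have := hT₁.sigmaFinite_hausdorff hpq₁
  have := hT₂.sigmaFinite_hausdorff hpq₂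
  have hc₁ : IsClosed P₁ := (hP₁.isCompact hT₁).isClosed
  have hc₂ : IsClosed P₂ := (hP₂.isCompact hT₂).isClosed
  let R : Set (T₁ × T₂) := ⋃ g : G, (g • P₁) ×ˢ (g • P₂)
  have hR : MeasurableSet R := MeasurableSet.iUnion fun g =>
    ((hc₁.smul g).prod (hc₂.smul g)).measurableSet
  have hN : MeasurableSet (Core G T₁ T₂ \ R) := (isClosed_core hT₁ hT₂).measurableSet.diff hR
  have hmemR : ∀ z : T₁ × T₂, z ∈ R ↔ z.2 ∈ leafOver G P₁ P₂ z.1 := by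
    intro z
    simp [R, mem_leafOver]
  have hN0 : ((μH[1] : Measure T₁).prod (μH[1] : Measure T₂)) (Core G T₁ T₂ \ R) = 0 := by
    rw [measure_prod_null hN]
    filter_upwards [core_inter_fiber_null hT₁ hT₂ hgen hP₁ hP₂] with x₁ hx₁
    refine measure_mono_null (fun x₂ hx₂ => ?_) hx₁
    exact ⟨hx₂.1, fun h => hx₂.2 ((hmemR _).2 h)⟩
  refine ne_top_of_le_ne_top ?_ (iInf_le_of_le ((Core G T₁ T₂ \ R) ∪ P₁ ×ˢ P₂)
    (iInf_le_of_le (hN.union (hc₁.prod hc₂).measurableSet) (iInf_le_of_le ?_ le_rfl)))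
  · refine ((measure_union_le _ _).trans_lt ?_).ne
    rw [hN0, zero_add, prod_prod]
    exact ENNReal.mul_lt_top (hP₁.measure_lt_top hT₁) (hP₂.measure_lt_top hT₂)
  · intro z hz
    by_cases hzR : z ∈ R
    · obtain ⟨g, ⟨x, hx, hxz⟩, ⟨y, hy, hyz⟩⟩ := mem_iUnion.1 hzR
      exact mem_iUnion.2 ⟨g, (x, y), Or.inr ⟨hx, hy⟩, Prod.ext hxz hyz⟩
    · exact mem_iUnion.2 ⟨1, z, Or.inl ⟨hz, hzR⟩, one_smul G z⟩

end CoreVolume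

/-- Any two elements are joined by a path in the Cayley graph of a power of a generating set. -/
theorem reflTransGen_of_generates {G : Type*} [Group G] {S : Set G} (h1 : (1 : G) ∈ S)
    (hS : ∀ g, ∃ n, g ∈ S ^ n) {N : ℕ} (hN : 1 ≤ N) (g h : G) :
    Relation.ReflTransGen (fun g h => g⁻¹ * h ∈ S ^ N) g h := by
  have key : ∀ n, ∀ w ∈ S ^ n, ∀ g : G,
      Relation.ReflTransGen (fun g h => g⁻¹ * h ∈ S ^ N) g (g * w) := by
    intro n
    induction n with
    | zero =>
      intro w hw g
      rw [pow_zero, Set.mem_one] at hw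
      rw [hw, mul_one]
    | succ n ih =>
      intro w hw g
      rw [pow_succ] at hw
      obtain ⟨u, hu, s, hs, rfl⟩ := Set.mem_mul.1 hw
      refine (ih u hu g).tail ?_
      have : s ∈ S ^ N := pow_subset_pow_of_one_mem h1 hN (by rwa [pow_one])
      simpa [mul_assoc] using this
  obtain ⟨n, hn⟩ := hS (g⁻¹ * h)
  simpa using key n _ hn g

theorem exists_subset_pow {G : Type*} [Group G] {S A : Set G} (h1 : (1 : G) ∈ S)
    (hS : ∀ g, ∃ n, g ∈ S ^ n) (hA : A.Finite) : ∃ n, ∀ N, n ≤ N → A ⊆ S ^ N := by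
  choose len hlen using hS
  refine ⟨hA.toFinset.sup len, fun N hN a ha => ?_⟩
  exact pow_subset_pow_of_one_mem h1
    ((Finset.le_sup (f := len) (hA.mem_toFinset.2 ha)).trans hN) (hlen a)

theorem countable_of_generates {G : Type*} [Group G] {S : Set G} (hfin : S.Finite)
    (hS : ∀ g, ∃ n, g ∈ S ^ n) : Countable G := by
  rw [← Set.countable_univ_iff]
  refine (countable_iUnion fun n => (finite_set_pow hfin n).countable).mono fun g _ => ?_
  exact mem_iUnion.2 (hS g)

theorem IsLeafDomain.secondCountable {G T : Type*} [Group G] [MetricSpace T] [MulAction G T]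
    [MeasurableSpace T] [BorelSpace T] [IsIsometricSMul G T] [Countable G] (hT : IsRTree T)
    {S A : Set G} {D : Set T} (hD : IsLeafDomain S A D) : SecondCountableTopology T := by
  obtain ⟨I, _, p, q, hpq, -⟩ := exists_countable_segs hD.cover hD.segs
  exact hT.secondCountable hpq
/-- Proposition 8.3: two geometric actions of a finitely presented
group on `ℝ`-trees have finite intersection number. -/
theorem intersection_number_finite_of_geometric
    {G T₁ T₂ : Type*} [Group G] [MetricSpace T₁] [MetricSpace T₂]
    [MeasurableSpace T₁] [BorelSpace T₁] [MeasurableSpace T₂] [BorelSpace T₂]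
    [MulAction G T₁] [MulAction G T₂]
    (hT₁ : IsRTree T₁) (hT₂ : IsRTree T₂)
    (hiso₁ : IsometricAction G T₁) (hiso₂ : IsometricAction G T₂)
    (hfp : FinitelyPresentedGroup G)
    (hg₁ : GeometricAction G T₁) (hg₂ : GeometricAction G T₂) :
    intersectionNumber G T₁ T₂ ≠ ⊤ := by
  obtain ⟨X₁⟩ := hg₁
  obtain ⟨X₂⟩ := hg₂
  have : IsIsometricSMul G T₁ := ⟨fun g => Isometry.of_dist_eq (hiso₁ g)⟩
  have : IsIsometricSMul G T₂ := ⟨fun g => Isometry.of_dist_eq (hiso₂ g)⟩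
  obtain ⟨S, hSfin, h1, hinv, hgen, N₀, hcoc⟩ := hfp.exists_cocycle_trivial
  have : Countable G := countable_of_generates hSfin hgen
  obtain ⟨A₁, D₁, hD₁⟩ := X₁.exists_isLeafDomain hT₁ hSfin
  obtain ⟨A₂, D₂, hD₂⟩ := X₂.exists_isLeafDomain hT₂ hSfin
  have := hD₁.secondCountable hT₁
  have := hD₂.secondCountable hT₂
  obtain ⟨n₁, hn₁⟩ := exists_subset_pow h1 hgen hD₁.finite
  obtain ⟨n₂, hn₂⟩ := exists_subset_pow h1 hgen hD₂.finite
  obtain ⟨N, hN, hN₀, hNn₁, hNn₂⟩ : ∃ N, 1 ≤ N ∧ N₀ ≤ N ∧ n₁ ≤ N ∧ n₂ ≤ N :=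
    ⟨1 + N₀ + n₁ + n₂, by omega, by omega, by omega, by omega⟩
  exact intersectionNumber_ne_top_of_isLeafCover hT₁ hT₂
    (reflTransGen_of_generates h1 hgen hN)
    (hD₁.isLeafCover hT₁ hSfin h1 hinv (hn₁ N hNn₁) (hcoc N hN₀))
    (hD₂.isLeafCover hT₂ hSfin h1 hinv (hn₂ N hNn₂) (hcoc N hN₀))

end Guirardel
end
end

section
/- Let T₁, T₂ be two actions of a finitely generated group G on ℝ-trees such that C(T₁ × T₂) ≠ ∅. Then every heavy quadrant Q = δ₁ × δ₂ is made heavy by a hyperbolic element: there exists h ∈ G which is hyperbolic in both T₁ and T₂ and such that for both i ∈ {1,2}, the end ω_{T_i}(h) of the positive semi-axis of h lies in the set of ends ∂_∞δ_i of δ_i. -/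
/-!
Formalization of definitions from V. Guirardel,
"Core and intersection number for group actions on trees".
-/

open Set Metric Filter Function Topology
open scoped ENNReal Pointwise

noncomputable section

namespace Guirardel

section RTreeGeometry

variable {T : Type*} [MetricSpace T]

/-- A geodesic of positive length, reparametrized proportionally to arc length. -/
def geodPath {x y : T} (f : ℝ → T) (h0 : f 0 = x) (h1 : f (dist x y) = y)
    (hf : ∀ s ∈ Icc (0 : ℝ) (dist x y), ∀ t ∈ Icc (0 : ℝ) (dist x y),
      dist (f s) (f t) = |s - t|) : Path x y where
  toFun t := f (t * dist x y)
  continuous_toFun := by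
    refine (LipschitzWith.of_dist_le_mul (K := ⟨dist x y, dist_nonneg⟩) ?_).continuous
    intro s t
    have key : ∀ r : unitInterval, (r : ℝ) * dist x y ∈ Icc (0 : ℝ) (dist x y) := fun r =>
      ⟨mul_nonneg r.2.1 dist_nonneg, mul_le_of_le_one_left dist_nonneg r.2.2⟩
    rw [hf _ (key s) _ (key t), ← sub_mul, abs_mul, abs_of_nonneg (dist_nonneg (x := x) (y := y)),
      mul_comm, Subtype.dist_eq, Real.dist_eq]
    rfl
  source' := by simpa using h0
  target' := by simpa using h1

lemma IsRTree.exists_path (hT : IsRTree T) {x y : T} (hxy : x ≠ y) :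
    ∃ γ : Path x y, Injective γ ∧ range γ ⊆ seg x y := by
  obtain ⟨f, h0, h1, hf⟩ := hT.exists_geod x y
  have hd : 0 < dist x y := dist_pos.2 hxy
  have key : ∀ r : unitInterval, (r : ℝ) * dist x y ∈ Icc (0 : ℝ) (dist x y) := fun r =>
    ⟨mul_nonneg r.2.1 dist_nonneg, mul_le_of_le_one_left dist_nonneg r.2.2⟩
  refine ⟨geodPath f h0 h1 hf, ?_, ?_⟩
  · intro s t hst
    have h : dist (f (s * dist x y)) (f (t * dist x y)) = 0 := dist_eq_zero.2 hst
    rw [hf _ (key s) _ (key t), abs_eq_zero, ← sub_mul] at h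
    exact Subtype.ext (sub_eq_zero.1 ((mul_eq_zero.1 h).resolve_right hd.ne'))
  · rintro _ ⟨t, rfl⟩
    change dist x (f (t * dist x y)) + dist (f (t * dist x y)) y = dist x y
    have e0 := hf 0 ⟨le_rfl, dist_nonneg⟩ _ (key t)
    have e1 := hf _ (key t) (dist x y) ⟨dist_nonneg, le_rfl⟩
    rw [h0, abs_of_nonpos (by linarith [(key t).1])] at e0
    rw [h1, abs_of_nonpos (by linarith [(key t).2])] at e1
    linarith

/-- If `[y,c]` and `[c,z]` only meet at `c`, then every arc from `y` to `z` passes through `c`. -/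
lemma IsRTree.mem_range_of_seg_inter (hT : IsRTree T) {y c z : T}
    (h : ∀ p ∈ seg y c, p ∈ seg c z → p = c) (γ : Path y z) (hγ : Injective γ) :
    c ∈ range γ := by
  by_cases hyc : y = c
  · exact ⟨0, by simp [hyc]⟩
  by_cases hcz : c = z
  · exact ⟨1, by simp [hcz]⟩
  obtain ⟨γ₁, i₁, r₁⟩ := hT.exists_path hyc
  obtain ⟨γ₂, i₂, r₂⟩ := hT.exists_path hcz
  have hc : ∀ s t, γ₁ s = γ₂ t → s = 1 ∧ t = 0 := by
    intro s t hst
    have h1 : γ₁ s = c := h _ (r₁ ⟨s, rfl⟩) (r₂ ⟨t, hst.symm⟩)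
    exact ⟨i₁ (by rw [h1, γ₁.target]), i₂ (by rw [← hst, h1, γ₂.source])⟩
  have hinj : Injective (γ₁.trans γ₂) := by
    intro s t hst
    simp only [Path.trans_apply] at hst
    split_ifs at hst with hs ht ht
    · have := congrArg Subtype.val (i₁ hst)
      simp only at this
      exact Subtype.ext (by linarith)
    · have := congrArg Subtype.val (hc _ _ hst).2
      simp only [Icc.coe_zero] at this
      exact absurd (by linarith) ht
    · have := congrArg Subtype.val (hc _ _ hst.symm).2
      simp only [Icc.coe_zero] at this
      exact absurd (by linarith) hs
    · have := congrArg Subtype.val (i₂ hst)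
      simp only at this
      exact Subtype.ext (by linarith)
  rw [hT.arc_unique y z γ _ hγ hinj, Path.trans_range]
  exact Or.inl ⟨1, γ₁.target⟩

lemma IsRTree.eq_geod_of_mem_seg (hT : IsRTree T) {x y p : T} (hp : p ∈ seg x y) {f : ℝ → T}
    (h0 : f 0 = x) (h1 : f (dist x y) = y)
    (hf : ∀ s ∈ Icc (0 : ℝ) (dist x y), ∀ t ∈ Icc (0 : ℝ) (dist x y),
      dist (f s) (f t) = |s - t|) : p = f (dist x p) := by
  have hp' : dist x p + dist p y = dist x y := hp
  by_cases hxy : x = y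
  · have : x = p := dist_eq_zero.1 (by
      rw [← hxy, dist_self, dist_comm p x] at hp'; linarith)
    rw [← this, dist_self, h0]
  have key : ∀ r : unitInterval, (r : ℝ) * dist x y ∈ Icc (0 : ℝ) (dist x y) := fun r =>
    ⟨mul_nonneg r.2.1 dist_nonneg, mul_le_of_le_one_left dist_nonneg r.2.2⟩
  have hinj : Injective (geodPath f h0 h1 hf) := by
    intro s t hst
    have h : dist (f (s * dist x y)) (f (t * dist x y)) = 0 := dist_eq_zero.2 hst
    rw [hf _ (key s) _ (key t), abs_eq_zero, ← sub_mul] at h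
    exact Subtype.ext (sub_eq_zero.1 ((mul_eq_zero.1 h).resolve_right (dist_pos.2 hxy).ne'))
  obtain ⟨t, ht⟩ := hT.mem_range_of_seg_inter (c := p) (fun q hq hq' => by
    have e1 : dist x q + dist q p = dist x p := hq
    have e2 : dist p q + dist q y = dist p y := hq'
    refine dist_eq_zero.1 (le_antisymm ?_ dist_nonneg)
    linarith [dist_triangle x q y, dist_comm p q]) _ hinj
  have ht' : f (t * dist x y) = p := ht
  have h2 := hf 0 ⟨le_rfl, dist_nonneg⟩ _ (key t)
  rw [h0, ht', abs_of_nonpos (by linarith [(key t).1])] at h2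
  rw [h2, zero_sub, neg_neg, ht']

lemma IsRTree.eq_of_mem_seg (hT : IsRTree T) {x y p q : T} (hp : p ∈ seg x y) (hq : q ∈ seg x y)
    (h : dist x p = dist x q) : p = q := by
  obtain ⟨f, h0, h1, hf⟩ := hT.exists_geod x y
  rw [hT.eq_geod_of_mem_seg hp h0 h1 hf, hT.eq_geod_of_mem_seg hq h0 h1 hf, h]

lemma IsRTree.exists_mem_seg (hT : IsRTree T) {x y : T} {t : ℝ} (h0 : 0 ≤ t)
    (h1 : t ≤ dist x y) : ∃ p ∈ seg x y, dist x p = t := by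
  obtain ⟨f, hf0, hf1, hf⟩ := hT.exists_geod x y
  have e0 := hf 0 ⟨le_rfl, dist_nonneg⟩ t ⟨h0, h1⟩
  have e1 := hf t ⟨h0, h1⟩ (dist x y) ⟨dist_nonneg, le_rfl⟩
  rw [hf0, abs_of_nonpos (by linarith)] at e0
  rw [hf1, abs_of_nonpos (by linarith)] at e1
  refine ⟨f t, ?_, by linarith⟩
  change dist x (f t) + dist (f t) y = dist x y
  linarith

lemma IsRTree.isPreconnected_and_isCompact_seg (hT : IsRTree T) (x y : T) :
    IsPreconnected (seg x y) ∧ IsCompact (seg x y) := by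
  obtain ⟨f, h0, h1, hf⟩ := hT.exists_geod x y
  have hseg : seg x y = f '' Icc 0 (dist x y) := by
    ext p
    constructor
    · intro hp
      have hp' : dist x p + dist p y = dist x y := hp
      exact ⟨dist x p, ⟨dist_nonneg, by linarith [dist_nonneg (x := p) (y := y)]⟩,
        (hT.eq_geod_of_mem_seg hp h0 h1 hf).symm⟩
    · rintro ⟨t, ht, rfl⟩
      have e0 := hf 0 ⟨le_rfl, dist_nonneg⟩ t ht
      have e1 := hf t ht (dist x y) ⟨dist_nonneg, le_rfl⟩
      rw [h0, abs_of_nonpos (by linarith [ht.1])] at e0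
      rw [h1, abs_of_nonpos (by linarith [ht.2])] at e1
      change dist x (f t) + dist (f t) y = dist x y
      linarith
  have hcont : ContinuousOn f (Icc 0 (dist x y)) := by
    refine LipschitzOnWith.continuousOn (K := 1) (LipschitzOnWith.of_dist_le_mul ?_)
    intro s hs t ht
    rw [hf s hs t ht, Real.dist_eq, NNReal.coe_one, one_mul]
  rw [hseg]
  exact ⟨isPreconnected_Icc.image f hcont, isCompact_Icc.image_of_continuousOn hcont⟩

lemma isClosed_seg (x y : T) : IsClosed (seg x y) :=
  isClosed_eq (by fun_prop) continuous_const

lemma IsRTree.exists_median (hT : IsRTree T) (w x y : T) :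
    ∃ c, c ∈ seg w x ∧ c ∈ seg w y ∧ c ∈ seg x y := by
  have hcomp : IsCompact (seg w x ∩ seg w y) :=
    (hT.isPreconnected_and_isCompact_seg w x).2.inter_right (isClosed_seg w y)
  obtain ⟨c, ⟨hcx, hcy⟩, hmax⟩ := hcomp.exists_isMaxOn
    ⟨w, by simp [seg], by simp [seg]⟩ (f := fun p => dist w p) (by fun_prop)
  refine ⟨c, hcx, hcy, ?_⟩
  have hcx' : dist w c + dist c x = dist w x := hcx
  have hcy' : dist w c + dist c y = dist w y := hcy
  have key : ∀ p ∈ seg x c, p ∈ seg c y → p = c := by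
    intro p hp hp'
    have e1 : dist x p + dist p c = dist x c := hp
    have e2 : dist c p + dist p y = dist c y := hp'
    have t1 := dist_triangle w c p
    have t2 := dist_triangle w p x
    have t3 := dist_triangle w p y
    have hpx : p ∈ seg w x := by
      change dist w p + dist p x = dist w x
      linarith [dist_comm x p, dist_comm p c, dist_comm x c]
    have hpy : p ∈ seg w y := by
      change dist w p + dist p y = dist w y
      linarith
    have h4 : dist w p ≤ dist w c := hmax ⟨hpx, hpy⟩
    have hpy' : dist w p + dist p y = dist w y := hpy
    exact dist_eq_zero.1 (le_antisymm (by linarith [dist_comm p c]) dist_nonneg)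
  by_cases hxy : x = y
  · subst hxy
    have := key x (by simp [seg]) (by simp [seg])
    subst this
    simp [seg]
  obtain ⟨γ, hγ, hr⟩ := hT.exists_path hxy
  exact hr (hT.mem_range_of_seg_inter key γ hγ)

/-- The Gromov product inequality in `ℝ`-trees. -/
lemma IsRTree.gromov (hT : IsRTree T) {w x y z : T} {r : ℝ}
    (hxy : r + dist x y ≤ dist w x + dist w y) (hyz : r + dist y z ≤ dist w y + dist w z) :
    r + dist x z ≤ dist w x + dist w z := by
  obtain hr | hr := le_or_gt r 0
  · linarith [dist_triangle x w z, dist_comm x w]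
  have aux : ∀ {a b : T}, r + dist a b ≤ dist w a + dist w b →
      ∃ p, p ∈ seg w a ∧ p ∈ seg w b ∧ dist w p = r / 2 := by
    intro a b hab
    obtain ⟨c, hca, hcb, hc⟩ := hT.exists_median w a b
    have e1 : dist w c + dist c a = dist w a := hca
    have e2 : dist w c + dist c b = dist w b := hcb
    have e3 : dist a c + dist c b = dist a b := hc
    obtain ⟨p, hp, hpr⟩ := hT.exists_mem_seg (x := w) (y := c) (t := r / 2) (by linarith)
      (by linarith [dist_comm a c])
    have e4 : dist w p + dist p c = dist w c := hp
    refine ⟨p, le_antisymm ?_ (dist_triangle _ _ _), le_antisymm ?_ (dist_triangle _ _ _), hpr⟩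
    · linarith [dist_triangle p c a]
    · linarith [dist_triangle p c b]
  obtain ⟨p, hpx, hpy, hp⟩ := aux hxy
  obtain ⟨q, hqy, hqz, hq⟩ := aux hyz
  obtain rfl := hT.eq_of_mem_seg hpy hqy (hp.trans hq.symm)
  have e1 : dist w p + dist p x = dist w x := hpx
  have e2 : dist w p + dist p z = dist w z := hqz
  linarith [dist_triangle x p z, dist_comm x p]

/-- `y` and `w` lie in the same direction at `x`. -/
def SameDir (x y w : T) : Prop := dist y w < dist x y + dist x w

lemma SameDir.symm {x y w : T} (h : SameDir x y w) : SameDir x w y := by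
  unfold SameDir at *
  linarith [dist_comm y w]

lemma IsRTree.sameDir_trans (hT : IsRTree T) {x y w v : T} (h : SameDir x y w)
    (h' : SameDir x w v) : SameDir x y v := by
  unfold SameDir at *
  set r := min (dist x y + dist x w - dist y w) (dist x w + dist x v - dist w v)
  have hr : 0 < r := lt_min (by linarith) (by linarith)
  have h1 : r ≤ dist x y + dist x w - dist y w := min_le_left _ _
  have h2 : r ≤ dist x w + dist x v - dist w v := min_le_right _ _
  linarith [hT.gromov (w := x) (x := y) (y := w) (z := v) (r := r) (by linarith) (by linarith)]

lemma sameDir_of_dist_lt {x y w : T} (h : dist y w < dist x y) : SameDir x y w := by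
  unfold SameDir
  linarith [dist_nonneg (x := x) (y := w)]

lemma isOpen_sameDir (x y : T) : IsOpen {w | SameDir x y w} :=
  isOpen_lt (by fun_prop) (by fun_prop)

lemma IsRTree.connectedComponentIn_eq_s9 (hT : IsRTree T) {x y : T} (hy : y ≠ x) :
    connectedComponentIn {x}ᶜ y = {w | SameDir x y w} := by
  have hyy : SameDir x y y := sameDir_of_dist_lt (by simpa using hy.symm)
  apply Subset.antisymm
  · have hpre : IsPreconnected (connectedComponentIn {x}ᶜ y) := isPreconnected_connectedComponentIn
    have hV : IsOpen (⋃ v ∈ {v | v ≠ x ∧ ¬ SameDir x y v}, {w | SameDir x v w}) :=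
      isOpen_biUnion fun v _ => isOpen_sameDir x v
    refine hpre.subset_left_of_subset_union (isOpen_sameDir x y) hV ?_ ?_
      ⟨y, mem_connectedComponentIn hy, hyy⟩
    · rw [Set.disjoint_left]
      rintro w hw hw'
      simp only [mem_iUnion] at hw'
      obtain ⟨v, hv, hvw⟩ := hw'
      exact hv.2 (hT.sameDir_trans hw (SameDir.symm hvw))
    · intro w hw
      by_cases h : SameDir x y w
      · exact Or.inl h
      · have hwx : w ≠ x := connectedComponentIn_subset _ _ hw
        refine Or.inr ?_
        simp only [mem_iUnion]
        exact ⟨w, ⟨hwx, h⟩, sameDir_of_dist_lt (by simpa using hwx.symm)⟩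
  · intro w hw
    refine (hT.isPreconnected_and_isCompact_seg y w).1.subset_connectedComponentIn (x := y) ?_ ?_ ?_
    · simp [seg]
    · rintro p hp rfl
      have h1 : dist y p + dist p w = dist y w := hp
      have h2 : dist y w < dist p y + dist p w := hw
      linarith [dist_comm y p]
    · simp [seg]

lemma IsRTree.isDirectionAt_sameDir (hT : IsRTree T) {x y : T} (hy : y ≠ x) :
    IsDirectionAt {w | SameDir x y w} x :=
  ⟨y, hy, (hT.connectedComponentIn_eq_s9 hy).symm⟩

lemma IsRTree.exists_eq_sameDir (hT : IsRTree T) {δ : Set T} (h : IsDirection δ) :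
    ∃ x y, δ = {w | SameDir x y w} := by
  obtain ⟨x, y, hy, rfl⟩ := h
  exact ⟨x, y, hT.connectedComponentIn_eq_s9 hy⟩

/-- Overlapping geodesics concatenate to a geodesic. -/
lemma IsRTree.dist_add_of_overlap (hT : IsRTree T) {a b c e : T}
    (h1 : dist a b + dist b c = dist a c) (h2 : dist b c + dist c e = dist b e)
    (hbc : b ≠ c) : dist a c + dist c e = dist a e := by
  by_contra hne
  have hlt : SameDir c a e := by
    have := lt_of_le_of_ne (dist_triangle a c e) (Ne.symm hne)
    unfold SameDir
    linarith [dist_comm a c]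
  have hab : SameDir c b a := by
    unfold SameDir
    linarith [dist_comm a b, dist_comm c a, dist_comm c b, dist_pos.2 hbc]
  have := hT.sameDir_trans hab hlt
  unfold SameDir at this
  linarith [dist_comm b c]

end RTreeGeometry

lemma Hyperbolic.mul_comm {G T : Type*} [Group G] [MulAction G T] {a b : G}
    (h : Hyperbolic T (a * b)) : Hyperbolic T (b * a) := by
  intro x hx
  refine h (a • x) ?_
  rw [mul_smul, ← mul_smul b a, hx]

section Isometries

variable {G T : Type*} [Group G] [MetricSpace T] [MulAction G T]

lemma IsometricAction.dist_inv_smul (hiso : IsometricAction G T) (g : G) (x y : T) :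
    dist (g⁻¹ • x) y = dist x (g • y) := by
  rw [← hiso g, smul_inv_smul]

lemma IsometricAction.sameDir_smul_iff (hiso : IsometricAction G T) (g : G) {x y w : T} :
    SameDir (g • x) (g • y) (g • w) ↔ SameDir x y w := by
  unfold SameDir
  rw [hiso, hiso, hiso]

lemma IsRTree.hyperbolic_of_dist_lt (hT : IsRTree T) (hiso : IsometricAction G T) {g : G} {q : T}
    (h : dist q (g • q) < dist q (g • g • q)) : Hyperbolic T g := by
  intro c hc
  have e1 : dist c (g • q) = dist c q := by
    conv_lhs => rw [← hc]
    exact hiso _ _ _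
  have e2 : dist c (g • g • q) = dist c q := by
    conv_lhs => rw [← hc]
    rw [hiso, e1]
  linarith [hT.gromov (w := c) (x := q) (y := g • q) (z := g • g • q)
    (r := 2 * dist c q - dist q (g • q)) (by linarith) (by rw [hiso]; linarith)]

lemma IsRTree.smul_midpoint_eq (hT : IsRTree T) (hiso : IsometricAction G T) {g : G} {q m : T}
    (h : dist q (g • g • q) ≤ dist q (g • q)) (hm : m ∈ seg q (g • q))
    (hqm : dist q m = dist q (g • q) / 2) : g • m = m := by
  have hm' : dist q m + dist m (g • q) = dist q (g • q) := hm
  have e1 : dist (g • q) (g • m) = dist q m := hiso _ _ _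
  have e2 : dist (g • q) (g • g • q) = dist q (g • q) := hiso _ _ _
  have e3 : dist (g • m) (g • g • q) = dist m (g • q) := hiso _ _ _
  have h1 := hT.gromov (w := g • q) (x := m) (y := q) (z := g • g • q) (r := dist q (g • q))
    (by linarith [dist_comm q m, dist_comm q (g • q), dist_comm m (g • q)])
    (by linarith [dist_comm q (g • q)])
  have h2 := hT.gromov (w := g • q) (x := m) (y := g • g • q) (z := g • m) (r := dist q (g • q))
    h1 (by linarith [dist_comm (g • m) (g • g • q)])
  exact (dist_eq_zero.1 (le_antisymm
    (by linarith [dist_comm m (g • q)]) (dist_nonneg (x := m) (y := g • m)))).symm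

lemma IsRTree.dist_lt_of_hyperbolic (hT : IsRTree T) (hiso : IsometricAction G T) {g : G}
    (h : Hyperbolic T g) (q : T) : dist q (g • q) < dist q (g • g • q) := by
  by_contra! hle
  have h0 := dist_nonneg (x := q) (y := g • q)
  obtain ⟨m, hm, hqm⟩ := hT.exists_mem_seg (x := q) (y := g • q) (t := dist q (g • q) / 2)
    (by linarith) (by linarith)
  exact h m (hT.smul_midpoint_eq hiso hle hm hqm)

/-- `F` parametrizes by arc length an axis of `h`, which translates it by `L > 0`. -/
structure IsAxis (h : G) (F : ℝ → T) (L : ℝ) : Prop where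
  pos : 0 < L
  isom : ∀ s t, dist (F s) (F t) = |s - t|
  smul : ∀ t, h • F t = F (t + L)

lemma IsAxis.inv {h : G} {F : ℝ → T} {L : ℝ} (hF : IsAxis h F L) :
    IsAxis h⁻¹ (fun t => F (-t)) L where
  pos := hF.pos
  isom s t := by rw [hF.isom, ← abs_neg]; ring_nf
  smul t := by rw [inv_smul_eq_iff, hF.smul]; ring_nf

lemma IsAxis.conj (hiso : IsometricAction G T) {h : G} {F : ℝ → T} {L : ℝ} (hF : IsAxis h F L)
    (γ : G) : IsAxis (γ * h * γ⁻¹) (fun t => γ • F t) L where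
  pos := hF.pos
  isom s t := by rw [hiso, hF.isom]
  smul t := by rw [mul_smul, mul_smul, inv_smul_smul, hF.smul]

lemma IsAxis.le_dist_smul (hiso : IsometricAction G T) {h : G} {F : ℝ → T} {L : ℝ}
    (hF : IsAxis h F L) (y : T) : L ≤ dist y (h • y) := by
  have h1 : ∀ n : ℕ, h ^ n • F 0 = F (n * L) := by
    intro n
    induction n with
    | zero => simp
    | succ n ih => rw [pow_succ', mul_smul, ih, hF.smul]; push_cast; ring_nf
  have h2 : ∀ n : ℕ, dist y (h ^ n • y) ≤ n * dist y (h • y) := by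
    intro n
    induction n with
    | zero => simp
    | succ n ih =>
      rw [pow_succ', mul_smul]
      have := dist_triangle y (h • y) (h • h ^ n • y)
      rw [hiso] at this
      push_cast
      linarith
  by_contra! hlt
  obtain ⟨n, hn⟩ := exists_nat_gt (2 * dist (F 0) y / (L - dist y (h • y)))
  rw [div_lt_iff₀ (by linarith)] at hn
  have h3 : dist (F 0) (h ^ n • F 0) = n * L := by
    rw [h1, hF.isom, zero_sub, abs_neg, abs_of_nonneg (mul_nonneg n.cast_nonneg hF.pos.le)]
  have h4 := dist_triangle4 (F 0) y (h ^ n • y) (h ^ n • F 0)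
  rw [hiso, h3, dist_comm y (F 0)] at h4
  linarith [h2 n]

lemma IsAxis.hyperbolic (hiso : IsometricAction G T) {h : G} {F : ℝ → T} {L : ℝ}
    (hF : IsAxis h F L) : Hyperbolic T h := by
  intro x hx
  have := hF.le_dist_smul hiso x
  rw [hx, dist_self] at this
  exact this.not_gt hF.pos

lemma IsAxis.endInSubtree (hiso : IsometricAction G T) {h : G} {F : ℝ → T} {L t₀ : ℝ}
    (hF : IsAxis h F L) {δ : Set T} (hδ : ∀ t ≥ t₀, F t ∈ δ) : EndInSubtree T h δ := by
  refine ⟨F '' Ici t₀, ⟨⟨fun t => F (t₀ + t), ?_, ?_⟩, ?_, ?_⟩, ?_⟩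
  · intro s _ t _
    rw [hF.isom, add_sub_add_left_eq_sub]
  · rw [← image_image F (fun t => t₀ + t), image_const_add_Ici, add_zero]
  · rintro _ ⟨t, _, rfl⟩ y
    rw [hF.smul, hF.isom, sub_add_cancel_left, abs_neg, abs_of_pos hF.pos]
    exact hF.le_dist_smul hiso y
  · rintro _ ⟨_, ⟨t, ht, rfl⟩, rfl⟩
    exact ⟨t + L, le_trans ht (le_add_of_nonneg_right hF.pos.le), (hF.smul t).symm⟩
  · rintro _ ⟨t, ht, rfl⟩
    exact hδ t ht

lemma IsRTree.dist_zpow_smul (hT : IsRTree T) (hiso : IsometricAction G T) {h : G} {x : T}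
    (hpos : 0 < dist x (h • x)) (h2 : dist x (h • h • x) = 2 * dist x (h • x)) {i j : ℤ}
    (hij : i ≤ j) : dist (h ^ i • x) (h ^ j • x) = (j - i) * dist x (h • x) := by
  have key : ∀ n : ℕ, dist x (h ^ n • x) = n * dist x (h • x) ∧
      dist x (h ^ (n + 1) • x) = (n + 1) * dist x (h • x) := by
    intro n
    induction n with
    | zero => simp
    | succ n ih =>
      have e1 : dist (h ^ n • x) (h ^ (n + 1) • x) = dist x (h • x) := by
        rw [pow_succ, mul_smul, hiso]
      have e2 : dist (h ^ (n + 1) • x) (h ^ (n + 1 + 1) • x) = dist x (h • x) := by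
        rw [pow_succ h (n + 1), mul_smul, hiso]
      have e3 : dist (h ^ n • x) (h ^ (n + 1 + 1) • x) = 2 * dist x (h • x) := by
        rw [pow_succ, pow_succ, mul_smul, mul_smul, hiso, h2]
      refine ⟨by push_cast; exact ih.2, ?_⟩
      rw [← hT.dist_add_of_overlap (b := h ^ n • x) (c := h ^ (n + 1) • x)
        (by linarith [ih.1, ih.2]) (by linarith) (dist_pos.1 (by linarith)), ih.2, e2]
      push_cast
      ring
  obtain ⟨n, rfl⟩ := Int.le.dest hij
  rw [zpow_add, mul_smul, hiso, zpow_natCast, (key n).1]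
  push_cast
  ring

lemma IsRTree.exists_isAxis (hT : IsRTree T) (hiso : IsometricAction G T) {h : G} {x : T}
    (hpos : 0 < dist x (h • x)) (h2 : dist x (h • h • x) = 2 * dist x (h • x)) :
    ∃ F : ℝ → T, IsAxis h F (dist x (h • x)) ∧ F 0 = x := by
  obtain ⟨f, f0, f1, hf⟩ := hT.exists_geod x (h • x)
  have hz := fun {i j : ℤ} (hij : i ≤ j) => hT.dist_zpow_smul hiso hpos h2 hij
  set L := dist x (h • x)
  let F : ℝ → T := fun t => h ^ ⌊t / L⌋ • f (t - ⌊t / L⌋ * L)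
  have hlo : ∀ t : ℝ, ⌊t / L⌋ * L ≤ t := fun t => (le_div_iff₀ hpos).1 (Int.floor_le _)
  have hhi : ∀ t : ℝ, t < (⌊t / L⌋ + 1) * L := fun t =>
    (div_lt_iff₀ hpos).1 (Int.lt_floor_add_one _)
  have hmem : ∀ t : ℝ, t - ⌊t / L⌋ * L ∈ Icc 0 L := fun t =>
    ⟨by linarith [hlo t], by linarith [hhi t]⟩
  have dl : ∀ t, dist (h ^ ⌊t / L⌋ • x) (F t) = t - ⌊t / L⌋ * L := by
    intro t
    change dist (h ^ ⌊t / L⌋ • x) (h ^ ⌊t / L⌋ • f (t - ⌊t / L⌋ * L)) = _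
    have e := hf 0 ⟨le_rfl, hpos.le⟩ _ (hmem t)
    rw [f0, abs_of_nonpos (by linarith [(hmem t).1])] at e
    rw [hiso, e]
    ring
  have dr : ∀ t, dist (F t) (h ^ (⌊t / L⌋ + 1) • x) = (⌊t / L⌋ + 1) * L - t := by
    intro t
    change dist (h ^ ⌊t / L⌋ • f (t - ⌊t / L⌋ * L)) _ = _
    have e := hf _ (hmem t) L ⟨hpos.le, le_rfl⟩
    rw [f1, abs_of_nonpos (by linarith [(hmem t).2])] at e
    rw [zpow_add_one, mul_smul, hiso, e]
    ring
  have hle : ∀ s t, s ≤ t → dist (F s) (F t) = t - s := by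
    intro s t hst
    have hij : ⌊s / L⌋ ≤ ⌊t / L⌋ := Int.floor_le_floor (div_le_div_of_nonneg_right hst hpos.le)
    obtain heq | hlt := hij.eq_or_lt
    · change dist (h ^ ⌊s / L⌋ • f (s - ⌊s / L⌋ * L)) (h ^ ⌊t / L⌋ • f (t - ⌊t / L⌋ * L)) = _
      have hs := hmem s
      rw [heq] at hs ⊢
      rw [hiso, hf _ hs _ (hmem t), abs_of_nonpos (by linarith)]
      ring
    · apply le_antisymm
      · have h3 := hz (i := ⌊s / L⌋ + 1) (j := ⌊t / L⌋) hlt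
        have := dist_triangle4 (F s) (h ^ (⌊s / L⌋ + 1) • x) (h ^ ⌊t / L⌋ • x) (F t)
        rw [dr, dl, h3] at this
        push_cast at this
        linarith
      · have h3 := hz (i := ⌊s / L⌋) (j := ⌊t / L⌋ + 1) (by omega)
        have := dist_triangle4 (h ^ ⌊s / L⌋ • x) (F s) (F t) (h ^ (⌊t / L⌋ + 1) • x)
        rw [dr, dl, h3] at this
        push_cast at this
        linarith
  refine ⟨F, ⟨hpos, ?_, ?_⟩, by simp [F, f0]⟩
  · intro s t
    obtain hst | hst := le_total s t
    · rw [hle s t hst, abs_of_nonpos (by linarith), neg_sub]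
    · rw [dist_comm, hle t s hst, abs_of_nonneg (by linarith)]
  · intro t
    have e : ⌊(t + L) / L⌋ = ⌊t / L⌋ + 1 := by
      rw [add_div, div_self hpos.ne', Int.floor_add_one]
    change h • h ^ ⌊t / L⌋ • f (t - ⌊t / L⌋ * L) =
      h ^ ⌊(t + L) / L⌋ • f (t + L - ⌊(t + L) / L⌋ * L)
    rw [e, zpow_add_one, (Commute.zpow_self h _).eq, mul_smul]
    push_cast
    ring_nf

lemma IsRTree.exists_isAxis_of_hyperbolic (hT : IsRTree T) (hiso : IsometricAction G T) {h : G}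
    (hh : Hyperbolic T h) (q : T) : ∃ (F : ℝ → T) (L : ℝ), IsAxis h F L := by
  have h0 := dist_nonneg (x := q) (y := h • q)
  obtain ⟨m, hm, hqm⟩ := hT.exists_mem_seg (x := q) (y := h • q) (t := dist q (h • q) / 2)
    (by linarith) (by linarith)
  have hm' : dist q m + dist m (h • q) = dist q (h • q) := hm
  have hpos : 0 < dist m (h • m) := dist_pos.2 (hh m).symm
  have e1 : dist (h • q) (h • m) = dist q m := hiso _ _ _
  have e2 : dist (h • m) (h • h • q) = dist m (h • q) := hiso _ _ _
  have e3 : dist (h • q) (h • h • q) = dist q (h • q) := hiso _ _ _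
  have e4 : dist (h • m) (h • h • m) = dist m (h • m) := hiso _ _ _
  have e5 : dist (h • h • q) (h • h • m) = dist q m := by rw [hiso, hiso]
  have a1 : SameDir (h • m) (h • q) m := by
    unfold SameDir
    linarith [dist_comm (h • m) m, dist_comm (h • q) m, dist_comm (h • m) (h • q)]
  have a2 : SameDir (h • m) (h • h • m) (h • h • q) := by
    unfold SameDir
    linarith [dist_comm (h • h • m) (h • h • q)]
  have a3 : ¬ SameDir (h • m) m (h • h • m) := fun h' => by
    have := hT.sameDir_trans (hT.sameDir_trans a1 h') a2
    unfold SameDir at this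
    linarith [dist_comm (h • m) (h • q)]
  unfold SameDir at a3
  have := dist_triangle m (h • m) (h • h • m)
  obtain ⟨F, hF, -⟩ := hT.exists_isAxis hiso hpos (by linarith [dist_comm (h • m) m])
  exact ⟨F, _, hF⟩

/-- An isometry moving `x` into a direction `δ` at `x`, and whose inverse moves `x` out of `δ`,
is hyperbolic and translates towards an end of `δ`. -/
lemma IsRTree.hyperbolic_and_endInSubtree (hT : IsRTree T) (hiso : IsometricAction G T) {g : G}
    {x y : T} (h1 : SameDir x y (g • x)) (h2 : ¬ SameDir x y (g⁻¹ • x)) :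
    Hyperbolic T g ∧ EndInSubtree T g {w | SameDir x y w} := by
  have hpos : 0 < dist x (g • x) := by
    refine dist_pos.2 fun h => ?_
    rw [← h] at h1
    unfold SameDir at h1
    linarith [dist_comm x y, dist_self x]
  have h3 : ¬ SameDir x (g • x) (g⁻¹ • x) := fun h => h2 (hT.sameDir_trans h1 h)
  have h4 : dist x (g • g • x) = 2 * dist x (g • x) := by
    unfold SameDir at h3
    have e1 : dist (g • x) (g⁻¹ • x) = dist x (g • g • x) := by
      rw [dist_comm, hiso.dist_inv_smul]
    have e2 : dist x (g⁻¹ • x) = dist x (g • x) := by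
      rw [dist_comm, hiso.dist_inv_smul]
    have := dist_triangle x (g • x) (g • g • x)
    rw [hiso] at this
    linarith
  obtain ⟨F, hF, hF0⟩ := hT.exists_isAxis hiso hpos h4
  refine ⟨hF.hyperbolic hiso, hF.endInSubtree hiso (t₀ := dist x (g • x)) fun t ht => ?_⟩
  refine hT.sameDir_trans h1 ?_
  have e1 : g • x = F (dist x (g • x)) := by
    have := hF.smul 0
    rwa [hF0, zero_add] at this
  have e2 : dist x (F t) = t := by
    rw [← hF0, hF.isom, zero_sub, abs_neg, abs_of_nonneg (by linarith)]
  have e3 : dist (g • x) (F t) = t - dist x (g • x) := by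
    conv_lhs => rw [e1]
    rw [hF.isom, abs_of_nonpos (by linarith), neg_sub]
  unfold SameDir
  linarith

end Isometries

section Heaviness

variable {G T : Type*} [Group G] [MetricSpace T] [MulAction G T]

/-- The orbit points `γ k • w` eventually lie in the direction of `y` at `x` and go to infinity. -/
def MakesHeavy (γ : ℕ → G) (x y : T) : Prop :=
  ∀ (w : T) (C : ℝ), ∀ᶠ k in atTop, SameDir x y (γ k • w) ∧ C < dist x (γ k • w)

lemma IsRTree.makesHeavy (hT : IsRTree T) (hiso : IsometricAction G T) {γ : ℕ → G} {x y p : T}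
    (h : ∀ k, SameDir x y (γ k • p)) (hγ : Tendsto (fun k => dist (γ k • p) p) atTop atTop) :
    MakesHeavy γ x y := by
  intro w C
  filter_upwards [hγ.eventually_gt_atTop (dist x p + dist p w + max C 0)] with k hk
  have e : dist (γ k • p) (γ k • w) = dist p w := hiso _ _ _
  have t1 := dist_triangle (γ k • p) x p
  have t2 := dist_triangle x (γ k • w) (γ k • p)
  have m1 := le_max_left C 0
  have m2 := le_max_right C 0
  rw [dist_comm (γ k • p) x] at t1
  rw [dist_comm (γ k • w)] at t2
  exact ⟨hT.sameDir_trans (h k) (sameDir_of_dist_lt (by linarith)), by linarith⟩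

/-- If orbit points go to infinity in every direction containing `z`, and some element moves `z`,
then some element is hyperbolic. -/
lemma IsRTree.exists_hyperbolic (hT : IsRTree T) (hiso : IsometricAction G T) {z : T} {f : G}
    (hf : z ≠ f • z) (hz : ∀ m, z ≠ m → ∃ γ : ℕ → G, MakesHeavy γ m z) :
    ∃ g : G, Hyperbolic T g := by
  by_contra! hno
  have hpos := dist_pos.2 hf
  obtain ⟨m, hm, hzm⟩ := hT.exists_mem_seg (x := z) (y := f • z) (t := dist z (f • z) / 2)
    (by linarith) (by linarith)
  have hfm : f • m = m := hT.smul_midpoint_eq hiso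
    (not_lt.1 fun h => hno f (hT.hyperbolic_of_dist_lt hiso h)) hm hzm
  obtain ⟨γ, hγ⟩ := hz m (dist_pos.1 (by linarith))
  obtain ⟨k, hk, -⟩ := (hγ m 0).exists
  have h1 : SameDir m z ((γ k)⁻¹ • m) :=
    not_not.1 fun h => hno _ (hT.hyperbolic_and_endInSubtree hiso hk h).1
  have h2 : SameDir m z ((γ k * f)⁻¹ • m) :=
    not_not.1 fun h => hno (γ k * f)
      (hT.hyperbolic_and_endInSubtree hiso (by rwa [mul_smul, hfm]) h).1
  rw [mul_inv_rev, mul_smul, ← hiso.sameDir_smul_iff f, smul_inv_smul, hfm] at h2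
  have h3 := hT.sameDir_trans h1 h2.symm
  have hm' : dist z m + dist m (f • z) = dist z (f • z) := hm
  unfold SameDir at h3
  linarith [dist_comm z m]

lemma IsRTree.dist_le_of_not_hyperbolic (hT : IsRTree T) (hiso : IsometricAction G T) {g s : G}
    {q : T} (hg : Hyperbolic T g) (hs : s • q = q)
    (h : ¬ (Hyperbolic T (g * s) ∧ Hyperbolic T (g * g * s))) :
    dist (g • q) (s⁻¹ • g⁻¹ • q) ≤ dist q (g • q) := by
  have aux : ∀ u : G, ¬ Hyperbolic T (u * s) →
      dist (u • q) (s⁻¹ • u⁻¹ • q) ≤ dist q (u • q) := by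
    intro u hu
    have := not_lt.1 fun h => hu (hT.hyperbolic_of_dist_lt (q := q) hiso h)
    simp only [mul_smul, hs] at this
    rwa [dist_comm, hiso.dist_inv_smul, hiso.dist_inv_smul]
  rw [not_and_or] at h
  obtain h | h := h
  · exact aux g h
  · have h1 := aux _ h
    have hlt := hT.dist_lt_of_hyperbolic hiso hg q
    simp only [mul_inv_rev, mul_smul] at h1
    have hsq : s⁻¹ • q = q := by rw [inv_smul_eq_iff, hs]
    have fixS : ∀ w, dist q (s⁻¹ • w) = dist q w := fun w => by
      conv_lhs => rw [← hsq]
      exact hiso _ _ _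
    have e1 : dist q (g⁻¹ • q) = dist q (g • q) := by rw [dist_comm, hiso.dist_inv_smul]
    have e2 : dist q (g⁻¹ • g⁻¹ • q) = dist q (g • g • q) := by
      rw [dist_comm, hiso.dist_inv_smul, hiso.dist_inv_smul]
    have e3 : dist (s⁻¹ • g⁻¹ • g⁻¹ • q) (s⁻¹ • g⁻¹ • q) = dist q (g • q) := by
      rw [hiso, hiso, dist_comm, e1]
    have e4 : dist (g • q) (g • g • q) = dist q (g • q) := hiso _ _ _
    have g1 := hT.gromov (w := q) (x := g • q) (y := g • g • q) (z := s⁻¹ • g⁻¹ • g⁻¹ • q)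
      (r := dist q (g • q)) (by linarith) (by rw [fixS, e2]; linarith)
    have g2 := hT.gromov (w := q) (x := g • q) (y := s⁻¹ • g⁻¹ • g⁻¹ • q) (z := s⁻¹ • g⁻¹ • q)
      (r := dist q (g • q)) g1 (by rw [fixS, fixS, e1, e2]; linarith)
    rw [fixS, e1] at g2
    linarith

/-- If `g` is hyperbolic and `s` is elliptic, then `g` and `g²` both have a hyperbolic product
with `s`, or both have a hyperbolic product with `s²`. -/
lemma IsRTree.hyperbolic_mul_elliptic (hT : IsRTree T) (hiso : IsometricAction G T) {g s : G}
    (hg : Hyperbolic T g) (hs : ¬ Hyperbolic T s) :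
    (Hyperbolic T (g * s) ∧ Hyperbolic T (g * g * s)) ∨
      (Hyperbolic T (g * (s * s)) ∧ Hyperbolic T (g * g * (s * s))) := by
  obtain ⟨q, hq⟩ : ∃ q : T, s • q = q := by simpa [Hyperbolic] using hs
  by_contra! hno
  have h1 := hT.dist_le_of_not_hyperbolic hiso hg hq (fun h => hno.1 h.1 h.2)
  have h2 := hT.dist_le_of_not_hyperbolic hiso hg (s := s * s) (by rw [mul_smul, hq, hq])
    (fun h => hno.2 h.1 h.2)
  rw [mul_inv_rev, mul_smul] at h2
  have hsq : s⁻¹ • q = q := by rw [inv_smul_eq_iff, hq]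
  have fixS : ∀ w, dist q (s⁻¹ • w) = dist q w := fun w => by
    conv_lhs => rw [← hsq]
    exact hiso _ _ _
  have e1 : dist q (g⁻¹ • q) = dist q (g • q) := by rw [dist_comm, hiso.dist_inv_smul]
  have g1 := hT.gromov (w := q) (x := s⁻¹ • g⁻¹ • q) (y := g • q) (z := s⁻¹ • s⁻¹ • g⁻¹ • q)
    (r := dist q (g • q)) (by rw [fixS]; linarith [dist_comm (g • q) (s⁻¹ • g⁻¹ • q)]) (by rw [fixS, fixS]; linarith)
  rw [hiso, fixS, fixS, fixS] at g1
  have g2 := hT.gromov (w := q) (x := g⁻¹ • q) (y := s⁻¹ • g⁻¹ • q) (z := g • q)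
    (r := dist q (g • q)) (by rw [fixS]; linarith) (by rw [fixS]; linarith [dist_comm (g • q) (s⁻¹ • g⁻¹ • q)])
  rw [hiso.dist_inv_smul] at g2
  linarith [hT.dist_lt_of_hyperbolic hiso hg q]

/-- If the ray `γ • F [0,∞)` starts in a direction at `x` and avoids `x`, then the corresponding
conjugate of `h` translates towards an end of this direction. -/
lemma IsRTree.endInSubtree_conj (hT : IsRTree T) (hiso : IsometricAction G T) {h γ : G} {F : ℝ → T}
    {L : ℝ} (hF : IsAxis h F L) {x y : T} (h0 : SameDir x y (γ • F 0))
    (hx : γ⁻¹ • x ∉ F '' Ioi 0) :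
    Hyperbolic T (γ * h * γ⁻¹) ∧ EndInSubtree T (γ * h * γ⁻¹) {w | SameDir x y w} := by
  have hF' := hF.conj hiso γ
  refine ⟨hF'.hyperbolic hiso, hF'.endInSubtree hiso (t₀ := 0) fun t ht => ?_⟩
  refine hT.sameDir_trans h0 (not_not.1 fun hns => hx ?_)
  have hd : dist x (γ • F 0) = dist (F 0) (γ⁻¹ • x) := by
    rw [dist_comm (F 0), hiso.dist_inv_smul]
  have hpos : 0 < dist (F 0) (γ⁻¹ • x) := by
    rw [← hd]
    refine dist_pos.2 fun he => ?_
    rw [← he] at h0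
    unfold SameDir at h0
    linarith [dist_comm x y, dist_self x]
  have e1 : dist (F 0) (F t) = t := by
    rw [hF.isom, zero_sub, abs_neg, abs_of_nonneg ht]
  have e2 : dist (γ • F 0) (γ • F t) = t := by rw [hiso, e1]
  have e3 : dist x (γ • F t) = dist (γ⁻¹ • x) (F t) := by rw [hiso.dist_inv_smul]
  have hle := not_lt.1 hns
  have hseg : dist (F 0) (γ⁻¹ • x) + dist (γ⁻¹ • x) (F t) = dist (F 0) (F t) :=
    le_antisymm (by linarith) (dist_triangle _ _ _)
  set s := dist (F 0) (γ⁻¹ • x)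
  have hst : s ≤ t := by linarith [dist_nonneg (x := γ⁻¹ • x) (y := F t)]
  have e4 : dist (F 0) (F s) = s := by
    rw [hF.isom, zero_sub, abs_neg, abs_of_nonneg hpos.le]
  refine ⟨s, hpos, hT.eq_of_mem_seg (x := F 0) (y := F t) ?_ hseg e4⟩
  change dist (F 0) (F s) + dist (F s) (F t) = dist (F 0) (F t)
  rw [e4, e1, hF.isom, abs_of_nonpos (by linarith)]
  ring

lemma IsRTree.endInSubtree_mul_inv (hT : IsRTree T) (hiso : IsometricAction G T) {γ γ' : G}
    {F : ℝ → T} (hF : ∀ s t, dist (F s) (F t) = |s - t|) {x y : T} {a b : ℝ} (ha : 0 < a)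
    (hb : 0 < b) (hγ : F a = γ⁻¹ • x) (hγ' : F b = γ'⁻¹ • x) (h0 : SameDir x y (γ • F 0))
    (h1 : SameDir x y (γ' • F a)) (hlt : a < dist x (γ' • F 0)) :
    Hyperbolic T (γ' * γ⁻¹) ∧ EndInSubtree T (γ' * γ⁻¹) {w | SameDir x y w} := by
  rw [← hiso.dist_inv_smul, ← hγ', hF, sub_zero, abs_of_pos hb] at hlt
  refine hT.hyperbolic_and_endInSubtree hiso (by rwa [mul_smul, ← hγ]) fun h => ?_
  rw [mul_inv_rev, inv_inv, mul_smul, ← hγ'] at h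
  have h2 := hT.sameDir_trans h0.symm h
  have hx : x = γ • F a := by rw [hγ, smul_inv_smul]
  rw [hx, hiso.sameDir_smul_iff] at h2
  unfold SameDir at h2
  rw [hF, hF, hF, sub_zero, zero_sub, abs_neg, abs_of_pos ha, abs_of_pos hb,
    abs_of_neg (by linarith)] at h2
  linarith

end Heaviness

section Products

variable {G T₁ T₂ : Type*} [Group G] [MetricSpace T₁] [MetricSpace T₂]
  [MulAction G T₁] [MulAction G T₂]

lemma exists_hyperbolic_both (hT₁ : IsRTree T₁) (hT₂ : IsRTree T₂)
    (hiso₁ : IsometricAction G T₁) (hiso₂ : IsometricAction G T₂) {g s : G}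
    (hg : Hyperbolic T₁ g) (hs : Hyperbolic T₂ s) :
    ∃ h : G, Hyperbolic T₁ h ∧ Hyperbolic T₂ h := by
  by_contra! hno
  have hs₁ : ¬ Hyperbolic T₁ s := fun h => hno s h hs
  obtain h1 | h1 := hT₁.hyperbolic_mul_elliptic hiso₁ hg hs₁ <;>
  obtain h2 | h2 := hT₂.hyperbolic_mul_elliptic hiso₂ hs (hno g hg)
  · exact hno _ h1.1 h2.1.mul_comm
  · exact hno _ h1.2 h2.1.mul_comm
  · exact hno _ h1.1 h2.2.mul_comm
  · exact hno _ h1.2 h2.2.mul_comm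

lemma exists_endInSubtree_of_frequently_mem_rays (hT₁ : IsRTree T₁) (hT₂ : IsRTree T₂)
    (hiso₁ : IsometricAction G T₁) (hiso₂ : IsometricAction G T₂) {γ : ℕ → G}
    {x₁ y₁ : T₁} {x₂ y₂ : T₂} (h₁ : MakesHeavy γ x₁ y₁) (h₂ : MakesHeavy γ x₂ y₂)
    {F₁ : ℝ → T₁} {F₂ : ℝ → T₂} (hF₁ : ∀ s t, dist (F₁ s) (F₁ t) = |s - t|)
    (hF₂ : ∀ s t, dist (F₂ s) (F₂ t) = |s - t|)
    (h : ∃ᶠ k in atTop, (γ k)⁻¹ • x₁ ∈ F₁ '' Ioi 0 ∧ (γ k)⁻¹ • x₂ ∈ F₂ '' Ioi 0) :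
    ∃ g : G, (Hyperbolic T₁ g ∧ EndInSubtree T₁ g {w | SameDir x₁ y₁ w}) ∧
      (Hyperbolic T₂ g ∧ EndInSubtree T₂ g {w | SameDir x₂ y₂ w}) := by
  obtain ⟨l, ⟨⟨a₁, ha₁, hl₁⟩, ⟨a₂, ha₂, hl₂⟩⟩, ⟨d₁, -⟩, ⟨d₂, -⟩⟩ :=
    (h.and_eventually ((h₁ (F₁ 0) 0).and (h₂ (F₂ 0) 0))).exists
  obtain ⟨k, ⟨⟨b₁, hb₁, hk₁⟩, ⟨b₂, hb₂, hk₂⟩⟩, ⟨-, c₁⟩, ⟨-, c₂⟩, ⟨e₁, -⟩, ⟨e₂, -⟩⟩ :=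
    (h.and_eventually ((h₁ (F₁ 0) a₁).and ((h₂ (F₂ 0) a₂).and
      ((h₁ (F₁ a₁) 0).and (h₂ (F₂ a₂) 0))))).exists
  exact ⟨γ k * (γ l)⁻¹, hT₁.endInSubtree_mul_inv hiso₁ hF₁ ha₁ hb₁ hl₁ hk₁ d₁ e₁ c₁,
    hT₂.endInSubtree_mul_inv hiso₂ hF₂ ha₂ hb₂ hl₂ hk₂ d₂ e₂ c₂⟩

lemma notMem_opposite_ray {T : Type*} [MetricSpace T] {F : ℝ → T} {p : T}
    (hF : ∀ s t, dist (F s) (F t) = |s - t|) (hp : p ∈ F '' Ioi 0) :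
    p ∉ (fun t => F (-t)) '' Ioi 0 := by
  obtain ⟨t, ht, rfl⟩ := hp
  rintro ⟨s, hs, hst : F (-s) = F t⟩
  have := hF (-s) t
  rw [mem_Ioi] at ht hs
  rw [hst, dist_self, eq_comm, abs_eq_zero] at this
  linarith

/-- An element hyperbolic in both trees can be modified so as to translate towards ends of the two
directions of a given heavy quadrant. -/
lemma exists_endInSubtree_of_makesHeavy (hT₁ : IsRTree T₁) (hT₂ : IsRTree T₂)
    (hiso₁ : IsometricAction G T₁) (hiso₂ : IsometricAction G T₂) {γ : ℕ → G}
    {x₁ y₁ : T₁} {x₂ y₂ : T₂} (h₁ : MakesHeavy γ x₁ y₁) (h₂ : MakesHeavy γ x₂ y₂)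
    {h : G} (hh₁ : Hyperbolic T₁ h) (hh₂ : Hyperbolic T₂ h) :
    ∃ g : G, (Hyperbolic T₁ g ∧ EndInSubtree T₁ g {w | SameDir x₁ y₁ w}) ∧
      (Hyperbolic T₂ g ∧ EndInSubtree T₂ g {w | SameDir x₂ y₂ w}) := by
  obtain ⟨F₁, L₁, hF₁⟩ := hT₁.exists_isAxis_of_hyperbolic hiso₁ hh₁ x₁
  obtain ⟨F₂, L₂, hF₂⟩ := hT₂.exists_isAxis_of_hyperbolic hiso₂ hh₂ x₂
  by_contra hno
  have hev : ∀ᶠ k in atTop,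
      ((γ k)⁻¹ • x₁ ∈ F₁ '' Ioi 0 ∧ (γ k)⁻¹ • x₂ ∈ (fun t => F₂ (-t)) '' Ioi 0) ∨
      ((γ k)⁻¹ • x₁ ∈ (fun t => F₁ (-t)) '' Ioi 0 ∧ (γ k)⁻¹ • x₂ ∈ F₂ '' Ioi 0) := by
    filter_upwards [h₁ (F₁ 0) 0, h₂ (F₂ 0) 0] with k hk₁ hk₂
    have a1 : ¬ ((γ k)⁻¹ • x₁ ∉ F₁ '' Ioi 0 ∧ (γ k)⁻¹ • x₂ ∉ F₂ '' Ioi 0) := fun hc =>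
      hno ⟨_, hT₁.endInSubtree_conj hiso₁ hF₁ hk₁.1 hc.1,
        hT₂.endInSubtree_conj hiso₂ hF₂ hk₂.1 hc.2⟩
    have a2 : ¬ ((γ k)⁻¹ • x₁ ∉ (fun t => F₁ (-t)) '' Ioi 0 ∧
        (γ k)⁻¹ • x₂ ∉ (fun t => F₂ (-t)) '' Ioi 0) := fun hc =>
      hno ⟨_, hT₁.endInSubtree_conj hiso₁ hF₁.inv (by simpa using hk₁.1) hc.1,
        hT₂.endInSubtree_conj hiso₂ hF₂.inv (by simpa using hk₂.1) hc.2⟩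
    have b1 : (γ k)⁻¹ • x₁ ∈ F₁ '' Ioi 0 →
        (γ k)⁻¹ • x₁ ∉ (fun t => F₁ (-t)) '' Ioi 0 := notMem_opposite_ray hF₁.isom
    have b2 : (γ k)⁻¹ • x₂ ∈ F₂ '' Ioi 0 →
        (γ k)⁻¹ • x₂ ∉ (fun t => F₂ (-t)) '' Ioi 0 := notMem_opposite_ray hF₂.isom
    tauto
  obtain hfr | hfr := frequently_or_distrib.1 hev.frequently
  · exact hno (exists_endInSubtree_of_frequently_mem_rays hT₁ hT₂ hiso₁ hiso₂ h₁ h₂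
      hF₁.isom hF₂.inv.isom hfr)
  · exact hno (exists_endInSubtree_of_frequently_mem_rays hT₁ hT₂ hiso₁ hiso₂ h₁ h₂
      hF₁.inv.isom hF₂.isom hfr)

lemma Heavy.exists_makesHeavy (hT₁ : IsRTree T₁) (hT₂ : IsRTree T₂)
    (hiso₁ : IsometricAction G T₁) (hiso₂ : IsometricAction G T₂) {x₁ y₁ : T₁} {x₂ y₂ : T₂}
    (h : Heavy G ({w | SameDir x₁ y₁ w} ×ˢ {w | SameDir x₂ y₂ w})) :
    ∃ γ : ℕ → G, MakesHeavy γ x₁ y₁ ∧ MakesHeavy γ x₂ y₂ := by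
  obtain ⟨γ, h1, h2, h3⟩ := h (x₁, x₂)
  exact ⟨γ, hT₁.makesHeavy hiso₁ (fun k => (h1 k).1) h2,
    hT₂.makesHeavy hiso₂ (fun k => (h1 k).2) h3⟩

lemma exists_makesHeavy_of_mem_core (hT₁ : IsRTree T₁) (hT₂ : IsRTree T₂)
    (hiso₁ : IsometricAction G T₁) (hiso₂ : IsometricAction G T₂) {z : T₁ × T₂}
    (hz : z ∈ Core G T₁ T₂) {m₁ : T₁} {m₂ : T₂} (h₁ : z.1 ≠ m₁) (h₂ : z.2 ≠ m₂) :
    ∃ γ : ℕ → G, MakesHeavy γ m₁ z.1 ∧ MakesHeavy γ m₂ z.2 :=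
  Heavy.exists_makesHeavy hT₁ hT₂ hiso₁ hiso₂ <| hz _
    ⟨_, _, ⟨m₁, hT₁.isDirectionAt_sameDir h₁⟩, ⟨m₂, hT₂.isDirectionAt_sameDir h₂⟩, rfl⟩
    ⟨sameDir_of_dist_lt (by simpa using h₁.symm), sameDir_of_dist_lt (by simpa using h₂.symm)⟩

end Products

/-- Corollary 3.8: if the core is non-empty, every heavy quadrant is
made heavy by an element hyperbolic in both trees, translating towards an end of each of
the two directions. -/
theorem heavy_quadrant_made_heavy_by_hyperbolic
    {G T₁ T₂ : Type*} [Group G] [Group.FG G] [MetricSpace T₁] [MetricSpace T₂]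
    [MulAction G T₁] [MulAction G T₂]
    (hT₁ : IsRTree T₁) (hT₂ : IsRTree T₂)
    (hiso₁ : IsometricAction G T₁) (hiso₂ : IsometricAction G T₂)
    (hne : (Core G T₁ T₂).Nonempty)
    (δ₁ : Set T₁) (δ₂ : Set T₂) (hδ₁ : IsDirection δ₁) (hδ₂ : IsDirection δ₂)
    (hheavy : Heavy G (δ₁ ×ˢ δ₂)) :
    ∃ h : G, Hyperbolic T₁ h ∧ Hyperbolic T₂ h ∧
      EndInSubtree T₁ h δ₁ ∧ EndInSubtree T₂ h δ₂ := by
  obtain ⟨z, hz⟩ := hne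
  obtain ⟨x₁, y₁, rfl⟩ := hT₁.exists_eq_sameDir hδ₁
  obtain ⟨x₂, y₂, rfl⟩ := hT₂.exists_eq_sameDir hδ₂
  obtain ⟨γ, hγ₁, hγ₂⟩ := hheavy.exists_makesHeavy hT₁ hT₂ hiso₁ hiso₂
  obtain ⟨k, ⟨-, hk₁⟩, ⟨-, hk₂⟩⟩ :=
    ((hγ₁ z.1 (dist x₁ z.1)).and (hγ₂ z.2 (dist x₂ z.2))).exists
  have hne₁ : z.1 ≠ γ k • z.1 := fun h => by rw [← h] at hk₁; exact lt_irrefl _ hk₁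
  have hne₂ : z.2 ≠ γ k • z.2 := fun h => by rw [← h] at hk₂; exact lt_irrefl _ hk₂
  obtain ⟨g, hg⟩ := hT₁.exists_hyperbolic hiso₁ hne₁ fun m hm =>
    (exists_makesHeavy_of_mem_core hT₁ hT₂ hiso₁ hiso₂ hz hm hne₂).imp fun _ h => h.1
  obtain ⟨s, hs⟩ := hT₂.exists_hyperbolic hiso₂ hne₂ fun m hm =>
    (exists_makesHeavy_of_mem_core hT₁ hT₂ hiso₁ hiso₂ hz hne₁ hm).imp fun _ h => h.2
  obtain ⟨h, hh₁, hh₂⟩ := exists_hyperbolic_both hT₁ hT₂ hiso₁ hiso₂ hg hs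
  obtain ⟨h', h1, h2⟩ :=
    exists_endInSubtree_of_makesHeavy hT₁ hT₂ hiso₁ hiso₂ hγ₁ hγ₂ hh₁ hh₂
  exact ⟨h', h1.1, h2.1, h1.2, h2.2⟩

end Guirardel
end
end
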